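/- arXiv:2308.10246 — 6 statements merged into one kernel-verified Lean document; each statement's English description precedes it below -/
import Mathlib

section
/- Let p be a prime, let 0 ≤ m ≤ p−1, and let r ≥ (m+1)(p+1) be an integer such that r ≡ i mod p for some 0 ≤ i ≤ m−1 (equivalently, p divides the binomial coefficient C(r,m)). Then there is a G-equivariant isomorphism V_r / V_r^{(m+1)} ≅ (V_r / V_r^{(i+1)}) ⊕ (V_r^{(i+1)} / V_r^{(m+1)}). -/
open MvPolynomial

noncomputable section

/-- The action of a `2 × 2` matrix `g = [[a,b],[c,d]]` on `𝔽_p[X,Y]`: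
`(g·P)(X,Y) = P(aX+cY, bX+dY)`. -/
def gAct (p : ℕ) (g : Matrix (Fin 2) (Fin 2) (ZMod p)) :
    MvPolynomial (Fin 2) (ZMod p) →ₗ[ZMod p] MvPolynomial (Fin 2) (ZMod p) :=
  (aeval fun i => C (g 0 i) * X 0 + C (g 1 i) * X 1).toLinearMap

/-- The Dickson polynomial `θ = X^p·Y − X·Y^p`. -/
def theta (p : ℕ) : MvPolynomial (Fin 2) (ZMod p) :=
  X 0 ^ p * X 1 - X 0 * X 1 ^ p

end

section FrobeniusDerivation

variable (p : ℕ)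

/-- The derivation `X^p ∂/∂X + Y^p ∂/∂Y` of `𝔽_p[X,Y]`. -/
noncomputable def frobDeriv :
    Derivation (ZMod p) (MvPolynomial (Fin 2) (ZMod p)) (MvPolynomial (Fin 2) (ZMod p)) :=
  (X 0 ^ p : MvPolynomial (Fin 2) (ZMod p)) • pderiv 0 +
    (X 1 ^ p : MvPolynomial (Fin 2) (ZMod p)) • pderiv 1

/-- The `n`-th iterate of `frobDeriv p`, as a linear map. -/
noncomputable def frobIter (n : ℕ) :
    MvPolynomial (Fin 2) (ZMod p) →ₗ[ZMod p] MvPolynomial (Fin 2) (ZMod p) :=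
  (frobDeriv p).toLinearMap ^ n

variable {p}

theorem frobDeriv_apply (P : MvPolynomial (Fin 2) (ZMod p)) :
    frobDeriv p P = X 0 ^ p * pderiv 0 P + X 1 ^ p * pderiv 1 P := rfl

theorem frobDeriv_mul (P Q : MvPolynomial (Fin 2) (ZMod p)) :
    frobDeriv p (P * Q) = P * frobDeriv p Q + frobDeriv p P * Q := by
  rw [Derivation.leibniz, smul_eq_mul, smul_eq_mul, mul_comm Q]

theorem frobDeriv_X (j : Fin 2) : frobDeriv p (X j) = X j ^ p := by
  fin_cases j <;> simp [frobDeriv_apply, pderiv_X]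

theorem frobDeriv_pow_char (P : MvPolynomial (Fin 2) (ZMod p)) : frobDeriv p (P ^ p) = 0 := by
  rw [Derivation.leibniz_pow, nsmul_eq_mul, CharP.cast_eq_zero, zero_mul]

theorem frobDeriv_theta : frobDeriv p (theta p) = 0 := by
  rw [theta, map_sub, frobDeriv_mul, frobDeriv_mul, frobDeriv_pow_char, frobDeriv_pow_char,
    frobDeriv_X, frobDeriv_X]
  ring

theorem frobDeriv_theta_pow (k : ℕ) : frobDeriv p (theta p ^ k) = 0 := by
  rw [Derivation.leibniz_pow, frobDeriv_theta, smul_zero, smul_zero]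

theorem frobIter_zero (P : MvPolynomial (Fin 2) (ZMod p)) : frobIter p 0 P = P := rfl

theorem frobIter_succ (n : ℕ) (P : MvPolynomial (Fin 2) (ZMod p)) :
    frobIter p (n + 1) P = frobDeriv p (frobIter p n P) := by
  simp only [frobIter, pow_succ']; rfl

theorem frobIter_succ' (n : ℕ) (P : MvPolynomial (Fin 2) (ZMod p)) :
    frobIter p (n + 1) P = frobIter p n (frobDeriv p P) := by
  simp only [frobIter, pow_succ]; rfl

theorem frobIter_mul_of_frobDeriv_eq_zero {a : MvPolynomial (Fin 2) (ZMod p)}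
    (ha : frobDeriv p a = 0) (n : ℕ) (P : MvPolynomial (Fin 2) (ZMod p)) :
    frobIter p n (a * P) = a * frobIter p n P := by
  induction n with
  | zero => rfl
  | succ n ih => rw [frobIter_succ, ih, frobDeriv_mul, ha, zero_mul, add_zero, frobIter_succ]

theorem dvd_frobIter {k n : ℕ} {P : MvPolynomial (Fin 2) (ZMod p)} (h : theta p ^ k ∣ P) :
    theta p ^ k ∣ frobIter p n P := by
  obtain ⟨Q, rfl⟩ := h
  rw [frobIter_mul_of_frobDeriv_eq_zero (frobDeriv_theta_pow k)]
  exact dvd_mul_right _ _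

theorem frobIter_X_mul (j : Fin 2) (n : ℕ) (Q : MvPolynomial (Fin 2) (ZMod p)) :
    frobIter p (n + 1) (X j * Q) =
      X j * frobIter p (n + 1) Q + ((n + 1 : ℕ) : MvPolynomial (Fin 2) (ZMod p)) * (X j ^ p * frobIter p n Q) := by
  induction n with
  | zero =>
    simp only [frobIter_succ, frobIter_zero, frobDeriv_mul, frobDeriv_X]
    simp
  | succ n ih =>
    rw [frobIter_succ, ih, map_add, frobDeriv_mul, frobDeriv_mul, frobDeriv_mul,
      frobDeriv_pow_char, frobDeriv_X, Derivation.map_natCast, ← frobIter_succ, ← frobIter_succ]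
    push_cast
    ring

theorem MvPolynomial.IsHomogeneous.euler {s : ℕ} {P : MvPolynomial (Fin 2) (ZMod p)}
    (hP : P.IsHomogeneous s) : X 0 * pderiv 0 P + X 1 * pderiv 1 P = (s : MvPolynomial (Fin 2) (ZMod p)) * P := by
  simpa [Fin.sum_univ_two, nsmul_eq_mul] using hP.sum_X_mul_pderiv

theorem X_one_mul_frobDeriv {s : ℕ} {P : MvPolynomial (Fin 2) (ZMod p)}
    (hP : P.IsHomogeneous s) :
    X 1 * frobDeriv p P = theta p * pderiv 0 P + (s : MvPolynomial (Fin 2) (ZMod p)) * (X 1 ^ p * P) := by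
  rw [frobDeriv_apply, theta]
  linear_combination X 1 ^ p * hP.euler

theorem X_zero_mul_frobDeriv {s : ℕ} {P : MvPolynomial (Fin 2) (ZMod p)}
    (hP : P.IsHomogeneous s) :
    X 0 * frobDeriv p P = theta p * (-pderiv 1 P) +
      (s : MvPolynomial (Fin 2) (ZMod p)) * (X 0 ^ p * P) := by
  rw [frobDeriv_apply, theta]
  linear_combination X 0 ^ p * hP.euler

theorem isHomogeneous_theta : (theta p).IsHomogeneous (p + 1) := by
  refine ((isHomogeneous_X_pow 0 p).mul (isHomogeneous_X _ 1)).sub ?_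
  rw [add_comm]
  exact (isHomogeneous_X _ 0).mul (isHomogeneous_X_pow 1 p)

theorem isHomogeneous_theta_pow (k : ℕ) : (theta p ^ k).IsHomogeneous (k * (p + 1)) := by
  rw [mul_comm]
  exact isHomogeneous_theta.pow k

theorem MvPolynomial.IsHomogeneous.exists_eq_theta_pow_mul {k s : ℕ}
    {P : MvPolynomial (Fin 2) (ZMod p)} (hP : P.IsHomogeneous (k * (p + 1) + s))
    (h : theta p ^ k ∣ P) : ∃ F : MvPolynomial (Fin 2) (ZMod p),
      F.IsHomogeneous s ∧ P = theta p ^ k * F := by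
  obtain ⟨Q, rfl⟩ := h
  let _ : GradedAlgebra (homogeneousSubmodule (Fin 2) (ZMod p)) := gradedAlgebra
  refine ⟨DirectSum.decompose (homogeneousSubmodule (Fin 2) (ZMod p)) Q s,
    (DirectSum.decompose (homogeneousSubmodule (Fin 2) (ZMod p)) Q s).2, ?_⟩
  rw [← DirectSum.coe_decompose_mul_add_of_left_mem _ (isHomogeneous_theta_pow k)]
  exact (DirectSum.decompose_of_mem_same _ hP).symm

section Prime

variable [Fact p.Prime]

theorem X_zero_not_dvd_X_one_pow (n : ℕ) :
    ¬ (X 0 : MvPolynomial (Fin 2) (ZMod p)) ∣ X 1 ^ n := by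
  intro h
  have := X_dvd_X.1 (X_prime.dvd_of_dvd_pow h)
  exact absurd this (by decide)

theorem dvd_of_dvd_X_pow_mul {a Q : MvPolynomial (Fin 2) (ZMod p)} {n : ℕ}
    (h₀ : a ∣ X 0 ^ n * Q) (h₁ : a ∣ X 1 ^ n * Q) : a ∣ Q := by
  rcases eq_or_ne a 0 with rfl | ha
  · rw [zero_dvd_iff] at h₀ ⊢
    exact (mul_eq_zero.1 h₀).resolve_left (pow_ne_zero _ (X_ne_zero 0))
  obtain ⟨A, hA⟩ := h₀
  obtain ⟨B, hB⟩ := h₁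
  have hAB : X 1 ^ n * A = X 0 ^ n * B := by
    apply mul_left_cancel₀ ha
    linear_combination X 0 ^ n * hB - X 1 ^ n * hA
  obtain ⟨A', rfl⟩ := X_prime.pow_dvd_of_dvd_mul_left n (X_zero_not_dvd_X_one_pow n)
    (Dvd.intro _ hAB.symm)
  refine ⟨A', mul_left_cancel₀ (pow_ne_zero n (X_ne_zero (R := ZMod p) (0 : Fin 2))) ?_⟩
  rw [hA]
  ring

theorem theta_ne_zero : theta p ≠ 0 := by
  obtain ⟨q, hq⟩ := Nat.exists_eq_add_of_le (Fact.out : p.Prime).two_le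
  intro h
  apply X_zero_not_dvd_X_one_pow (p := p) p
  refine ⟨X 0 ^ q * X 1, mul_left_cancel₀ (X_ne_zero (R := ZMod p) (0 : Fin 2)) ?_⟩
  have h' : X 0 ^ p * X 1 - X 0 * X 1 ^ p = (0 : MvPolynomial (Fin 2) (ZMod p)) := h
  have hp : (X 0 : MvPolynomial (Fin 2) (ZMod p)) ^ p = X 0 ^ (2 + q) := by rw [← hq]
  rw [hp] at h'
  linear_combination -h'

theorem MvPolynomial.IsHomogeneous.frobDeriv {s : ℕ} {P : MvPolynomial (Fin 2) (ZMod p)}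
    (hP : P.IsHomogeneous s) : (frobDeriv p P).IsHomogeneous (s + (p - 1)) := by
  have hp := (Fact.out : p.Prime).one_le
  rcases Nat.eq_zero_or_pos s with rfl | hs
  · rw [← totalDegree_zero_iff_isHomogeneous, totalDegree_eq_zero_iff_eq_C] at hP
    rw [hP, ← algebraMap_eq, Derivation.map_algebraMap]
    exact isHomogeneous_zero _ _ _
  · rw [frobDeriv_apply, show s + (p - 1) = p + (s - 1) by omega]
    exact ((isHomogeneous_X_pow 0 p).mul hP.pderiv).add
      ((isHomogeneous_X_pow 1 p).mul hP.pderiv)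

theorem MvPolynomial.IsHomogeneous.frobIter {s : ℕ} {P : MvPolynomial (Fin 2) (ZMod p)}
    (hP : P.IsHomogeneous s) (n : ℕ) : (frobIter p n P).IsHomogeneous (s + n * (p - 1)) := by
  induction n with
  | zero => simpa [frobIter_zero] using hP
  | succ n ih =>
    rw [frobIter_succ, show s + (n + 1) * (p - 1) = s + n * (p - 1) + (p - 1) by ring]
    exact ih.frobDeriv

theorem theta_pow_dvd_frobIter {j s : ℕ} {P : MvPolynomial (Fin 2) (ZMod p)}
    (hP : P.IsHomogeneous s) (hj : j ≤ s) (hs : s ≡ j [MOD p]) :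
    theta p ^ (j + 1) ∣ frobIter p (j + 1) P := by
  induction j generalizing s P with
  | zero =>
    have hc : (s : MvPolynomial (Fin 2) (ZMod p)) = 0 :=
      (CharP.cast_eq_zero_iff _ p s).2 ((Nat.modEq_zero_iff_dvd).1 hs)
    have h₀ := X_zero_mul_frobDeriv hP
    have h₁ := X_one_mul_frobDeriv hP
    rw [hc, zero_mul, add_zero] at h₀ h₁
    rw [frobIter_succ, frobIter_zero]
    refine dvd_of_dvd_X_pow_mul (n := 1) ?_ ?_
    · rw [zero_add, pow_one, pow_one, h₀]; exact dvd_mul_right _ _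
    · rw [zero_add, pow_one, pow_one, h₁]; exact dvd_mul_right _ _
  | succ j ih =>
    have hc : (s : MvPolynomial (Fin 2) (ZMod p)) = (j + 1 : ℕ) :=
      (CharP.cast_eq_iff_mod_eq _ p).2 hs
    have hs' : s - 1 ≡ j [MOD p] := by
      apply Nat.ModEq.add_right_cancel' 1
      rwa [Nat.sub_add_cancel (by omega)]
    have key (l : Fin 2) (R : MvPolynomial (Fin 2) (ZMod p))
        (hR : theta p ^ (j + 1) ∣ frobIter p (j + 1) R)
        (h : X l * frobDeriv p P = theta p * R + (s : MvPolynomial (Fin 2) (ZMod p)) * (X l ^ p * P)) :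
        theta p ^ (j + 1 + 1) ∣ X l ^ 1 * frobIter p (j + 1 + 1) P := by
      have h' := congrArg (frobIter p (j + 1)) h
      rw [frobIter_X_mul, map_add, frobIter_mul_of_frobDeriv_eq_zero frobDeriv_theta,
        frobIter_mul_of_frobDeriv_eq_zero (Derivation.map_natCast _ s),
        frobIter_mul_of_frobDeriv_eq_zero (frobDeriv_pow_char _), hc,
        ← frobIter_succ' j P, add_left_inj, ← frobIter_succ'] at h'
      rw [pow_one, h', pow_succ' _ (j + 1)]
      exact mul_dvd_mul_left _ hR
    refine dvd_of_dvd_X_pow_mul (n := 1) (key 0 _ ?_ (X_zero_mul_frobDeriv hP))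
      (key 1 _ ?_ (X_one_mul_frobDeriv hP))
    · rw [map_neg, dvd_neg]
      exact ih hP.pderiv (by omega) hs'
    · exact ih hP.pderiv (by omega) hs'

theorem theta_dvd_of_dvd_frobDeriv {s : ℕ} {P : MvPolynomial (Fin 2) (ZMod p)}
    (hP : P.IsHomogeneous s) (hs : ¬ p ∣ s) (h : theta p ∣ frobDeriv p P) : theta p ∣ P := by
  have hc : IsUnit (s : MvPolynomial (Fin 2) (ZMod p)) := by
    rw [← map_natCast (C : ZMod p →+* MvPolynomial (Fin 2) (ZMod p))]
    refine IsUnit.map C (isUnit_iff_ne_zero.2 ?_)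
    rwa [Ne, CharP.cast_eq_zero_iff (ZMod p) p]
  refine dvd_of_dvd_X_pow_mul (n := p) ?_ ?_
  · rw [← hc.dvd_mul_left, ← dvd_add_right (dvd_mul_right (theta p) (-pderiv 1 P)),
      ← X_zero_mul_frobDeriv hP]
    exact h.mul_left _
  · rw [← hc.dvd_mul_left, ← dvd_add_right (dvd_mul_right (theta p) (pderiv 0 P)),
      ← X_one_mul_frobDeriv hP]
    exact h.mul_left _

theorem theta_dvd_of_dvd_frobIter {s n : ℕ} {P : MvPolynomial (Fin 2) (ZMod p)}
    (hP : P.IsHomogeneous s) (hs : ∀ l < n, ¬ p ∣ s + l * (p - 1))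
    (h : theta p ∣ frobIter p n P) : theta p ∣ P := by
  induction n with
  | zero => exact h
  | succ n ih =>
    rw [frobIter_succ] at h
    exact ih (fun l hl => hs l (by omega))
      (theta_dvd_of_dvd_frobDeriv (hP.frobIter n) (hs n (by omega)) h)

theorem exists_frobDeriv_sub_monomial {s a b : ℕ} (hs : ¬ p ∣ s) (hps : p ≤ s)
    (hab : a + b = s + (p - 1)) : ∃ F : MvPolynomial (Fin 2) (ZMod p),
      F.IsHomogeneous s ∧ theta p ∣ frobDeriv p F - X 0 ^ a * X 1 ^ b := by
  have hp := (Fact.out : p.Prime).two_le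
  have hc : (s : ZMod p) ≠ 0 := by rwa [Ne, CharP.cast_eq_zero_iff (ZMod p) p]
  have hinv : (C (s : ZMod p)⁻¹ : MvPolynomial (Fin 2) (ZMod p)) * (s : MvPolynomial (Fin 2) (ZMod p)) = 1 := by
    rw [← map_natCast (C : ZMod p →+* MvPolynomial (Fin 2) (ZMod p)), ← C_mul,
      inv_mul_cancel₀ hc, C_1]
  have hD (c d : ℕ) : frobDeriv p (C (s : ZMod p)⁻¹ * (X 0 ^ c * X 1 ^ d)) =
      C (s : ZMod p)⁻¹ * ((c : MvPolynomial (Fin 2) (ZMod p)) * (X 0 ^ (c - 1) * X 0 ^ p * X 1 ^ d) +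
        (d : MvPolynomial (Fin 2) (ZMod p)) * (X 0 ^ c * (X 1 ^ (d - 1) * X 1 ^ p))) := by
    rw [frobDeriv_mul, frobDeriv_mul, ← algebraMap_eq, Derivation.map_algebraMap,
      Derivation.leibniz_pow, Derivation.leibniz_pow, frobDeriv_X, frobDeriv_X]
    simp only [nsmul_eq_mul, smul_eq_mul]
    ring
  have hhom (c d : ℕ) (hcd : c + d = s) :
      (C (s : ZMod p)⁻¹ * (X 0 ^ c * X 1 ^ d) : MvPolynomial (Fin 2) (ZMod p)).IsHomogeneous s := by
    refine IsHomogeneous.C_mul ?_ _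
    rw [← hcd]
    exact (isHomogeneous_X_pow 0 c).mul (isHomogeneous_X_pow 1 d)
  rcases le_or_gt p a with ha | ha
  · obtain ⟨c, rfl⟩ := Nat.exists_eq_add_of_le ha
    obtain rfl : s = c + 1 + b := by omega
    refine ⟨_, hhom (c + 1) b rfl, ?_⟩
    rw [hD]
    rcases b with - | d
    · refine ⟨0, ?_⟩
      simp only [Nat.add_sub_cancel]
      push_cast at hinv ⊢
      linear_combination (X 0 ^ c * X 0 ^ p) * hinv
    · refine ⟨-(C (((c + 1 + (d + 1) : ℕ) : ZMod p)⁻¹) * ((d + 1 : ℕ) : MvPolynomial (Fin 2) (ZMod p)) * (X 0 ^ c * X 1 ^ d)), ?_⟩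
      simp only [Nat.add_sub_cancel, theta]
      push_cast at hinv ⊢
      linear_combination (X 0 ^ c * X 0 ^ p * X 1 ^ (d + 1)) * hinv
  · obtain ⟨d, rfl⟩ := Nat.exists_eq_add_of_le (show p ≤ b by omega)
    obtain rfl : s = a + (d + 1) := by omega
    refine ⟨_, hhom a (d + 1) rfl, ?_⟩
    rw [hD]
    rcases a with - | c
    · refine ⟨0, ?_⟩
      simp only [Nat.add_sub_cancel]
      push_cast at hinv ⊢
      linear_combination (X 1 ^ d * X 1 ^ p) * hinv
    · refine ⟨C (((c + 1 + (d + 1) : ℕ) : ZMod p)⁻¹) * ((c + 1 : ℕ) : MvPolynomial (Fin 2) (ZMod p)) * (X 0 ^ c * X 1 ^ d), ?_⟩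
      simp only [Nat.add_sub_cancel, theta]
      push_cast at hinv ⊢
      linear_combination (X 1 ^ d * X 1 ^ p * X 0 ^ (c + 1)) * hinv

theorem exists_frobDeriv_sub {s : ℕ} (hs : ¬ p ∣ s) (hps : p ≤ s)
    {G : MvPolynomial (Fin 2) (ZMod p)} (hG : G.IsHomogeneous (s + (p - 1))) :
    ∃ F : MvPolynomial (Fin 2) (ZMod p), F.IsHomogeneous s ∧ theta p ∣ frobDeriv p F - G := by
  have hmon (d : Fin 2 →₀ ℕ) (hd : d ∈ G.support) : ∃ F : MvPolynomial (Fin 2) (ZMod p),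
      F.IsHomogeneous s ∧ theta p ∣ frobDeriv p F - monomial d (coeff d G) := by
    have hdeg : d 0 + d 1 = s + (p - 1) := by
      rw [← Fin.sum_univ_two, ← Finsupp.degree_eq_sum]
      by_contra h
      exact (mem_support_iff.1 hd) (hG.coeff_eq_zero h)
    obtain ⟨F, hF, hdvd⟩ := exists_frobDeriv_sub_monomial hs hps hdeg
    refine ⟨C (coeff d G) * F, hF.C_mul _, ?_⟩
    rw [frobDeriv_mul, ← algebraMap_eq, Derivation.map_algebraMap, zero_mul, add_zero,
      algebraMap_eq, monomial_eq, Finsupp.prod_fintype _ _ (by simp), Fin.prod_univ_two,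
      ← mul_sub]
    exact hdvd.mul_left _
  choose! f hf hdvd using hmon
  refine ⟨∑ d ∈ G.support, f d, IsHomogeneous.sum _ _ _ hf, ?_⟩
  nth_rw 2 [G.as_sum]
  rw [map_sum, ← Finset.sum_sub_distrib]
  exact Finset.dvd_sum hdvd

theorem exists_frobIter_sub {s n : ℕ} (hs : ∀ l < n, ¬ p ∣ s + l * (p - 1)) (hps : p ≤ s)
    {G : MvPolynomial (Fin 2) (ZMod p)} (hG : G.IsHomogeneous (s + n * (p - 1))) :
    ∃ F : MvPolynomial (Fin 2) (ZMod p), F.IsHomogeneous s ∧ theta p ∣ frobIter p n F - G := by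
  induction n generalizing G with
  | zero => exact ⟨G, by simpa using hG, by simp [frobIter_zero]⟩
  | succ n ih =>
    obtain ⟨F', hF', h'⟩ := exists_frobDeriv_sub (hs n (by omega)) (by omega)
      (show G.IsHomogeneous (s + n * (p - 1) + (p - 1)) by convert hG using 1; ring)
    obtain ⟨F, hF, h⟩ := ih (fun l hl => hs l (by omega)) hF'
    refine ⟨F, hF, ?_⟩
    have h₂ : theta p ^ 1 ∣ frobIter p 1 (frobIter p n F - F') := dvd_frobIter (by simpa using h)
    rw [pow_one, frobIter_succ, frobIter_zero, map_sub, ← frobIter_succ] at h₂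
    simpa using h₂.add h'

theorem gAct_mul (g : Matrix (Fin 2) (Fin 2) (ZMod p)) (P Q : MvPolynomial (Fin 2) (ZMod p)) :
    gAct p g (P * Q) = gAct p g P * gAct p g Q := by
  simp [gAct]

theorem gAct_pow (g : Matrix (Fin 2) (Fin 2) (ZMod p)) (P : MvPolynomial (Fin 2) (ZMod p))
    (n : ℕ) : gAct p g (P ^ n) = gAct p g P ^ n := by
  simp [gAct]

theorem gAct_X (g : Matrix (Fin 2) (Fin 2) (ZMod p)) (j : Fin 2) :
    gAct p g (X j) = C (g 0 j) * X 0 + C (g 1 j) * X 1 := by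
  simp [gAct]

theorem gAct_X_pow (g : Matrix (Fin 2) (Fin 2) (ZMod p)) (j : Fin 2) :
    gAct p g (X j ^ p) = C (g 0 j) * X 0 ^ p + C (g 1 j) * X 1 ^ p := by
  rw [gAct_pow, gAct_X, add_pow_char, mul_pow, mul_pow, ← C_pow, ← C_pow, ZMod.pow_card,
    ZMod.pow_card]

theorem gAct_theta (g : Matrix (Fin 2) (Fin 2) (ZMod p)) :
    gAct p g (theta p) = C g.det * theta p := by
  rw [theta, map_sub, gAct_mul, gAct_mul, gAct_X_pow, gAct_X_pow, gAct_X, gAct_X,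
    Matrix.det_fin_two, C_sub, C_mul, C_mul]
  ring

theorem theta_pow_dvd_gAct (g : Matrix (Fin 2) (Fin 2) (ZMod p)) {k : ℕ}
    {P : MvPolynomial (Fin 2) (ZMod p)} (h : theta p ^ k ∣ P) : theta p ^ k ∣ gAct p g P := by
  obtain ⟨Q, rfl⟩ := h
  rw [gAct_mul, gAct_pow, gAct_theta]
  exact (pow_dvd_pow_of_dvd (dvd_mul_left _ _) k).mul_right _

theorem MvPolynomial.IsHomogeneous.gAct {s : ℕ} {P : MvPolynomial (Fin 2) (ZMod p)}
    (hP : P.IsHomogeneous s) (g : Matrix (Fin 2) (Fin 2) (ZMod p)) :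
    (gAct p g P).IsHomogeneous s := by
  have := hP.aeval
    (fun j => (C (g 0 j) * X 0 + C (g 1 j) * X 1 : MvPolynomial (Fin 2) (ZMod p))) (n := 1)
    (fun j => (isHomogeneous_C_mul_X _ 0).add (isHomogeneous_C_mul_X _ 1))
  rw [one_mul] at this
  exact this

theorem frobDeriv_gAct (g : Matrix (Fin 2) (Fin 2) (ZMod p))
    (P : MvPolynomial (Fin 2) (ZMod p)) :
    frobDeriv p (gAct p g P) = gAct p g (frobDeriv p P) := by
  induction P using MvPolynomial.induction_on with
  | C a => simp [gAct, ← algebraMap_eq]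
  | add P Q hP hQ => simp only [map_add, hP, hQ]
  | mul_X P j hP =>
    rw [gAct_mul, frobDeriv_mul, frobDeriv_mul, map_add, gAct_mul, gAct_mul, hP, frobDeriv_X,
      gAct_X_pow, gAct_X, map_add, frobDeriv_mul, frobDeriv_mul, frobDeriv_X, frobDeriv_X,
      ← algebraMap_eq, Derivation.map_algebraMap, Derivation.map_algebraMap]
    ring

theorem frobIter_gAct (g : Matrix (Fin 2) (Fin 2) (ZMod p)) (n : ℕ)
    (P : MvPolynomial (Fin 2) (ZMod p)) :
    frobIter p n (gAct p g P) = gAct p g (frobIter p n P) := by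
  induction n with
  | zero => rfl
  | succ n ih => rw [frobIter_succ, ih, frobDeriv_gAct, frobIter_succ]

theorem not_dvd_of_modEq {i k l s : ℕ} (hcong : k * (p + 1) + s ≡ i [MOD p]) (hik : i < k)
    (hkp : k < p) (hl : l ≤ i) : ¬ p ∣ s + l * (p - 1) := by
  have hp := (Fact.out : p.Prime).one_le
  intro h
  have hd : ((s + l * (p - 1) : ℕ) : ZMod p) = 0 := (CharP.cast_eq_zero_iff _ p _).2 h
  have hc : ((k * (p + 1) + s : ℕ) : ZMod p) = i := (CharP.cast_eq_iff_mod_eq _ p).2 hcong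
  have h0 : ((k - i + l : ℕ) : ZMod p) = 0 := by
    push_cast [Nat.cast_sub hp, Nat.cast_sub hik.le, CharP.cast_eq_zero (ZMod p) p] at hc hd ⊢
    linear_combination hc - hd
  rw [CharP.cast_eq_zero_iff (ZMod p) p] at h0
  exact absurd (Nat.le_of_dvd (by omega) h0) (by omega)

theorem theta_pow_dvd_of_dvd_frobIter {m r i : ℕ} (hm : m < p) (hr : (m + 1) * (p + 1) ≤ r)
    (hcong : r ≡ i [MOD p]) {P : MvPolynomial (Fin 2) (ZMod p)} (hP : P.IsHomogeneous r)
    (hdvd : theta p ^ (i + 1) ∣ P) (h : theta p ^ (m + 1) ∣ frobIter p (i + 1) P) :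
    theta p ^ (m + 1) ∣ P := by
  suffices H : ∀ k, i + 1 + k ≤ m + 1 → theta p ^ (i + 1 + k) ∣ P by
    rcases le_total m i with hmi | hmi
    · exact (pow_dvd_pow _ (by omega)).trans hdvd
    · simpa [show i + 1 + (m - i) = m + 1 by omega] using H (m - i) (by omega)
  intro k
  induction k with
  | zero => exact fun _ => hdvd
  | succ k ih =>
    intro hk
    have hle : (i + 1 + k) * (p + 1) ≤ r :=
      (Nat.mul_le_mul_right _ (show i + 1 + k ≤ m + 1 by omega)).trans hr
    obtain ⟨s, rfl⟩ := Nat.exists_eq_add_of_le hle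
    obtain ⟨F, hF, rfl⟩ := hP.exists_eq_theta_pow_mul (ih (by omega))
    rw [frobIter_mul_of_frobDeriv_eq_zero (frobDeriv_theta_pow _)] at h
    have h' := (pow_dvd_pow (theta p) hk).trans h
    rw [← add_assoc, pow_succ] at h' ⊢
    refine mul_dvd_mul_left _ (theta_dvd_of_dvd_frobIter hF (n := i + 1) (fun l hl => ?_)
      ((mul_dvd_mul_iff_left (pow_ne_zero _ theta_ne_zero)).1 h'))
    exact not_dvd_of_modEq hcong (by omega) (by omega) (by omega)

theorem exists_theta_pow_dvd_frobIter_sub {m r i : ℕ} (hm : m < p) (hi : i ≤ m)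
    (hr : (m + 1) * (p + 1) ≤ r) (hcong : r ≡ i [MOD p])
    {P : MvPolynomial (Fin 2) (ZMod p)} (hP : P.IsHomogeneous r) :
    ∃ Q : MvPolynomial (Fin 2) (ZMod p), Q.IsHomogeneous r ∧ theta p ^ (i + 1) ∣ Q ∧
      theta p ^ (m + 1) ∣ frobIter p (i + 1) (P - Q) := by
  suffices H : ∀ k, i + 1 + k ≤ m + 1 → ∃ Q : MvPolynomial (Fin 2) (ZMod p),
      Q.IsHomogeneous r ∧ theta p ^ (i + 1) ∣ Q ∧
        theta p ^ (i + 1 + k) ∣ frobIter p (i + 1) (P - Q) by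
    simpa [show i + 1 + (m - i) = m + 1 by omega] using H (m - i) (by omega)
  intro k
  induction k with
  | zero =>
    refine fun _ => ⟨0, isHomogeneous_zero _ _ _, dvd_zero _, ?_⟩
    rw [sub_zero]
    refine theta_pow_dvd_frobIter hP ?_ hcong
    nlinarith
  | succ k ih =>
    intro hk
    obtain ⟨Q, hQ, hdvd, h⟩ := ih (by omega)
    have hle : (i + 1 + k + 1) * (p + 1) ≤ r := (Nat.mul_le_mul_right _ hk).trans hr
    obtain ⟨s, rfl⟩ := Nat.exists_eq_add_of_le
      ((Nat.mul_le_mul_right (p + 1) (Nat.le_succ (i + 1 + k))).trans hle)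
    have hhom := (hP.sub hQ).frobIter (i + 1)
    rw [add_assoc] at hhom
    obtain ⟨G, hG, hGeq⟩ := hhom.exists_eq_theta_pow_mul h
    obtain ⟨F, hF, hFG⟩ := exists_frobIter_sub (s := s) (n := i + 1) (fun l hl =>
      not_dvd_of_modEq hcong (by omega) (by omega) (by omega)) (by nlinarith) hG
    refine ⟨Q + theta p ^ (i + 1 + k) * F, hQ.add ((isHomogeneous_theta_pow _).mul hF),
      dvd_add hdvd ((pow_dvd_pow _ (by omega)).mul_right _), ?_⟩
    rw [← sub_sub, map_sub, hGeq, frobIter_mul_of_frobDeriv_eq_zero (frobDeriv_theta_pow _),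
      ← mul_sub, ← add_assoc, pow_succ]
    exact mul_dvd_mul_left _ ((dvd_sub_comm).1 hFG)

end Prime

end FrobeniusDerivation

/-- A relation `R(x, y) ⇔ T (x - y) ∈ W` between a subspace `V` and a subspace `N`, total on `V`,
contains the graph of a linear map. -/
theorem LinearMap.exists_linear_choice {K E : Type*} [Field K] [AddCommGroup E] [Module K E]
    (V N W : Submodule K E) (T : E →ₗ[K] E) (h : ∀ x ∈ V, ∃ y ∈ N, T (x - y) ∈ W) :
    ∃ Φ : E →ₗ[K] E, ∀ x ∈ V, Φ x ∈ N ∧ T (x - Φ x) ∈ W := by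
  let L : N →ₗ[K] E ⧸ W := W.mkQ ∘ₗ T ∘ₗ N.subtype
  have hL (x : V) : (W.mkQ ∘ₗ T ∘ₗ V.subtype) x ∈ LinearMap.range L := by
    obtain ⟨y, hy, hxy⟩ := h x x.2
    rw [map_sub] at hxy
    exact ⟨⟨y, hy⟩, ((Submodule.Quotient.eq W).2 hxy).symm⟩
  obtain ⟨f, hf⟩ := Module.projective_lifting_property L.rangeRestrict
    ((W.mkQ ∘ₗ T ∘ₗ V.subtype).codRestrict _ hL) L.surjective_rangeRestrict
  obtain ⟨Φ, hΦ⟩ := LinearMap.exists_extend (N.subtype ∘ₗ f)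
  refine ⟨Φ, fun x hx => ?_⟩
  have hx' : Φ x = f ⟨x, hx⟩ := LinearMap.congr_fun hΦ ⟨x, hx⟩
  rw [hx', map_sub]
  refine ⟨(f ⟨x, hx⟩).2, (Submodule.Quotient.eq W).1 ?_⟩
  exact (congrArg Subtype.val (LinearMap.congr_fun hf ⟨x, hx⟩)).symm


/-- if `0 ≤ i ≤ m−1 ≤ p−2`, `r ≥ (m+1)(p+1)` and `r ≡ i mod p`, then there is a
`G`-equivariant isomorphism `V_r / V_r^{(m+1)} ≅ (V_r / V_r^{(i+1)}) ⊕ (V_r^{(i+1)} / V_r^{(m+1)})`,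
expressed here by a pair of linear maps `Φ₁`, `Φ₂` lifting the two components of the
isomorphism. -/
theorem theta_filtration_splits (p : ℕ) [Fact p.Prime] (m r i : ℕ)
    (hm : m ≤ p - 1) (hi : i + 1 ≤ m) (hr : (m + 1) * (p + 1) ≤ r)
    (hcong : r ≡ i [MOD p]) :
    ∃ Φ₁ Φ₂ : MvPolynomial (Fin 2) (ZMod p) →ₗ[ZMod p] MvPolynomial (Fin 2) (ZMod p),
      -- `Φ₁` maps `V_r` to `V_r` (representing `V_r / V_r^{(i+1)}`)
      (∀ P ∈ homogeneousSubmodule (Fin 2) (ZMod p) r,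
          Φ₁ P ∈ homogeneousSubmodule (Fin 2) (ZMod p) r) ∧
      -- `Φ₂` maps `V_r` to `V_r^{(i+1)}` (representing `V_r^{(i+1)} / V_r^{(m+1)}`)
      (∀ P ∈ homogeneousSubmodule (Fin 2) (ZMod p) r,
          Φ₂ P ∈ homogeneousSubmodule (Fin 2) (ZMod p) r ∧ theta p ^ (i + 1) ∣ Φ₂ P) ∧
      -- well-definedness on the quotient `V_r / V_r^{(m+1)}`
      (∀ P ∈ homogeneousSubmodule (Fin 2) (ZMod p) r, theta p ^ (m + 1) ∣ P →
          theta p ^ (i + 1) ∣ Φ₁ P ∧ theta p ^ (m + 1) ∣ Φ₂ P) ∧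
      -- injectivity of the induced map
      (∀ P ∈ homogeneousSubmodule (Fin 2) (ZMod p) r,
          theta p ^ (i + 1) ∣ Φ₁ P → theta p ^ (m + 1) ∣ Φ₂ P →
            theta p ^ (m + 1) ∣ P) ∧
      -- surjectivity of the induced map
      (∀ Q₁ ∈ homogeneousSubmodule (Fin 2) (ZMod p) r,
          ∀ Q₂ ∈ homogeneousSubmodule (Fin 2) (ZMod p) r, theta p ^ (i + 1) ∣ Q₂ →
            ∃ P ∈ homogeneousSubmodule (Fin 2) (ZMod p) r,
              theta p ^ (i + 1) ∣ (Φ₁ P - Q₁) ∧ theta p ^ (m + 1) ∣ (Φ₂ P - Q₂)) ∧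
      -- `G`-equivariance of the induced map
      (∀ g : Matrix.GeneralLinearGroup (Fin 2) (ZMod p),
          ∀ P ∈ homogeneousSubmodule (Fin 2) (ZMod p) r,
            theta p ^ (i + 1) ∣ (Φ₁ (gAct p g.val P) - gAct p g.val (Φ₁ P)) ∧
            theta p ^ (m + 1) ∣ (Φ₂ (gAct p g.val P) - gAct p g.val (Φ₂ P))) := by
  have hp := (Fact.out : p.Prime).one_le
  let dvdSub (k : ℕ) : Submodule (ZMod p) (MvPolynomial (Fin 2) (ZMod p)) :=
    (Ideal.span {theta p ^ k}).restrictScalars (ZMod p)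
  have mem_dvdSub (k : ℕ) (P : MvPolynomial (Fin 2) (ZMod p)) :
      P ∈ dvdSub k ↔ theta p ^ k ∣ P := Ideal.mem_span_singleton
  obtain ⟨Φ, hΦ⟩ := LinearMap.exists_linear_choice (homogeneousSubmodule (Fin 2) (ZMod p) r)
    (homogeneousSubmodule (Fin 2) (ZMod p) r ⊓ dvdSub (i + 1)) (dvdSub (m + 1))
    (frobIter p (i + 1)) (fun P hP => by
      obtain ⟨Q, hQ, hdvd, h⟩ := exists_theta_pow_dvd_frobIter_sub (m := m) (by omega)
        (by omega) hr hcong hP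
      exact ⟨Q, ⟨hQ, (mem_dvdSub _ _).2 hdvd⟩, (mem_dvdSub _ _).2 h⟩)
  have hΦhom (P) (hP : P ∈ homogeneousSubmodule (Fin 2) (ZMod p) r) :
      Φ P ∈ homogeneousSubmodule (Fin 2) (ZMod p) r := (hΦ P hP).1.1
  have hΦdvd (P) (hP : P ∈ homogeneousSubmodule (Fin 2) (ZMod p) r) :
      theta p ^ (i + 1) ∣ Φ P := (mem_dvdSub _ _).1 (hΦ P hP).1.2
  have hΦiter (P) (hP : P ∈ homogeneousSubmodule (Fin 2) (ZMod p) r) :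
      theta p ^ (m + 1) ∣ frobIter p (i + 1) P - frobIter p (i + 1) (Φ P) := by
    rw [← map_sub]
    exact (mem_dvdSub _ _).1 (hΦ P hP).2
  have hinj (P) (hP : P ∈ homogeneousSubmodule (Fin 2) (ZMod p) r)
      (hdvd : theta p ^ (i + 1) ∣ P) (h : theta p ^ (m + 1) ∣ frobIter p (i + 1) P) :
      theta p ^ (m + 1) ∣ P :=
    theta_pow_dvd_of_dvd_frobIter (by omega) hr hcong hP hdvd h
  have hle : theta p ^ (i + 1) ∣ theta p ^ (m + 1) := pow_dvd_pow _ (by omega)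
  refine ⟨LinearMap.id, Φ, fun P hP => hP, fun P hP => ⟨hΦhom P hP, hΦdvd P hP⟩,
    fun P hP h => ⟨hle.trans h, ?_⟩, fun P hP h₁ h₂ => ?_, fun Q₁ hQ₁ Q₂ hQ₂ h => ?_,
    fun g P hP => ⟨by simp, ?_⟩⟩
  · exact hinj _ (hΦhom P hP) (hΦdvd P hP)
      ((dvd_sub_right (dvd_frobIter h)).1 (hΦiter P hP))
  · exact hinj P hP h₁ ((dvd_sub_left (dvd_frobIter h₂)).1 (hΦiter P hP))
  · have hP : Q₁ - Φ Q₁ + Q₂ ∈ homogeneousSubmodule (Fin 2) (ZMod p) r :=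
      add_mem (sub_mem hQ₁ (hΦhom Q₁ hQ₁)) hQ₂
    refine ⟨Q₁ - Φ Q₁ + Q₂, hP, ?_, ?_⟩
    · have := h.sub (hΦdvd Q₁ hQ₁)
      convert this using 1
      rw [LinearMap.id_apply]
      abel
    · refine hinj _ (sub_mem (hΦhom _ hP) hQ₂) ((hΦdvd _ hP).sub h) ?_
      have := (hΦiter Q₁ hQ₁).sub (hΦiter _ hP)
      rw [map_add (frobIter p (i + 1)), map_sub (frobIter p (i + 1))] at this
      rw [map_sub (frobIter p (i + 1))]
      convert this using 1
      abel
  · have hgP : gAct p g.val P ∈ homogeneousSubmodule (Fin 2) (ZMod p) r :=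
      IsHomogeneous.gAct hP g.val
    refine hinj _ (sub_mem (hΦhom _ hgP) (IsHomogeneous.gAct (hΦhom P hP) g.val))
      ((hΦdvd _ hgP).sub (theta_pow_dvd_gAct _ (hΦdvd P hP))) ?_
    have := (theta_pow_dvd_gAct g.val (hΦiter P hP)).sub (hΦiter _ hgP)
    rw [map_sub (gAct p g.val), ← frobIter_gAct, ← frobIter_gAct] at this
    rw [map_sub (frobIter p (i + 1))]
    convert this using 1
    abel
end

section
/- Let p be a prime, let 0 ≤ m ≤ p−1, and let r, s ≥ (m+1)(p+1) be integers with r ≡ s mod (p−1), p ∤ C(r,m) and p ∤ C(s,m) (binomial coefficients). Then there is a G-equivariant isomorphism V_r / V_r^{(m+1)} ≅ V_s / V_s^{(m+1)}. -/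
open MvPolynomial

namespace ThetaQuotient

noncomputable section

variable {p : ℕ}

/-- The substitution `X ↦ 1`, `Y ↦ y`. -/
def dehom (p : ℕ) : MvPolynomial (Fin 2) (ZMod p) →ₐ[ZMod p] Polynomial (ZMod p) :=
  aeval ![1, Polynomial.X]

/-- The coefficient of `y ^ i` in `P(1, y)`. -/
def jet (p i : ℕ) : MvPolynomial (Fin 2) (ZMod p) →ₗ[ZMod p] ZMod p :=
  Polynomial.lcoeff (ZMod p) i ∘ₗ (dehom p).toLinearMap

theorem jet_apply (i : ℕ) (P : MvPolynomial (Fin 2) (ZMod p)) :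
    jet p i P = (dehom p P).coeff i := rfl

theorem dehom_X_zero : dehom p (X 0) = 1 := by simp [dehom]

theorem dehom_X_one : dehom p (X 1) = Polynomial.X := by simp [dehom]

theorem dehom_C (a : ZMod p) : dehom p (C a) = Polynomial.C a := by
  simp [dehom]

theorem gAct_mul (g : Matrix (Fin 2) (Fin 2) (ZMod p)) (P Q : MvPolynomial (Fin 2) (ZMod p)) :
    gAct p g (P * Q) = gAct p g P * gAct p g Q := by simp [gAct]

theorem gAct_pow (g : Matrix (Fin 2) (Fin 2) (ZMod p)) (P : MvPolynomial (Fin 2) (ZMod p))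
    (n : ℕ) : gAct p g (P ^ n) = gAct p g P ^ n := by simp [gAct]

theorem gAct_C (g : Matrix (Fin 2) (Fin 2) (ZMod p)) (a : ZMod p) :
    gAct p g (C a) = C a := by simp [gAct, algebraMap_eq]

theorem gAct_X (g : Matrix (Fin 2) (Fin 2) (ZMod p)) (i : Fin 2) :
    gAct p g (X i) = C (g 0 i) * X 0 + C (g 1 i) * X 1 := by simp [gAct]

theorem gAct_dvd (g : Matrix (Fin 2) (Fin 2) (ZMod p)) {P Q : MvPolynomial (Fin 2) (ZMod p)}
    (h : P ∣ Q) : gAct p g P ∣ gAct p g Q := by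
  obtain ⟨R, rfl⟩ := h
  exact ⟨gAct p g R, gAct_mul g P R⟩

theorem gAct_gAct (g h : Matrix (Fin 2) (Fin 2) (ZMod p)) (P : MvPolynomial (Fin 2) (ZMod p)) :
    gAct p g (gAct p h P) = gAct p (g * h) P := by
  induction P using MvPolynomial.induction_on with
  | C a => simp only [gAct_C]
  | add P Q hP hQ => simp only [map_add, hP, hQ]
  | mul_X P i hP =>
    simp only [gAct_mul, hP, gAct_X, map_add, gAct_C, Matrix.mul_apply, Fin.sum_univ_two, map_mul]
    ring

theorem gAct_one (P : MvPolynomial (Fin 2) (ZMod p)) :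
    gAct p 1 P = P := by
  induction P using MvPolynomial.induction_on with
  | C a => simp only [gAct_C]
  | add P Q hP hQ => simp only [map_add, hP, hQ]
  | mul_X P i hP =>
    rw [gAct_mul, hP, gAct_X]
    congr 1
    fin_cases i <;> simp [Matrix.one_apply]

theorem gAct_mem (g : Matrix (Fin 2) (Fin 2) (ZMod p)) {n : ℕ}
    {P : MvPolynomial (Fin 2) (ZMod p)} (hP : P ∈ homogeneousSubmodule (Fin 2) (ZMod p) n) :
    gAct p g P ∈ homogeneousSubmodule (Fin 2) (ZMod p) n := by
  rw [mem_homogeneousSubmodule] at hP ⊢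
  simpa using! hP.aeval (fun i => C (g 0 i) * X 0 + C (g 1 i) * X 1)
    (fun i => (isHomogeneous_C_mul_X _ _).add (isHomogeneous_C_mul_X _ _))

theorem gAct_theta [Fact p.Prime] (g : Matrix (Fin 2) (Fin 2) (ZMod p)) :
    gAct p g (theta p) = C g.det * theta p := by
  simp only [theta, map_sub, gAct_mul, gAct_pow, gAct_X, add_pow_char, mul_pow, ← C_pow,
    ZMod.pow_card, Matrix.det_fin_two, C_mul]
  ring

/-- A homogeneous polynomial is determined by its jets. -/
theorem eq_sum_jet {n : ℕ} {P : MvPolynomial (Fin 2) (ZMod p)}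
    (hP : P ∈ homogeneousSubmodule (Fin 2) (ZMod p) n) :
    P = ∑ j ∈ Finset.range (n + 1), C (jet p j P) * (X 0 ^ (n - j) * X 1 ^ j) := by
  rw [mem_homogeneousSubmodule] at hP
  have hmon (d : Fin 2 →₀ ℕ) (a : ZMod p) (hd : d 0 + d 1 = n) :
      monomial d a = ∑ j ∈ Finset.range (n + 1),
        C (jet p j (monomial d a)) * (X 0 ^ (n - j) * X 1 ^ j) := by
    have h1 : monomial d a = C a * (X 0 ^ d 0 * X 1 ^ d 1) := by
      rw [monomial_eq, Finsupp.prod_fintype _ _ (by simp), Fin.prod_univ_two]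
    have h2 (j : ℕ) : jet p j (monomial d a) = if j = d 1 then a else 0 := by
      rw [jet_apply, h1]
      simp only [map_mul, map_pow, dehom_C, dehom_X_zero, dehom_X_one, one_pow, one_mul,
        Polynomial.coeff_C_mul, Polynomial.coeff_X_pow, mul_ite, mul_one, mul_zero]
    rw [Finset.sum_eq_single_of_mem (d 1) (by rw [Finset.mem_range]; lia)]
    · rw [h2, if_pos rfl, h1, show n - d 1 = d 0 by lia]
    · intro j _ hj
      rw [h2, if_neg hj, C_0, zero_mul]
  calc P = ∑ d ∈ P.support, monomial d (coeff d P) := P.as_sum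
    _ = ∑ d ∈ P.support, ∑ j ∈ Finset.range (n + 1),
        C (jet p j (monomial d (coeff d P))) * (X 0 ^ (n - j) * X 1 ^ j) := by
      refine Finset.sum_congr rfl fun d hd => hmon d _ ?_
      have := hP (mem_support_iff.1 hd)
      simpa [Finsupp.weight_apply, Finsupp.sum_fintype] using this
    _ = ∑ j ∈ Finset.range (n + 1),
        C (jet p j (∑ d ∈ P.support, monomial d (coeff d P))) * (X 0 ^ (n - j) * X 1 ^ j) := by
      rw [Finset.sum_comm]
      simp only [map_sum, Finset.sum_mul]
    _ = _ := by rw [← P.as_sum]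

theorem jet_eq_zero_of_dvd {m i : ℕ} (hi : i ≤ m) {P : MvPolynomial (Fin 2) (ZMod p)}
    (h : X 1 ^ (m + 1) ∣ P) : jet p i P = 0 := by
  have h' := map_dvd (dehom p) h
  rw [map_pow, dehom_X_one, Polynomial.X_pow_dvd_iff] at h'
  exact h' i (by lia)

theorem X_pow_dvd_iff_jet {n m : ℕ} {P : MvPolynomial (Fin 2) (ZMod p)}
    (hP : P ∈ homogeneousSubmodule (Fin 2) (ZMod p) n) :
    X 1 ^ (m + 1) ∣ P ↔ ∀ i ≤ m, jet p i P = 0 := by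
  refine ⟨fun h i hi => jet_eq_zero_of_dvd hi h, fun h => ?_⟩
  rw [eq_sum_jet hP]
  refine Finset.dvd_sum fun j _ => ?_
  rcases Nat.lt_or_ge m j with hj | hj
  · exact ((pow_dvd_pow _ hj).mul_left _).mul_left _
  · simp [h j hj]

theorem coeff_linear_pow (a c : ZMod p) (n k : ℕ) :
    ((Polynomial.C a + Polynomial.C c * Polynomial.X) ^ n).coeff k =
      a ^ (n - k) * n.choose k * c ^ k := by
  have : (Polynomial.C a + Polynomial.C c * Polynomial.X) ^ n =
      ((Polynomial.X + Polynomial.C a) ^ n).comp (Polynomial.C c * Polynomial.X) := by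
    simp [add_comm]
  rw [this, Polynomial.comp_C_mul_X_coeff, Polynomial.coeff_X_add_C_pow]

/-- The jets of `b · P` for `b` lower triangular. -/
theorem jet_gAct_of_lower {n i : ℕ} (hi : i ≤ n) {P : MvPolynomial (Fin 2) (ZMod p)}
    (hP : P ∈ homogeneousSubmodule (Fin 2) (ZMod p) n)
    {g : Matrix (Fin 2) (Fin 2) (ZMod p)} (hg : g 0 1 = 0) :
    jet p i (gAct p g P) = ∑ j ∈ Finset.range (i + 1),
      jet p j P * ((n - j).choose (i - j) *
        (g 0 0 ^ (n - i) * g 1 0 ^ (i - j) * g 1 1 ^ j)) := by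
  conv_lhs => rw [eq_sum_jet hP]
  rw [map_sum, map_sum]
  have key (j : ℕ) : jet p i (gAct p g (C (jet p j P) * (X 0 ^ (n - j) * X 1 ^ j))) =
      if j ≤ i then jet p j P * ((n - j).choose (i - j) *
        (g 0 0 ^ (n - i) * g 1 0 ^ (i - j) * g 1 1 ^ j)) else 0 := by
    have : dehom p (gAct p g (C (jet p j P) * (X 0 ^ (n - j) * X 1 ^ j))) =
        Polynomial.C (jet p j P * g 1 1 ^ j) *
        ((Polynomial.C (g 0 0) + Polynomial.C (g 1 0) * Polynomial.X) ^ (n - j) *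
          Polynomial.X ^ j) := by
      simp only [gAct_mul, gAct_C, gAct_pow, gAct_X, hg, map_mul, map_pow, map_add, dehom_C,
        dehom_X_zero, dehom_X_one, map_zero]
      ring
    rw [jet_apply, this, Polynomial.coeff_C_mul, Polynomial.coeff_mul_X_pow']
    split_ifs with hj
    · rw [coeff_linear_pow, show n - j - (i - j) = n - i by lia]
      ring
    · simp
  simp only [key]
  rw [← Finset.sum_subset (Finset.range_mono (show i + 1 ≤ n + 1 by lia))]
  · refine Finset.sum_congr rfl fun j hj => if_pos ?_
    rw [Finset.mem_range] at hj
    lia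
  · intro j _ hj
    rw [Finset.mem_range] at hj
    exact if_neg (by lia)

theorem choose_ne_zero [Fact p.Prime] {r m i : ℕ} (hm : m ≤ p - 1) (hi : i ≤ m)
    (hr : ¬ p ∣ r.choose m) : (r.choose i : ZMod p) ≠ 0 := by
  have hp : p.Prime := Fact.out
  rw [Ne, ZMod.natCast_eq_zero_iff]
  intro h
  have h1 : p ∣ r.choose m * m.choose i := by
    rw [Nat.choose_mul hi]
    exact h.mul_right _
  rcases hp.dvd_mul.1 h1 with h2 | h2
  · exact hr h2
  · have h3 : p ∣ m.factorial := by
      rw [← Nat.choose_mul_factorial_mul_factorial hi, mul_assoc]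
      exact h2.mul_right _
    have := hp.dvd_factorial.1 h3
    have := hp.two_le
    lia

theorem pow_sub_eq [Fact p.Prime] {r s i : ℕ} (hrs : r ≡ s [MOD p - 1]) (hr : i ≤ r) (hs : i ≤ s)
    {a : ZMod p} (ha : a ≠ 0) : a ^ (r - i) = a ^ (s - i) := by
  have h : r - i ≡ s - i [MOD p - 1] := by
    apply Nat.ModEq.add_right_cancel' i
    rwa [Nat.sub_add_cancel hr, Nat.sub_add_cancel hs]
  exact pow_eq_pow_of_modEq h (ZMod.pow_card_sub_one_eq_one ha)

/-- Rescaling the `i`-th jet by `C(s,i) / C(r,i)` commutes with lower triangular matrices. -/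
theorem jet_gAct_rescale [Fact p.Prime] {m r s : ℕ} (hm : m ≤ p - 1) (hmr : m ≤ r) (hms : m ≤ s)
    (hrs : r ≡ s [MOD p - 1]) (hcr : ¬ p ∣ r.choose m)
    {P Q : MvPolynomial (Fin 2) (ZMod p)}
    (hP : P ∈ homogeneousSubmodule (Fin 2) (ZMod p) r)
    (hQ : Q ∈ homogeneousSubmodule (Fin 2) (ZMod p) s)
    (h : ∀ i ≤ m, jet p i Q = s.choose i / r.choose i * jet p i P)
    {g : Matrix (Fin 2) (Fin 2) (ZMod p)} (hg : g 0 1 = 0) (hdet : g.det ≠ 0)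
    {i : ℕ} (hi : i ≤ m) :
    jet p i (gAct p g Q) = s.choose i / r.choose i * jet p i (gAct p g P) := by
  have ha : g 0 0 ≠ 0 := by
    intro h0
    simp [Matrix.det_fin_two, h0, hg] at hdet
  rw [jet_gAct_of_lower (hi.trans hmr) hP hg, jet_gAct_of_lower (hi.trans hms) hQ hg,
    Finset.mul_sum]
  refine Finset.sum_congr rfl fun j hj => ?_
  have hj : j ≤ i := by
    rw [Finset.mem_range] at hj
    lia
  rw [h j (hj.trans hi), pow_sub_eq hrs (hi.trans hmr) (hi.trans hms) ha]
  have h1 := choose_ne_zero hm hi hcr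
  have h2 := choose_ne_zero hm (hj.trans hi) hcr
  have h3 : (s.choose i * i.choose j : ZMod p) = s.choose j * (s - j).choose (i - j) := by
    exact_mod_cast congrArg (Nat.cast (R := ZMod p)) (Nat.choose_mul (n := s) hj)
  have h4 : (r.choose i * i.choose j : ZMod p) = r.choose j * (r - j).choose (i - j) := by
    exact_mod_cast congrArg (Nat.cast (R := ZMod p)) (Nat.choose_mul (n := r) hj)
  have h5 : (s.choose j / r.choose j * (s - j).choose (i - j) : ZMod p) =
      s.choose i / r.choose i * (r - j).choose (i - j) := by
    field_simp
    linear_combination s.choose i * h4 - r.choose i * h3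
  linear_combination (jet p j P * (g 0 0 ^ (s - i) * g 1 0 ^ (i - j) * g 1 1 ^ j)) * h5

theorem prod_X_sub_C_eq [Fact p.Prime] :
    ∏ a : ZMod p, (Polynomial.X - Polynomial.C a) = Polynomial.X ^ p - Polynomial.X := by
  have hp : 1 < p := (Fact.out : p.Prime).one_lt
  have hroots := FiniteField.roots_X_pow_card_sub_X (ZMod p)
  rw [ZMod.card] at hroots
  have := Polynomial.prod_multiset_X_sub_C_of_monic_of_roots_card_eq
    (p := (Polynomial.X ^ p - Polynomial.X : Polynomial (ZMod p)))
    (Polynomial.monic_X_pow_sub (by simpa using! hp))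
    (by
      rw [hroots, FiniteField.X_pow_card_sub_X_natDegree_eq _ hp, ← Finset.card_def,
        Finset.card_univ, ZMod.card])
  rwa [hroots] at this

/-- The Dickson polynomial is the product of the linear forms up to scalars. -/
theorem theta_eq_prod [Fact p.Prime] :
    theta p = X 1 * ∏ a : ZMod p, (X 0 - C a * X 1) := by
  set K := FractionRing (MvPolynomial (Fin 2) (ZMod p))
  have hinj : Function.Injective (algebraMap (MvPolynomial (Fin 2) (ZMod p)) K) :=
    IsFractionRing.injective _ _
  apply hinj
  set x := algebraMap (MvPolynomial (Fin 2) (ZMod p)) K (X 0) with hx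
  set y := algebraMap (MvPolynomial (Fin 2) (ZMod p)) K (X 1) with hy
  have hy0 : y ≠ 0 := by
    rw [hy, Ne, map_eq_zero_iff _ hinj]
    exact X_ne_zero 1
  have h := congrArg (Polynomial.aeval (x / y)) (prod_X_sub_C_eq (p := p))
  have hC (a : ZMod p) : algebraMap (ZMod p) K a =
      algebraMap (MvPolynomial (Fin 2) (ZMod p)) K (C a) :=
    IsScalarTower.algebraMap_apply _ _ _ _
  simp only [map_prod, map_sub, map_pow, Polynomial.aeval_X, Polynomial.aeval_C] at h
  have h2 : ∏ a : ZMod p, (x - algebraMap (MvPolynomial (Fin 2) (ZMod p)) K (C a) * y) =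
      y ^ p * ((x / y) ^ p - x / y) := by
    rw [← h]
    have hyp : y ^ p = ∏ _a : ZMod p, y := by
      rw [Finset.prod_const, Finset.card_univ, ZMod.card]
    rw [hyp, ← Finset.prod_mul_distrib]
    refine Finset.prod_congr rfl fun a _ => ?_
    rw [hC, mul_sub, mul_div_cancel₀ _ hy0, mul_comm y]
  simp only [theta, map_sub, map_mul, map_pow, map_prod, ← hx, ← hy, h2]
  rw [mul_sub, ← mul_pow, mul_div_cancel₀ _ hy0, mul_sub, mul_left_comm, mul_div_cancel₀ _ hy0]
  ring

theorem det_ne_zero [Fact p.Prime] (g : Matrix.GeneralLinearGroup (Fin 2) (ZMod p)) :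
    g.val.det ≠ 0 :=
  ((Matrix.isUnit_iff_isUnit_det _).1 g.isUnit).ne_zero

theorem gAct_inv_gAct [Fact p.Prime] (g : Matrix.GeneralLinearGroup (Fin 2) (ZMod p))
    (P : MvPolynomial (Fin 2) (ZMod p)) : gAct p g.val (gAct p g⁻¹.val P) = P := by
  rw [gAct_gAct, ← Units.val_mul, mul_inv_cancel, Units.val_one, gAct_one]

theorem isRelPrime_X [Fact p.Prime] :
    IsRelPrime (X 0 : MvPolynomial (Fin 2) (ZMod p)) (X 1) := by
  rw [X_prime.irreducible.isRelPrime_iff_not_dvd, X_dvd_X]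
  simp

theorem isRelPrime_X_linear [Fact p.Prime] (a : ZMod p) :
    IsRelPrime (X 1 : MvPolynomial (Fin 2) (ZMod p)) (X 0 - C a * X 1) := by
  intro d h1 h0
  exact isRelPrime_X ((dvd_sub_left (h1.mul_left _)).1 h0) h1

theorem isRelPrime_linear [Fact p.Prime] {a b : ZMod p} (hab : a ≠ b) :
    IsRelPrime (X 0 - C a * X 1 : MvPolynomial (Fin 2) (ZMod p)) (X 0 - C b * X 1) := by
  intro d ha hb
  refine isRelPrime_X_linear a ?_ ha
  have h : X 1 = C (b - a)⁻¹ * ((X 0 - C a * X 1) - (X 0 - C b * X 1) :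
      MvPolynomial (Fin 2) (ZMod p)) := by
    have : C (b - a)⁻¹ * C (b - a) = (1 : MvPolynomial (Fin 2) (ZMod p)) := by
      rw [← C_mul, inv_mul_cancel₀ (sub_ne_zero.2 hab.symm), C_1]
    rw [C_sub] at this
    linear_combination -X 1 * this
  rw [h]
  exact (dvd_sub ha hb).mul_left _

/-- Divisibility by a power of `θ` can be tested on the translates at the point `Y = 0`. -/
theorem theta_pow_dvd_iff [Fact p.Prime] {n : ℕ} {P : MvPolynomial (Fin 2) (ZMod p)} :
    theta p ^ n ∣ P ↔
      ∀ g : Matrix.GeneralLinearGroup (Fin 2) (ZMod p), X 1 ^ n ∣ gAct p g.val P := by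
  constructor
  · intro h g
    refine dvd_trans ?_ (gAct_dvd g.val h)
    rw [gAct_pow, gAct_theta, theta_eq_prod]
    exact pow_dvd_pow_of_dvd ((dvd_mul_right _ _).mul_left _) n
  · intro h
    have hg (g : Matrix.GeneralLinearGroup (Fin 2) (ZMod p)) : gAct p g.val (X 1) ^ n ∣ P := by
      have := gAct_dvd g.val (h g⁻¹)
      rwa [gAct_pow, gAct_inv_gAct] at this
    rw [theta_eq_prod, mul_pow, ← Finset.prod_pow]
    refine IsRelPrime.mul_dvd (IsRelPrime.prod_right fun a _ => (isRelPrime_X_linear a).pow) ?_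
      (Fintype.prod_dvd_of_isRelPrime (fun a b hab => (isRelPrime_linear hab).pow) fun a => ?_)
    · simpa [gAct_one] using hg 1
    · have := hg (Matrix.GeneralLinearGroup.mkOfDetNeZero !![0, 1; 1, -a] (by simp))
      rw [gAct_X] at this
      simpa [Matrix.GeneralLinearGroup.mkOfDetNeZero, sub_eq_add_neg] using! this

theorem theta_pow_dvd_iff_jet [Fact p.Prime] {n m : ℕ} {P : MvPolynomial (Fin 2) (ZMod p)}
    (hP : P ∈ homogeneousSubmodule (Fin 2) (ZMod p) n) :
    theta p ^ (m + 1) ∣ P ↔ ∀ g : Matrix.GeneralLinearGroup (Fin 2) (ZMod p),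
      ∀ i ≤ m, jet p i (gAct p g.val P) = 0 := by
  rw [theta_pow_dvd_iff]
  exact forall_congr' fun g => X_pow_dvd_iff_jet (gAct_mem g.val hP)

/-- The cofactor of `Y` in `θ`. -/
def cofactor (p : ℕ) : MvPolynomial (Fin 2) (ZMod p) :=
  X 0 ^ p - X 0 * X 1 ^ (p - 1)

theorem X_mul_cofactor [Fact p.Prime] : X 1 * cofactor p = theta p := by
  have hp : p = p - 1 + 1 := by
    have := (Fact.out : p.Prime).pos
    lia
  have h : (X 1 : MvPolynomial (Fin 2) (ZMod p)) ^ p = X 1 ^ (p - 1) * X 1 := by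
    rw [← pow_succ, ← hp]
  rw [cofactor, theta, h]
  ring

theorem cofactor_mem [Fact p.Prime] :
    cofactor p ∈ homogeneousSubmodule (Fin 2) (ZMod p) p := by
  rw [mem_homogeneousSubmodule]
  refine (isHomogeneous_X_pow _ _).sub ?_
  have := (isHomogeneous_X (ZMod p) (0 : Fin 2)).mul
    (isHomogeneous_X_pow (R := ZMod p) (1 : Fin 2) (p - 1))
  rwa [Nat.add_sub_cancel' (Fact.out : p.Prime).one_le] at this

theorem X_dvd_gAct_cofactor [Fact p.Prime] {g : Matrix (Fin 2) (Fin 2) (ZMod p)}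
    (hg : g 0 1 ≠ 0) : X 1 ∣ gAct p g (cofactor p) := by
  have h : X 1 ∣ gAct p g (X 1) * gAct p g (cofactor p) := by
    rw [← gAct_mul, X_mul_cofactor, gAct_theta, ← X_mul_cofactor]
    exact (dvd_mul_right _ _).mul_left _
  refine (X_prime.dvd_or_dvd h).resolve_left fun h1 => hg ?_
  rw [gAct_X, dvd_add_left (dvd_mul_left _ _)] at h1
  have := map_dvd (dehom p) h1
  rw [map_mul, dehom_C, dehom_X_zero, dehom_X_one, mul_one, Polynomial.X_dvd_iff] at this
  simpa using this

/-- `(1 - y ^ (p - 1)) ^ (m + 1) ≡ 1` modulo `y ^ (m + 1)` when `m < p`. -/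
theorem X_pow_dvd_dehom_cofactor_pow [Fact p.Prime] {m : ℕ} (hm : m ≤ p - 1) :
    Polynomial.X ^ (m + 1) ∣ dehom p (cofactor p ^ (m + 1)) - 1 := by
  have hp : 2 ≤ p := (Fact.out : p.Prime).two_le
  have h : dehom p (cofactor p) = 1 - Polynomial.X ^ (p - 1) := by
    simp [cofactor, dehom_X_zero, dehom_X_one]
  rw [map_pow, h]
  rcases hm.lt_or_eq with hlt | rfl
  · refine (pow_dvd_pow _ (show m + 1 ≤ p - 1 by lia)).trans ?_
    have := sub_dvd_pow_sub_pow (1 - Polynomial.X ^ (p - 1) : Polynomial (ZMod p)) 1 (m + 1)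
    rw [one_pow] at this
    exact (dvd_of_eq (by ring : Polynomial.X ^ (p - 1) =
      -(1 - Polynomial.X ^ (p - 1) - 1 : Polynomial (ZMod p)))).trans ((neg_dvd).2 this)
  · rw [show p - 1 + 1 = p by lia, sub_pow_char, one_pow, sub_sub_cancel_left, dvd_neg, ← pow_mul]
    exact pow_dvd_pow _ (Nat.le_mul_of_pos_left _ (by lia))

/-- A homogeneous form of degree `s` whose jets up to order `m` at `Y = 0` are those of `P`,
rescaled by `C(s,i) / C(r,i)`, and which vanishes to order `m + 1` at the other points. -/
def localLift (p m r s : ℕ) [Fact p.Prime] :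
    MvPolynomial (Fin 2) (ZMod p) →ₗ[ZMod p] MvPolynomial (Fin 2) (ZMod p) :=
  ∑ i ∈ Finset.range (m + 1), ((s.choose i / r.choose i : ZMod p) • jet p i).smulRight
    (cofactor p ^ (m + 1) * (X 0 ^ (s - p * (m + 1) - i) * X 1 ^ i))

theorem localLift_apply [Fact p.Prime] (m r s : ℕ) (P : MvPolynomial (Fin 2) (ZMod p)) :
    localLift p m r s P = ∑ i ∈ Finset.range (m + 1),
      (s.choose i / r.choose i * jet p i P) •
        (cofactor p ^ (m + 1) * (X 0 ^ (s - p * (m + 1) - i) * X 1 ^ i)) := by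
  simp [localLift]

theorem cofactor_pow_dvd_localLift [Fact p.Prime] (m r s : ℕ) (P : MvPolynomial (Fin 2) (ZMod p)) :
    cofactor p ^ (m + 1) ∣ localLift p m r s P := by
  rw [localLift_apply]
  refine Finset.dvd_sum fun i _ => ?_
  rw [smul_eq_C_mul]
  exact (dvd_mul_right _ _).mul_left _

theorem localLift_mem [Fact p.Prime] {m r s : ℕ} (hs : (m + 1) * (p + 1) ≤ s)
    (P : MvPolynomial (Fin 2) (ZMod p)) :
    localLift p m r s P ∈ homogeneousSubmodule (Fin 2) (ZMod p) s := by
  rw [localLift_apply]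
  refine Submodule.sum_mem _ fun i hi => Submodule.smul_mem _ _ ?_
  rw [Finset.mem_range] at hi
  rw [mem_homogeneousSubmodule]
  have h := ((mem_homogeneousSubmodule _ _).1 (cofactor_mem (p := p))).pow (m + 1)
  have h' := h.mul ((isHomogeneous_X_pow (R := ZMod p) (0 : Fin 2) (s - p * (m + 1) - i)).mul
    (isHomogeneous_X_pow (1 : Fin 2) i))
  have hd : p * (m + 1) + (s - p * (m + 1) - i + i) = s := by
    have : (m + 1) * (p + 1) = p * (m + 1) + (m + 1) := by ring
    lia
  rwa [hd] at h'

theorem jet_localLift [Fact p.Prime] {m r s i : ℕ} (hm : m ≤ p - 1) (hi : i ≤ m)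
    (P : MvPolynomial (Fin 2) (ZMod p)) :
    jet p i (localLift p m r s P) = s.choose i / r.choose i * jet p i P := by
  have key (j : ℕ) : jet p i (cofactor p ^ (m + 1) *
      (X 0 ^ (s - p * (m + 1) - j) * X 1 ^ j)) = if i = j then 1 else 0 := by
    obtain ⟨q, hq⟩ := X_pow_dvd_dehom_cofactor_pow (p := p) hm
    rw [sub_eq_iff_eq_add] at hq
    have : dehom p (cofactor p ^ (m + 1) * (X 0 ^ (s - p * (m + 1) - j) * X 1 ^ j)) =
        Polynomial.X ^ (m + 1) * (q * Polynomial.X ^ j) + Polynomial.X ^ j := by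
      rw [map_mul, hq, map_mul, map_pow, map_pow, dehom_X_zero, dehom_X_one]
      ring
    rw [jet_apply, this, Polynomial.coeff_add, Polynomial.coeff_X_pow_mul', if_neg (by lia),
      zero_add, Polynomial.coeff_X_pow]
  rw [localLift_apply, map_sum, Finset.sum_eq_single_of_mem i (by rw [Finset.mem_range]; lia)]
  · rw [map_smul, key, if_pos rfl, smul_eq_mul, mul_one]
  · intro j _ hj
    rw [map_smul, key, if_neg hj.symm, smul_zero]

/-- The subgroup of lower triangular matrices. -/
def lowerBorel (p : ℕ) [Fact p.Prime] :
    Subgroup (Matrix.GeneralLinearGroup (Fin 2) (ZMod p)) where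
  carrier := {g | g.val 0 1 = 0}
  one_mem' := by simp
  mul_mem' := by
    intro g h hg hh
    simp only [Set.mem_ofPred_eq] at hg hh ⊢
    simp [Matrix.mul_apply, Fin.sum_univ_two, hg, hh]
  inv_mem' := by
    intro g hg
    simp only [Set.mem_ofPred_eq] at hg ⊢
    simp [Matrix.inv_def, Matrix.adjugate_fin_two, hg]

theorem mem_lowerBorel [Fact p.Prime] {g : Matrix.GeneralLinearGroup (Fin 2) (ZMod p)} :
    g ∈ lowerBorel p ↔ g.val 0 1 = 0 := Iff.rfl

instance [Fact p.Prime] :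
    Fintype (Matrix.GeneralLinearGroup (Fin 2) (ZMod p) ⧸ lowerBorel p) :=
  Fintype.ofFinite _

/-- The relative trace of `localLift` from the lower triangular matrices to `GL₂(𝔽_p)`. -/
def globalLift (p m r s : ℕ) [Fact p.Prime] :
    MvPolynomial (Fin 2) (ZMod p) →ₗ[ZMod p] MvPolynomial (Fin 2) (ZMod p) :=
  ∑ q : Matrix.GeneralLinearGroup (Fin 2) (ZMod p) ⧸ lowerBorel p,
    gAct p q.out.val ∘ₗ localLift p m r s ∘ₗ gAct p q.out⁻¹.val

theorem globalLift_apply [Fact p.Prime] (m r s : ℕ) (P : MvPolynomial (Fin 2) (ZMod p)) :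
    globalLift p m r s P =
      ∑ q : Matrix.GeneralLinearGroup (Fin 2) (ZMod p) ⧸ lowerBorel p,
        gAct p q.out.val (localLift p m r s (gAct p q.out⁻¹.val P)) := by
  simp [globalLift]

theorem globalLift_mem [Fact p.Prime] {m r s : ℕ} (hs : (m + 1) * (p + 1) ≤ s)
    (P : MvPolynomial (Fin 2) (ZMod p)) :
    globalLift p m r s P ∈ homogeneousSubmodule (Fin 2) (ZMod p) s := by
  rw [globalLift_apply]
  exact Submodule.sum_mem _ fun q _ => gAct_mem _ (localLift_mem hs _)

/-- At every point, `globalLift` rescales the `i`-th jet by `C(s,i) / C(r,i)`. -/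
theorem jet_gAct_globalLift [Fact p.Prime] {m r s : ℕ} (hm : m ≤ p - 1) (hmr : m ≤ r)
    (hs : (m + 1) * (p + 1) ≤ s) (hrs : r ≡ s [MOD p - 1]) (hcr : ¬ p ∣ r.choose m)
    {P : MvPolynomial (Fin 2) (ZMod p)} (hP : P ∈ homogeneousSubmodule (Fin 2) (ZMod p) r)
    (g : Matrix.GeneralLinearGroup (Fin 2) (ZMod p)) {i : ℕ} (hi : i ≤ m) :
    jet p i (gAct p g.val (globalLift p m r s P)) =
      s.choose i / r.choose i * jet p i (gAct p g.val P) := by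
  have hms : m ≤ s := by nlinarith
  rw [globalLift_apply, map_sum, map_sum,
    Finset.sum_eq_single_of_mem (QuotientGroup.mk g⁻¹) (Finset.mem_univ _)]
  · set h := (QuotientGroup.mk g⁻¹ : _ ⧸ lowerBorel p).out
    have hmem : g * h ∈ lowerBorel p := by
      have := QuotientGroup.eq.1
        (QuotientGroup.out_eq' (QuotientGroup.mk g⁻¹ : _ ⧸ lowerBorel p)).symm
      rwa [inv_inv] at this
    rw [gAct_gAct, ← Units.val_mul, jet_gAct_rescale hm hmr hms hrs hcr (gAct_mem h⁻¹.val hP)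
      (localLift_mem hs _) (fun i hi => jet_localLift hm hi _) (mem_lowerBorel.1 hmem)
      (det_ne_zero _) hi, gAct_gAct, ← Units.val_mul, mul_inv_cancel_right]
  · intro q _ hq
    have hmem : g * q.out ∉ lowerBorel p := by
      intro hmem
      refine hq ?_
      rw [← QuotientGroup.out_eq' q, eq_comm, QuotientGroup.eq, inv_inv]
      exact hmem
    rw [gAct_gAct, ← Units.val_mul]
    refine jet_eq_zero_of_dvd hi ?_
    refine dvd_trans ?_ (gAct_dvd _ (cofactor_pow_dvd_localLift m r s _))
    rw [gAct_pow]
    exact pow_dvd_pow_of_dvd (X_dvd_gAct_cofactor hmem) _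

end

end ThetaQuotient

open ThetaQuotient

/-- periodicity: if `0 ≤ m ≤ p−1`, `r, s ≥ (m+1)(p+1)`, `r ≡ s mod (p−1)`,
and `p ∤ C(r,m)`, `p ∤ C(s,m)`, then there is a `G`-equivariant isomorphism
`V_r / V_r^{(m+1)} ≅ V_s / V_s^{(m+1)}`, expressed here by a linear map `Φ` lifting it. -/
theorem theta_quotient_periodicity (p : ℕ) [Fact p.Prime] (m r s : ℕ)
    (hm : m ≤ p - 1) (hr : (m + 1) * (p + 1) ≤ r) (hs : (m + 1) * (p + 1) ≤ s)
    (hrs : r ≡ s [MOD p - 1])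
    (hcr : ¬ p ∣ Nat.choose r m) (hcs : ¬ p ∣ Nat.choose s m) :
    ∃ Φ : MvPolynomial (Fin 2) (ZMod p) →ₗ[ZMod p] MvPolynomial (Fin 2) (ZMod p),
      -- `Φ` maps `V_r` to `V_s`
      (∀ P ∈ homogeneousSubmodule (Fin 2) (ZMod p) r,
          Φ P ∈ homogeneousSubmodule (Fin 2) (ZMod p) s) ∧
      -- the induced map `V_r / V_r^{(m+1)} → V_s / V_s^{(m+1)}` is well defined and injective
      (∀ P ∈ homogeneousSubmodule (Fin 2) (ZMod p) r,
          (theta p ^ (m + 1) ∣ Φ P ↔ theta p ^ (m + 1) ∣ P)) ∧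
      -- the induced map is surjective
      (∀ Q ∈ homogeneousSubmodule (Fin 2) (ZMod p) s,
          ∃ P ∈ homogeneousSubmodule (Fin 2) (ZMod p) r,
            theta p ^ (m + 1) ∣ (Φ P - Q)) ∧
      -- the induced map is `G`-equivariant
      (∀ g : Matrix.GeneralLinearGroup (Fin 2) (ZMod p),
          ∀ P ∈ homogeneousSubmodule (Fin 2) (ZMod p) r,
            theta p ^ (m + 1) ∣ (Φ (gAct p g.val P) - gAct p g.val (Φ P))) := by
  have hmr : m ≤ r := by nlinarith
  have hms : m ≤ s := by nlinarith
  have hΦ {P} (hP : P ∈ homogeneousSubmodule (Fin 2) (ZMod p) r) g {i : ℕ} (hi : i ≤ m) :=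
    jet_gAct_globalLift hm hmr hs hrs hcr hP g hi
  have hΨ {P} (hP : P ∈ homogeneousSubmodule (Fin 2) (ZMod p) s) g {i : ℕ} (hi : i ≤ m) :=
    jet_gAct_globalLift hm hms hr hrs.symm hcs hP g hi
  have hr0 {i : ℕ} (hi : i ≤ m) := choose_ne_zero hm hi hcr
  have hs0 {i : ℕ} (hi : i ≤ m) := choose_ne_zero hm hi hcs
  refine ⟨globalLift p m r s, fun P _ => globalLift_mem hs P, fun P hP => ?_, fun Q hQ => ?_,
    fun g P hP => ?_⟩
  · rw [theta_pow_dvd_iff_jet (globalLift_mem hs P), theta_pow_dvd_iff_jet hP]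
    refine forall_congr' fun g => forall_congr' fun i => forall_congr' fun hi => ?_
    rw [hΦ hP g hi, mul_eq_zero, or_iff_right (div_ne_zero (hs0 hi) (hr0 hi))]
  · have hmem := globalLift_mem (r := s) hr Q
    refine ⟨globalLift p m s r Q, hmem, ?_⟩
    rw [theta_pow_dvd_iff_jet (Submodule.sub_mem _ (globalLift_mem hs _) hQ)]
    intro g i hi
    have h1 := hr0 hi
    have h2 := hs0 hi
    rw [map_sub, map_sub, hΦ hmem g hi, hΨ hQ g hi]
    field_simp
    simp
  · rw [theta_pow_dvd_iff_jet (Submodule.sub_mem _ (globalLift_mem hs _)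
      (gAct_mem _ (globalLift_mem hs _)))]
    intro h i hi
    rw [map_sub, map_sub, hΦ (gAct_mem _ hP) h hi, gAct_gAct, gAct_gAct, ← Units.val_mul,
      hΦ hP _ hi, sub_self]
end

section
/- Let 0 ≤ m_j ≤ p−1 and let r_j be integers with r_j ≥ p^{f−j} and r_j ≥ (m_j+1)(q+1) for all 0 ≤ j ≤ f−1, and assume p ∤ C(r_j, m_j) (binomial coefficient) for all j. Then there is a G-equivariant isomorphism (⊗_{j=0}^{f−1} V_{r_j}^{Fr^j}) / ⟨θ_0^{m_0+1}, θ_1^{m_1+1}, …, θ_{f−1}^{m_{f−1}+1}⟩ ≅ ind_{B(𝔽_q)}^{G} ⊗_{j=0}^{f−1} (V_{m_j}^{Fr^j} ⊗ d^{(r_j−m_j)p^j}), where each V_{m_j}^{Fr^j} is restricted from G to B(𝔽_q). -/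
open MvPolynomial

noncomputable section

/-- The twisted Dickson polynomial `θ_k = X_k·Y_{k−1}^p − Y_k·X_{k−1}^p`
(indices mod `f`, so `θ_0 = X_0·Y_{f−1}^p − Y_0·X_{f−1}^p`), in
`𝔽_q[X_0,Y_0,…,X_{f−1},Y_{f−1}]` with `X_j = X (j,0)`, `Y_j = X (j,1)`. -/
def thetaTw (p f : ℕ) [Fact p.Prime] [NeZero f] (k : Fin f) :
    MvPolynomial (Fin f × Fin 2) (GaloisField p f) :=
  X (k, 0) * X (k - 1, 1) ^ p - X (k, 1) * X (k - 1, 0) ^ p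

/-- `P` is multihomogeneous of multidegree `(r_0,…,r_{f−1})`: every monomial of `P` has
degree `r_j` in the pair of variables `(X_j, Y_j)`. -/
def IsMultiHom (p f : ℕ) [Fact p.Prime] (r : Fin f → ℕ)
    (P : MvPolynomial (Fin f × Fin 2) (GaloisField p f)) : Prop :=
  ∀ dd ∈ P.support, ∀ j : Fin f, dd (j, 0) + dd (j, 1) = r j

/-- The Frobenius-twisted action of `g = [[a,b],[c,d]] ∈ GL₂(𝔽_q)`:
`X_j ↦ a^{p^j}X_j + c^{p^j}Y_j` and `Y_j ↦ b^{p^j}X_j + d^{p^j}Y_j`. -/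
def actTw (p f : ℕ) [Fact p.Prime] (g : Matrix (Fin 2) (Fin 2) (GaloisField p f)) :
    MvPolynomial (Fin f × Fin 2) (GaloisField p f) →ₗ[GaloisField p f]
      MvPolynomial (Fin f × Fin 2) (GaloisField p f) :=
  (aeval fun v : Fin f × Fin 2 =>
    C (g 0 v.2 ^ p ^ (v.1 : ℕ)) * X (v.1, 0) +
      C (g 1 v.2 ^ p ^ (v.1 : ℕ)) * X (v.1, 1)).toLinearMap

end

namespace TwistedPrincipalSeries

variable {p f : ℕ} [Fact p.Prime]

/-- The weight recording the multidegree: `X_j` and `Y_j` have weight the `j`-th unit vector. -/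
def wt (f : ℕ) (v : Fin f × Fin 2) : Fin f → ℕ := Pi.single v.1 1

/-- The monomial `∏_j X_j^{a_j} Y_j^{b_j}`. -/
noncomputable def mon (p : ℕ) [Fact p.Prime] {f : ℕ} (a b : Fin f → ℕ) :
    MvPolynomial (Fin f × Fin 2) (GaloisField p f) :=
  ∏ j, (X (j, 0) ^ a j * X (j, 1) ^ b j)

theorem weight_wt (e : Fin f × Fin 2 →₀ ℕ) :
    Finsupp.weight (wt f) e = fun j => e (j, 0) + e (j, 1) := by
  rw [Finsupp.weight_eq_sum]
  funext j
  simp [Fintype.sum_prod_type, wt, Finset.sum_apply, Pi.single_apply, Finset.sum_add_distrib]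

theorem isMultiHom_iff {r : Fin f → ℕ} {P : MvPolynomial (Fin f × Fin 2) (GaloisField p f)} :
    IsMultiHom p f r P ↔ IsWeightedHomogeneous (wt f) P r := by
  unfold IsMultiHom IsWeightedHomogeneous
  simp only [weight_wt, mem_support_iff, funext_iff]

theorem isWeightedHomogeneous_mon (a b : Fin f → ℕ) :
    IsWeightedHomogeneous (wt f) (mon p a b) (a + b) := by
  have h : a + b = ∑ j, (a j • wt f (j, 0) + b j • wt f (j, 1)) := by
    funext j
    simp [wt, Finset.sum_apply, Pi.single_apply, Finset.sum_add_distrib]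
  rw [h]
  exact IsWeightedHomogeneous.prod _ _ _ fun j _ =>
    ((isWeightedHomogeneous_X _ _ _).pow _).mul ((isWeightedHomogeneous_X _ _ _).pow _)

theorem mon_mul_mon (a b a' b' : Fin f → ℕ) :
    mon p a b * mon p a' b' = mon p (a + a') (b + b') := by
  simp only [mon, ← Finset.prod_mul_distrib, Pi.add_apply]
  exact Finset.prod_congr rfl fun j _ => by ring

theorem X_zero_pow_eq_mon (k : Fin f) (n : ℕ) :
    (X (k, 0) : MvPolynomial (Fin f × Fin 2) (GaloisField p f)) ^ n = mon p (Pi.single k n) 0 := by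
  unfold mon
  rw [Finset.prod_eq_single k] <;> simp +contextual

theorem X_one_pow_eq_mon (k : Fin f) (n : ℕ) :
    (X (k, 1) : MvPolynomial (Fin f × Fin 2) (GaloisField p f)) ^ n = mon p 0 (Pi.single k n) := by
  unfold mon
  rw [Finset.prod_eq_single k] <;> simp +contextual

theorem monomial_eq_mon (e : Fin f × Fin 2 →₀ ℕ) (c : GaloisField p f) :
    monomial e c = c • mon p (fun j => e (j, 0)) (fun j => e (j, 1)) := by
  rw [monomial_eq, Finsupp.prod_fintype _ _ (by simp), smul_eq_C_mul, mon,
    Fintype.prod_prod_type]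
  simp

/-- Multihomogeneous polynomials are spanned by the monomials of the right multidegree. -/
theorem mem_of_isWeightedHomogeneous {r : Fin f → ℕ}
    {P : MvPolynomial (Fin f × Fin 2) (GaloisField p f)} (hP : IsWeightedHomogeneous (wt f) P r)
    (S : Submodule (GaloisField p f) (MvPolynomial (Fin f × Fin 2) (GaloisField p f)))
    (hS : ∀ a b : Fin f → ℕ, a + b = r → mon p a b ∈ S) : P ∈ S := by
  rw [P.as_sum]
  refine Submodule.sum_mem _ fun e he => ?_
  rw [monomial_eq_mon]
  refine S.smul_mem _ (hS _ _ ?_)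
  have := hP (mem_support_iff.1 he)
  rwa [weight_wt] at this

section Substitution

variable {F : Fin f × Fin 2 → MvPolynomial (Fin f × Fin 2) (GaloisField p f)}

theorem isWeightedHomogeneous_aeval (hF : ∀ v, IsWeightedHomogeneous (wt f) (F v) (wt f v))
    {n : Fin f → ℕ} {P : MvPolynomial (Fin f × Fin 2) (GaloisField p f)}
    (hP : IsWeightedHomogeneous (wt f) P n) : IsWeightedHomogeneous (wt f) (aeval F P) n := by
  refine mem_of_isWeightedHomogeneous hP
    ((weightedHomogeneousSubmodule _ (wt f) n).comap (aeval F).toLinearMap) fun a b hab => ?_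
  simp only [Submodule.mem_comap, AlgHom.toLinearMap_apply, mem_weightedHomogeneousSubmodule, mon,
    map_prod, map_mul, map_pow, aeval_X]
  have h : n = ∑ j, (a j • wt f (j, 0) + b j • wt f (j, 1)) := by
    rw [← hab]
    funext j
    simp [wt, Finset.sum_apply, Pi.single_apply, Finset.sum_add_distrib]
  rw [h]
  exact IsWeightedHomogeneous.prod _ _ _ fun j _ => ((hF _).pow _).mul ((hF _).pow _)

theorem weightedHomogeneousComponent_aeval
    (hF : ∀ v, IsWeightedHomogeneous (wt f) (F v) (wt f v)) (n : Fin f → ℕ)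
    (P : MvPolynomial (Fin f × Fin 2) (GaloisField p f)) :
    weightedHomogeneousComponent (wt f) n (aeval F P) =
      aeval F (weightedHomogeneousComponent (wt f) n P) := by
  classical
  induction P using MvPolynomial.induction_on' with
  | monomial e c =>
    have h1 := isWeightedHomogeneous_monomial (wt f) e c rfl
    rw [weightedHomogeneousComponent_of_mem h1,
      weightedHomogeneousComponent_of_mem (isWeightedHomogeneous_aeval hF h1)]
    split_ifs <;> simp
  | add P Q hP hQ => simp only [map_add, hP, hQ]

end Substitution

/-- The twisted action of a matrix, as an algebra homomorphism. -/
noncomputable def actHom (p f : ℕ) [Fact p.Prime] (g : Matrix (Fin 2) (Fin 2) (GaloisField p f)) :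
    MvPolynomial (Fin f × Fin 2) (GaloisField p f) →ₐ[GaloisField p f]
      MvPolynomial (Fin f × Fin 2) (GaloisField p f) :=
  aeval fun v : Fin f × Fin 2 =>
    C (g 0 v.2 ^ p ^ (v.1 : ℕ)) * X (v.1, 0) +
      C (g 1 v.2 ^ p ^ (v.1 : ℕ)) * X (v.1, 1)

theorem actTw_apply (g : Matrix (Fin 2) (Fin 2) (GaloisField p f))
    (P : MvPolynomial (Fin f × Fin 2) (GaloisField p f)) : actTw p f g P = actHom p f g P := rfl

theorem actHom_X (g : Matrix (Fin 2) (Fin 2) (GaloisField p f)) (j : Fin f) (i : Fin 2) :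
    actHom p f g (X (j, i)) = C (g 0 i ^ p ^ (j : ℕ)) * X (j, 0) +
      C (g 1 i ^ p ^ (j : ℕ)) * X (j, 1) := by
  simp [actHom]

theorem isWeightedHomogeneous_actHom_gen (g : Matrix (Fin 2) (Fin 2) (GaloisField p f))
    (v : Fin f × Fin 2) :
    IsWeightedHomogeneous (wt f) (C (g 0 v.2 ^ p ^ (v.1 : ℕ)) * X (v.1, 0) +
      C (g 1 v.2 ^ p ^ (v.1 : ℕ)) * X (v.1, 1)) (wt f v) :=
  ((isWeightedHomogeneous_X _ (wt f) (v.1, 0)).C_mul _).add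
    ((isWeightedHomogeneous_X _ (wt f) (v.1, 1)).C_mul _)

theorem isWeightedHomogeneous_actHom (g : Matrix (Fin 2) (Fin 2) (GaloisField p f))
    {n : Fin f → ℕ} {P : MvPolynomial (Fin f × Fin 2) (GaloisField p f)}
    (hP : IsWeightedHomogeneous (wt f) P n) :
    IsWeightedHomogeneous (wt f) (actHom p f g P) n :=
  isWeightedHomogeneous_aeval (isWeightedHomogeneous_actHom_gen g) hP

theorem actHom_mul (g h : Matrix (Fin 2) (Fin 2) (GaloisField p f))
    (P : MvPolynomial (Fin f × Fin 2) (GaloisField p f)) :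
    actHom p f (g * h) P = actHom p f g (actHom p f h P) := by
  rw [← AlgHom.comp_apply, show actHom p f (g * h) = (actHom p f g).comp (actHom p f h) from
    algHom_ext fun v => ?_]
  obtain ⟨j, i⟩ := v
  simp only [AlgHom.comp_apply, actHom_X, map_add, map_mul, algHom_C, Matrix.mul_apply,
    Fin.sum_univ_two, add_pow_char_pow, mul_pow, algebraMap_eq]
  ring

theorem actHom_one (P : MvPolynomial (Fin f × Fin 2) (GaloisField p f)) :
    actHom p f 1 P = P := by
  rw [show actHom p f 1 = AlgHom.id _ _ from algHom_ext fun v => ?_]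
  · rfl
  obtain ⟨j, i⟩ := v
  have : p ≠ 0 := (Fact.out : p.Prime).ne_zero
  fin_cases i <;> simp [actHom_X, this]

theorem actHom_scalar {r : Fin f → ℕ} {P : MvPolynomial (Fin f × Fin 2) (GaloisField p f)}
    (hP : IsWeightedHomogeneous (wt f) P r) (c : GaloisField p f) :
    actHom p f (c • (1 : Matrix (Fin 2) (Fin 2) (GaloisField p f))) P =
      c ^ (∑ j, r j * p ^ (j : ℕ)) • P := by
  refine mem_of_isWeightedHomogeneous hP (LinearMap.eqLocus (actHom p f (c • 1)).toLinearMap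
    (c ^ (∑ j, r j * p ^ (j : ℕ)) • LinearMap.id)) fun a b hab => ?_
  have hp : p ≠ 0 := (Fact.out : p.Prime).ne_zero
  subst hab
  simp only [LinearMap.mem_eqLocus, AlgHom.toLinearMap_apply, LinearMap.smul_apply,
    LinearMap.id_apply, mon, map_prod, map_mul, map_pow, actHom_X, smul_eq_C_mul,
    ← Finset.prod_pow_eq_pow_sum, ← Finset.prod_mul_distrib]
  refine Finset.prod_congr rfl fun j _ => ?_
  simp [hp]
  ring

/-! ### Twisted Dickson polynomials and the truncation at the standard point -/

section Frobenius

variable [NeZero f]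

theorem pow_prime_pow_eq_self (x : GaloisField p f) : x ^ p ^ f = x := by
  have := Fintype.ofFinite (GaloisField p f)
  have h := FiniteField.pow_card x
  rwa [← Nat.card_eq_fintype_card, GaloisField.card p f (NeZero.ne f)] at h

theorem pow_prime_pow_sub_one_eq_one {x : GaloisField p f} (hx : x ≠ 0) :
    x ^ (p ^ f - 1) = 1 := by
  have := Fintype.ofFinite (GaloisField p f)
  have h := FiniteField.pow_card_sub_one_eq_one x hx
  rwa [← Nat.card_eq_fintype_card, GaloisField.card p f (NeZero.ne f)] at h

theorem pow_frobenius_pred (x : GaloisField p f) (k : Fin f) :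
    (x ^ p ^ ((k - 1 : Fin f) : ℕ)) ^ p = x ^ p ^ (k : ℕ) := by
  rw [← pow_mul, ← pow_succ]
  obtain ⟨n, rfl⟩ := Nat.exists_eq_succ_of_ne_zero (NeZero.ne f)
  by_cases hk : k = 0
  · subst hk
    rw [Fin.coe_sub_one, if_pos rfl, pow_prime_pow_eq_self]
    simp
  · rw [Fin.coe_sub_one, if_neg hk, Nat.sub_add_cancel]
    exact Nat.one_le_iff_ne_zero.2 (Fin.val_ne_zero_iff.2 hk)

theorem actHom_thetaTw (g : Matrix (Fin 2) (Fin 2) (GaloisField p f)) (k : Fin f) :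
    actHom p f g (thetaTw p f k) = C (g.det ^ p ^ (k : ℕ)) * thetaTw p f k := by
  have h (x : GaloisField p f) : (C (x ^ p ^ ((k - 1 : Fin f) : ℕ)) :
      MvPolynomial (Fin f × Fin 2) (GaloisField p f)) ^ p = C (x ^ p ^ (k : ℕ)) := by
    rw [← C_pow, pow_frobenius_pred]
  rw [thetaTw, map_sub, map_mul, map_mul, map_pow, map_pow]
  simp only [actHom_X, add_pow_char, mul_pow _ (X _), h, Matrix.det_fin_two, sub_pow_char_pow]
  simp only [map_sub, map_mul, mul_pow]
  ring

end Frobenius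

/-- The ideal generated by the powers `X_j^{m_j+1}`. -/
noncomputable def truncIdeal (p : ℕ) [Fact p.Prime] {f : ℕ} (m : Fin f → ℕ) :
    Ideal (MvPolynomial (Fin f × Fin 2) (GaloisField p f)) :=
  Ideal.span (Set.range fun j : Fin f => X (j, 0) ^ (m j + 1))

/-- The ideal generated by the powers `θ_j^{m_j+1}`. -/
noncomputable def thetaIdeal (p : ℕ) [Fact p.Prime] {f : ℕ} [NeZero f] (m : Fin f → ℕ) :
    Ideal (MvPolynomial (Fin f × Fin 2) (GaloisField p f)) :=
  Ideal.span (Set.range fun j : Fin f => thetaTw p f j ^ (m j + 1))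

theorem X_pow_mem_truncIdeal {m : Fin f → ℕ} {j : Fin f} {n : ℕ} (h : m j + 1 ≤ n) :
    X (j, 0) ^ n ∈ truncIdeal p m :=
  Ideal.pow_mem_of_pow_mem _ (Ideal.subset_span ⟨j, rfl⟩) h

theorem actHom_mem_truncIdeal [NeZero f] {m : Fin f → ℕ} (hm : ∀ j, m j ≤ p - 1)
    (g : Matrix (Fin 2) (Fin 2) (GaloisField p f))
    {P : MvPolynomial (Fin f × Fin 2) (GaloisField p f)} (hP : P ∈ thetaIdeal p m) :
    actHom p f g P ∈ truncIdeal p m := by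
  suffices h : thetaIdeal p m ≤ (truncIdeal p m).comap (actHom p f g) from h hP
  refine Ideal.span_le.2 ?_
  rintro _ ⟨k, rfl⟩
  simp only [SetLike.mem_coe, Ideal.mem_comap, map_pow, actHom_thetaTw, mul_pow]
  refine Ideal.mul_mem_left _ _ ?_
  rw [thetaTw, sub_eq_add_neg, add_pow]
  refine Ideal.sum_mem _ fun i hi => Ideal.mul_mem_right _ _ ?_
  rcases Nat.lt_or_ge i (m k + 1) with h | h
  · refine Ideal.mul_mem_left _ _ ?_
    obtain ⟨n, hn⟩ := Nat.exists_eq_succ_of_ne_zero (Nat.sub_ne_zero_of_lt h)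
    rw [hn, pow_succ]
    refine Ideal.mul_mem_left _ _ (neg_mem (Ideal.mul_mem_left _ _ (X_pow_mem_truncIdeal ?_)))
    have := hm (k - 1)
    have := (Fact.out : p.Prime).pos
    omega
  · rw [mul_pow]
    exact Ideal.mul_mem_right _ _ (Ideal.mul_mem_right _ _ (X_pow_mem_truncIdeal h))

/-- The substitution `Y_j ↦ Y_j + 1`. -/
noncomputable def shiftHom (p f : ℕ) [Fact p.Prime] :
    MvPolynomial (Fin f × Fin 2) (GaloisField p f) →ₐ[GaloisField p f]
      MvPolynomial (Fin f × Fin 2) (GaloisField p f) :=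
  aeval fun v => X v + if v.2 = 1 then 1 else 0

/-- The multidegree-`m` component of `P(X_j, Y_j + 1)`. -/
noncomputable def trunc (p : ℕ) [Fact p.Prime] {f : ℕ} (m : Fin f → ℕ) :
    MvPolynomial (Fin f × Fin 2) (GaloisField p f) →ₗ[GaloisField p f]
      MvPolynomial (Fin f × Fin 2) (GaloisField p f) :=
  weightedHomogeneousComponent (wt f) m ∘ₗ (shiftHom p f).toLinearMap

theorem shiftHom_X_zero (j : Fin f) : shiftHom p f (X (j, 0)) = X (j, 0) := by
  simp [shiftHom]

theorem shiftHom_X_one (j : Fin f) : shiftHom p f (X (j, 1)) = X (j, 1) + 1 := by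
  simp [shiftHom]

theorem trunc_apply (m : Fin f → ℕ) (P : MvPolynomial (Fin f × Fin 2) (GaloisField p f)) :
    trunc p m P = weightedHomogeneousComponent (wt f) m (shiftHom p f P) := rfl

theorem isWeightedHomogeneous_trunc (m : Fin f → ℕ)
    (P : MvPolynomial (Fin f × Fin 2) (GaloisField p f)) :
    IsWeightedHomogeneous (wt f) (trunc p m P) m :=
  weightedHomogeneousComponent_isWeightedHomogeneous _ _

theorem trunc_eq_zero_of_mem {m : Fin f → ℕ}
    {P : MvPolynomial (Fin f × Fin 2) (GaloisField p f)} (hP : P ∈ truncIdeal p m) :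
    trunc p m P = 0 := by
  classical
  obtain ⟨c, rfl⟩ := Ideal.mem_span_range_iff_exists_fun.1 hP
  rw [trunc_apply, map_sum, map_sum]
  refine Finset.sum_eq_zero fun j _ => ?_
  rw [map_mul, map_pow, shiftHom_X_zero]
  ext d
  rw [coeff_weightedHomogeneousComponent, coeff_zero]
  split_ifs with hd
  · rw [X_pow_eq_monomial, coeff_mul_monomial', if_neg]
    intro hle
    have h1 := hle (j, 0)
    have h2 := congrFun hd j
    rw [weight_wt] at h2
    simp at h1 h2
    omega
  · rfl

theorem trunc_mon {m a b : Fin f → ℕ} (ha : a ≤ m) (hb : m - a ≤ b) :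
    trunc p m (mon p a b) =
      (∏ j, ((b j).choose (m j - a j) : GaloisField p f)) • mon p a (m - a) := by
  classical
  have key : shiftHom p f (mon p a b) =
      ∑ l ∈ Fintype.piFinset fun j => Finset.range (b j + 1),
        (∏ j, ((b j).choose (l j) : GaloisField p f)) • mon p a l := by
    simp only [mon, map_prod, map_mul, map_pow, shiftHom_X_zero, shiftHom_X_one, add_pow,
      Finset.mul_sum, Finset.prod_univ_sum, smul_eq_C_mul, ← Finset.prod_mul_distrib]
    refine Finset.sum_congr rfl fun l _ => Finset.prod_congr rfl fun j _ => ?_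
    simp
    ring
  rw [trunc_apply, key, map_sum, Finset.sum_eq_single (m - a)]
  · rw [map_smul, weightedHomogeneousComponent_of_mem (isWeightedHomogeneous_mon _ _), if_pos]
    · rfl
    · exact (add_tsub_cancel_of_le ha).symm
  · intro l _ hl
    rw [map_smul, weightedHomogeneousComponent_of_mem (isWeightedHomogeneous_mon _ _), if_neg,
      smul_zero]
    rintro rfl
    exact hl (by simp)
  · intro h
    refine absurd (Fintype.mem_piFinset.2 fun j => ?_) h
    exact Finset.mem_range.2 (Nat.lt_succ_of_le (hb j))

theorem trunc_actHom {m r : Fin f → ℕ} (hmr : m ≤ r)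
    {P : MvPolynomial (Fin f × Fin 2) (GaloisField p f)} (hP : IsWeightedHomogeneous (wt f) P r)
    {b : Matrix (Fin 2) (Fin 2) (GaloisField p f)} (hb : b 1 0 = 0) (hd : b 1 1 ≠ 0) :
    trunc p m (actHom p f b P) =
      (b 1 1) ^ (∑ j : Fin f, (r j - m j) * p ^ (j : ℕ)) • actHom p f b (trunc p m P) := by
  have hp : p ≠ 0 := (Fact.out : p.Prime).ne_zero
  obtain ⟨b', hb'⟩ : ∃ b', b' = (b 1 1)⁻¹ • b := ⟨_, rfl⟩
  have hbb : b = b' * (b 1 1 • 1) := by simp [hb', smul_smul, hd]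
  have hcomm (Q) : shiftHom p f (actHom p f b' Q) = actHom p f b' (shiftHom p f Q) := by
    rw [← AlgHom.comp_apply, ← AlgHom.comp_apply,
      show (shiftHom p f).comp (actHom p f b') = (actHom p f b').comp (shiftHom p f) from
        algHom_ext fun v => ?_]
    obtain ⟨j, i⟩ := v
    fin_cases i <;>
      simp [actHom_X, shiftHom_X_zero, shiftHom_X_one, hb', hb, hd, hp, algHom_C, add_assoc]
  have hcomm' (Q) : trunc p m (actHom p f b' Q) = actHom p f b' (trunc p m Q) := by
    rw [trunc_apply, hcomm]
    exact weightedHomogeneousComponent_aeval (isWeightedHomogeneous_actHom_gen b') m _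
  have hsum : ∑ j : Fin f, r j * p ^ (j : ℕ) =
      ∑ j : Fin f, (r j - m j) * p ^ (j : ℕ) + ∑ j : Fin f, m j * p ^ (j : ℕ) := by
    rw [← Finset.sum_add_distrib]
    refine Finset.sum_congr rfl fun j _ => ?_
    rw [← add_mul, Nat.sub_add_cancel (hmr j)]
  obtain ⟨d, hdd⟩ : ∃ d, d = b 1 1 := ⟨_, rfl⟩
  rw [← hdd] at hbb ⊢
  rw [hbb, actHom_mul, actHom_mul, actHom_scalar hP,
    actHom_scalar (isWeightedHomogeneous_trunc m P), map_smul, map_smul, map_smul, hcomm', hsum,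
    pow_add, mul_smul]

/-! ### Surjectivity -/

theorem prod_choose_ne_zero {r m a : Fin f → ℕ} (hm : ∀ j, m j ≤ p - 1)
    (hchoose : ∀ j, ¬ p ∣ Nat.choose (r j) (m j)) (ha : a ≤ m) :
    (∏ j, ((r j - a j).choose (m j - a j) : GaloisField p f)) ≠ 0 := by
  have hp := (Fact.out : p.Prime)
  refine Finset.prod_ne_zero_iff.2 fun j _ => ?_
  rw [Ne, CharP.cast_eq_zero_iff (GaloisField p f) p]
  intro h
  have h1 : p ∣ (r j).choose (m j) * (m j).choose (a j) := by
    rw [Nat.choose_mul (ha j)]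
    exact h.mul_left _
  rcases hp.dvd_mul.1 h1 with h2 | h2
  · exact hchoose j h2
  · have h3 : p ∣ (m j).factorial := by
      rw [← Nat.choose_mul_factorial_mul_factorial (ha j)]
      exact (h2.mul_right _).mul_right _
    have := hp.dvd_factorial.1 h3
    have := hm j
    have := hp.pos
    omega

section Surjectivity

variable [NeZero f]

/-- A polynomial vanishing to order `m_0 + 1` at all rational points other than `[0 : 1]`. -/
noncomputable def bump (p : ℕ) [Fact p.Prime] {f : ℕ} [NeZero f] (m : Fin f → ℕ) :
    MvPolynomial (Fin f × Fin 2) (GaloisField p f) :=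
  (X (0, 1) ^ p ^ f - X (0, 1) * X (0, 0) ^ (p ^ f - 1)) ^ (m 0 + 1)

theorem isWeightedHomogeneous_bump (m : Fin f → ℕ) :
    IsWeightedHomogeneous (wt f) (bump p m) (Pi.single 0 ((m 0 + 1) * p ^ f)) := by
  have h0 : (p ^ f - 1) + 1 = p ^ f :=
    Nat.sub_add_cancel ((Fact.out : p.Prime).pos.trans_le (Nat.le_self_pow (NeZero.ne f) p))
  have h1 : Pi.single 0 ((m 0 + 1) * p ^ f) = (m 0 + 1) • (p ^ f) • wt f (0, 1) := by
    simp [wt, ← Pi.single_smul]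
  have h2 : (p ^ f) • wt f (0, 1) = wt f (0, 1) + (p ^ f - 1) • wt f (0, 0) := by
    conv_lhs => rw [← h0]
    simp [wt, add_smul, add_comm]
  rw [h1]
  refine IsWeightedHomogeneous.pow (((isWeightedHomogeneous_X _ _ _).pow _).sub ?_) _
  rw [h2]
  exact (isWeightedHomogeneous_X _ _ _).mul ((isWeightedHomogeneous_X _ _ _).pow _)

theorem bump_sub_mem_truncIdeal {m : Fin f → ℕ} (hm : ∀ j, m j ≤ p - 1) :
    bump p m - X (0, 1) ^ ((m 0 + 1) * p ^ f) ∈ truncIdeal p m := by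
  have hp := (Fact.out : p.Prime).two_le
  have hq := Nat.le_self_pow (NeZero.ne f) p
  have h0 := hm 0
  rw [mul_comm, pow_mul, bump]
  rcases (show m 0 + 1 ≤ p by omega).lt_or_eq with h | h
  · obtain ⟨c, hc⟩ := sub_dvd_pow_sub_pow
      (X (0, 1) ^ p ^ f - X (0, 1) * X (0, 0) ^ (p ^ f - 1) :
        MvPolynomial (Fin f × Fin 2) (GaloisField p f)) (X (0, 1) ^ p ^ f) (m 0 + 1)
    rw [hc, sub_sub_cancel_left]
    exact Ideal.mul_mem_right _ _ (neg_mem (Ideal.mul_mem_left _ _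
      (X_pow_mem_truncIdeal (by omega))))
  · rw [h, sub_pow_char, sub_sub_cancel_left, mul_pow, ← pow_mul]
    refine neg_mem (Ideal.mul_mem_left _ _ (X_pow_mem_truncIdeal ?_))
    rw [h]
    exact Nat.le_mul_of_pos_left _ (by omega)

theorem actHom_bump_mem_truncIdeal (m : Fin f → ℕ)
    {x : Matrix (Fin 2) (Fin 2) (GaloisField p f)} (hx : x 1 0 ≠ 0) :
    actHom p f x (bump p m) ∈ truncIdeal p m := by
  have h0 : (p ^ f - 1) + 1 = p ^ f :=
    Nat.sub_add_cancel ((Fact.out : p.Prime).pos.trans_le (Nat.le_self_pow (NeZero.ne f) p))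
  suffices h : X (0, 0) ∣ actHom p f x
      (X (0, 1) ^ p ^ f - X (0, 1) * X (0, 0) ^ (p ^ f - 1)) by
    obtain ⟨c, hc⟩ := h
    rw [bump, map_pow, hc, mul_pow]
    exact Ideal.mul_mem_right _ _ (X_pow_mem_truncIdeal le_rfl)
  rw [← Ideal.mem_span_singleton, ← Ideal.Quotient.eq_zero_iff_mem]
  have hX : Ideal.Quotient.mk (Ideal.span {(X (0, 0) :
      MvPolynomial (Fin f × Fin 2) (GaloisField p f))}) (X (0, 0)) = 0 :=
    Ideal.Quotient.eq_zero_iff_mem.2 (Ideal.mem_span_singleton_self _)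
  simp only [map_sub, map_mul, map_pow, actHom_X, map_add, hX, mul_zero, zero_add, Fin.val_zero,
    pow_zero, pow_one, mul_pow]
  rw [← map_pow, ← C_pow, pow_prime_pow_eq_self, ← map_pow (Ideal.Quotient.mk _) (C _), ← C_pow,
    pow_prime_pow_sub_one_eq_one hx, map_one, map_one, one_mul, mul_assoc, ← pow_succ', h0,
    sub_self]

/-- Any prescribed truncation at the point `[0 : 1]` is attained by a polynomial whose truncations
at all other rational points vanish. -/
theorem exists_trunc_eq {r m : Fin f → ℕ} (hm : ∀ j, m j ≤ p - 1)
    (hr2 : ∀ j, (m j + 1) * (p ^ f + 1) ≤ r j)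
    (hchoose : ∀ j, ¬ p ∣ Nat.choose (r j) (m j))
    {V : MvPolynomial (Fin f × Fin 2) (GaloisField p f)}
    (hV : IsWeightedHomogeneous (wt f) V m) :
    ∃ Q, IsWeightedHomogeneous (wt f) Q r ∧ trunc p m Q = V ∧
      ∀ x : Matrix (Fin 2) (Fin 2) (GaloisField p f), x 1 0 ≠ 0 →
        trunc p m (actHom p f x Q) = 0 := by
  let S : Submodule (GaloisField p f) (MvPolynomial (Fin f × Fin 2) (GaloisField p f)) :=
    weightedHomogeneousSubmodule _ (wt f) r ⊓
      ⨅ x : {x : Matrix (Fin 2) (Fin 2) (GaloisField p f) // x 1 0 ≠ 0},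
        LinearMap.ker (trunc p m ∘ₗ (actHom p f x.1).toLinearMap)
  suffices h : V ∈ S.map (trunc p m) by
    obtain ⟨Q, hQ, rfl⟩ := h
    obtain ⟨h1, h2⟩ := Submodule.mem_inf.1 hQ
    exact ⟨Q, h1, rfl, fun x hx => (Submodule.mem_iInf _).1 h2 ⟨x, hx⟩⟩
  refine mem_of_isWeightedHomogeneous hV _ fun a a' haa => ?_
  have ha : a ≤ m := haa ▸ le_self_add
  obtain rfl : a' = m - a := by rw [← haa, add_tsub_cancel_left]
  have hle : a + Pi.single 0 ((m 0 + 1) * p ^ f) ≤ r := by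
    intro j
    change a j + _ ≤ _
    have h1 := hr2 j
    have h2 : a j ≤ m j := ha j
    rw [mul_add_one] at h1
    by_cases hj : j = 0
    · subst hj
      simp
      omega
    · simp [hj]
      omega
  obtain ⟨b, hb⟩ := exists_add_of_le hle
  have hab : a ≤ r := le_self_add.trans hle
  have hb' : r - a = Pi.single 0 ((m 0 + 1) * p ^ f) + b := by
    rw [hb, add_assoc, add_tsub_cancel_left]
  have hmr : m ≤ r := fun j => by
    change m j ≤ r j
    have h1 := hr2 j
    rw [mul_add_one] at h1
    omega
  have hc := prod_choose_ne_zero hm hchoose ha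
  refine ⟨(∏ j, ((r j - a j).choose (m j - a j) : GaloisField p f))⁻¹ • (bump p m * mon p a b),
    Submodule.smul_mem _ _ (Submodule.mem_inf.2 ⟨?_, (Submodule.mem_iInf _).2 fun x => ?_⟩), ?_⟩
  · rw [mem_weightedHomogeneousSubmodule, show r = Pi.single 0 ((m 0 + 1) * p ^ f) + (a + b) by
      rw [hb]; abel]
    exact (isWeightedHomogeneous_bump m).mul (isWeightedHomogeneous_mon a b)
  · rw [LinearMap.mem_ker, LinearMap.comp_apply, AlgHom.toLinearMap_apply, map_mul]
    exact trunc_eq_zero_of_mem (Ideal.mul_mem_right _ _ (actHom_bump_mem_truncIdeal m x.2))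
  · have h1 : trunc p m (bump p m * mon p a b) = trunc p m (mon p a (r - a)) := by
      rw [← sub_eq_zero, ← map_sub]
      refine trunc_eq_zero_of_mem ?_
      rw [hb', ← zero_add a, ← mon_mul_mon, zero_add, ← X_one_pow_eq_mon, ← sub_mul]
      exact Ideal.mul_mem_right _ _ (bump_sub_mem_truncIdeal hm)
    rw [map_smul, h1, trunc_mon ha (tsub_le_tsub_right hmr a), smul_smul]
    exact (congrArg (· • _) (inv_mul_cancel₀ hc)).trans (one_smul _ _)

end Surjectivity

/-- Representatives of the cosets `B(𝔽_q) \ GL₂(𝔽_q)`, indexed by `ℙ¹(𝔽_q)`. -/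
noncomputable def rep (p f : ℕ) [Fact p.Prime] :
    Option (GaloisField p f) → Matrix.GeneralLinearGroup (Fin 2) (GaloisField p f)
  | none => 1
  | some c => Matrix.GeneralLinearGroup.mkOfDetNeZero !![0, 1; 1, c] (by simp)

theorem mul_inv_val_one_zero (g h : Matrix.GeneralLinearGroup (Fin 2) (GaloisField p f)) :
    (g * h⁻¹).val 1 0 =
      h.val.det⁻¹ * (g.val 1 0 * h.val 1 1 - g.val 1 1 * h.val 1 0) := by
  rw [Units.val_mul, Matrix.coe_units_inv, Matrix.inv_def, Matrix.adjugate_fin_two]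
  simp [Matrix.mul_apply, Fin.sum_univ_two]
  ring

theorem det_val_ne_zero (g : Matrix.GeneralLinearGroup (Fin 2) (GaloisField p f)) :
    g.val.det ≠ 0 :=
  ((Matrix.isUnit_iff_isUnit_det _).1 g.isUnit).ne_zero

theorem exists_mul_rep_inv (g : Matrix.GeneralLinearGroup (Fin 2) (GaloisField p f)) :
    ∃ o, (g * (rep p f o)⁻¹).val 1 0 = 0 := by
  by_cases h : g.val 1 0 = 0
  · exact ⟨none, by simpa [rep] using h⟩
  · refine ⟨some (g.val 1 1 / g.val 1 0), ?_⟩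
    rw [mul_inv_val_one_zero]
    simp [rep, Matrix.GeneralLinearGroup.mkOfDetNeZero, mul_div_cancel₀ _ h]

theorem rep_mul_rep_inv {o o' : Option (GaloisField p f)} (h : o ≠ o') :
    (rep p f o * (rep p f o')⁻¹).val 1 0 ≠ 0 := by
  rw [mul_inv_val_one_zero]
  refine mul_ne_zero (inv_ne_zero (det_val_ne_zero _)) ?_
  rcases o with _ | c <;> rcases o' with _ | c' <;>
    simp_all [rep, Matrix.GeneralLinearGroup.mkOfDetNeZero, sub_eq_zero, eq_comm]

theorem actHom_val_mul (g h : Matrix.GeneralLinearGroup (Fin 2) (GaloisField p f))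
    (P : MvPolynomial (Fin f × Fin 2) (GaloisField p f)) :
    actHom p f (g * h).val P = actHom p f g.val (actHom p f h.val P) := by
  rw [Units.val_mul, actHom_mul]

/-- Truncations at all rational points can be prescribed simultaneously. -/
theorem exists_trunc_actHom_rep_eq [NeZero f] {r m : Fin f → ℕ} (hm : ∀ j, m j ≤ p - 1)
    (hr2 : ∀ j, (m j + 1) * (p ^ f + 1) ≤ r j)
    (hchoose : ∀ j, ¬ p ∣ Nat.choose (r j) (m j))
    (t : Option (GaloisField p f) → MvPolynomial (Fin f × Fin 2) (GaloisField p f))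
    (ht : ∀ o, IsWeightedHomogeneous (wt f) (t o) m) :
    ∃ P, IsWeightedHomogeneous (wt f) P r ∧
      ∀ o, trunc p m (actHom p f (rep p f o).val P) = t o := by
  classical
  have := Fintype.ofFinite (GaloisField p f)
  choose Q hQ hQt hQ0 using fun o => exists_trunc_eq hm hr2 hchoose (ht o)
  refine ⟨∑ o, actHom p f ((rep p f o)⁻¹).val (Q o),
    IsWeightedHomogeneous.sum _ _ _ fun o _ => isWeightedHomogeneous_actHom _ (hQ o), fun o => ?_⟩
  rw [map_sum, map_sum, Finset.sum_eq_single o]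
  · rw [← actHom_val_mul, mul_inv_cancel, Units.val_one, actHom_one, hQt]
  · intro o' _ ho
    rw [← actHom_val_mul]
    exact hQ0 _ _ (rep_mul_rep_inv ho.symm)
  · simp

/-! ### The upper bound on the quotient -/

section UpperBound

variable [NeZero f]

/-- The multidegree of `θ_k`. -/
def thetaDeg (p : ℕ) {f : ℕ} [NeZero f] (k : Fin f) : Fin f → ℕ :=
  Pi.single k 1 + Pi.single (k - 1) p

theorem thetaDeg_apply (p : ℕ) {f : ℕ} [NeZero f] (k j : Fin f) :
    thetaDeg p k j = (if j = k then 1 else 0) + if j + 1 = k then p else 0 := by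
  simp [thetaDeg, Pi.single_apply, eq_sub_iff_add_eq]

theorem exists_eq_single_add {f : ℕ} {a : Fin f → ℕ} {k : Fin f} {n : ℕ} (h : n ≤ a k) :
    ∃ a' : Fin f → ℕ, a = Pi.single k n + a' := by
  refine exists_add_of_le fun j => ?_
  by_cases hj : j = k
  · subst hj; simpa using h
  · simp [hj]

/-- The multiples of the `θ_k^{m_k+1}` by multihomogeneous polynomials, in multidegree `r`. -/
noncomputable def thetaSpan (p : ℕ) [Fact p.Prime] {f : ℕ} [NeZero f] (r m : Fin f → ℕ) :
    Submodule (GaloisField p f) (MvPolynomial (Fin f × Fin 2) (GaloisField p f)) :=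
  Submodule.span _ {P | ∃ k A s, IsWeightedHomogeneous (wt f) A s ∧
    s + (m k + 1) • thetaDeg p k = r ∧ P = thetaTw p f k ^ (m k + 1) * A}

theorem mul_mem_thetaSpan {r m s : Fin f → ℕ} {k : Fin f}
    {A : MvPolynomial (Fin f × Fin 2) (GaloisField p f)} (hA : IsWeightedHomogeneous (wt f) A s)
    (hs : s + (m k + 1) • thetaDeg p k = r) :
    thetaTw p f k ^ (m k + 1) * A ∈ thetaSpan p r m :=
  Submodule.subset_span ⟨k, A, s, hA, hs, rfl⟩

theorem thetaTw_eq_mon_sub_mon (k : Fin f) :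
    thetaTw p f k = mon p (Pi.single k 1) (Pi.single (k - 1) p) -
      mon p (Pi.single (k - 1) p) (Pi.single k 1) := by
  have h1 := mon_mul_mon (p := p) (Pi.single k 1) 0 0 (Pi.single (k - 1) p)
  have h2 := mon_mul_mon (p := p) (Pi.single (k - 1) p) 0 0 (Pi.single k 1)
  rw [add_zero, zero_add] at h1 h2
  rw [← h1, ← h2, ← X_zero_pow_eq_mon, ← X_zero_pow_eq_mon, ← X_one_pow_eq_mon,
    ← X_one_pow_eq_mon, thetaTw]
  ring

theorem isWeightedHomogeneous_thetaTw (k : Fin f) :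
    IsWeightedHomogeneous (wt f) (thetaTw p f k) (thetaDeg p k) := by
  rw [thetaTw_eq_mon_sub_mon]
  refine (isWeightedHomogeneous_mon _ _).sub ?_
  rw [add_comm]
  exact isWeightedHomogeneous_mon _ _

theorem forall_of_forall_sub_one {f : ℕ} [NeZero f] {S : Fin f → Prop}
    (h : ∀ k, S k → S (k - 1)) {k : Fin f} (hk : S k) : ∀ j, S j := by
  obtain ⟨n, rfl⟩ := Nat.exists_eq_succ_of_ne_zero (NeZero.ne f)
  have hs (i : Fin n) (hi : S i.succ) : S i.castSucc := by
    convert h _ hi using 1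
    exact Fin.ext (by simp [Fin.coe_sub_one, Fin.succ_ne_zero])
  have h0 : ∀ i : Fin (n + 1), S i → S 0 := fun i => by
    induction i using Fin.induction with
    | zero => exact id
    | succ i ih => exact fun hi => ih (hs i hi)
  have hl : S (Fin.last n) := by
    convert h _ (h0 k hk) using 1
    exact Fin.ext (by simp)
  exact fun j => Fin.reverseInduction hl hs j

theorem exists_spanning_of_zero {r : Fin f → ℕ} (hr : ∀ j, p ≤ r j) :
    ∃ Z : Finset (MvPolynomial (Fin f × Fin 2) (GaloisField p f)), Z.card ≤ p ^ f + 1 ∧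
      weightedHomogeneousSubmodule (GaloisField p f) (wt f) r ≤
        Submodule.span (GaloisField p f) Z ⊔ thetaSpan p r 0 := by
  classical
  have hp := (Fact.out : p.Prime).two_le
  let Z : Finset (MvPolynomial (Fin f × Fin 2) (GaloisField p f)) :=
    insert (mon p 0 r) (Finset.univ.image fun t : Fin f → Fin p =>
      mon p (fun j => r j - t j) fun j => t j)
  have hZ : Z.card ≤ p ^ f + 1 := by
    refine (Finset.card_insert_le (mon p 0 r) _).trans (Nat.succ_le_succ ?_)
    exact Finset.card_image_le.trans (by simp)
  refine ⟨Z, hZ, fun P hP => ?_⟩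
  have key : ∀ n, ∀ a b : Fin f → ℕ, ∑ j, b j = n → a + b = r →
      mon p a b ∈ Submodule.span (GaloisField p f) (Z : Set _) ⊔ thetaSpan p r 0 := by
    intro n
    induction n using Nat.strong_induction_on with
    | _ n ih =>
    intro a b hn hab
    have hab' (j : Fin f) : a j + b j = r j := congrFun hab j
    by_cases h0 : a = 0
    · refine Submodule.mem_sup_left (Submodule.subset_span ?_)
      obtain rfl : b = r := by rw [← hab, h0, zero_add]
      rw [h0]
      exact Finset.mem_coe.2 (Finset.mem_insert_self (mon p 0 b) _)
    by_cases h1 : ∀ j, b j < p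
    · refine Submodule.mem_sup_left (Submodule.subset_span
        (Finset.mem_insert_of_mem
          (Finset.mem_image.2 ⟨fun j => ⟨b j, h1 j⟩, Finset.mem_univ _, ?_⟩)))
      congr 1
      funext j
      exact (Nat.eq_sub_of_add_eq (hab' j)).symm
    obtain ⟨k, hk, hk'⟩ : ∃ k, 1 ≤ a k ∧ p ≤ b (k - 1) := by
      by_contra! hcon
      obtain ⟨k, hk⟩ := Function.ne_iff.1 h0
      have hall := forall_of_forall_sub_one (S := fun k => 1 ≤ a k) (fun k hk => by
        have := hcon k hk
        have := hab' (k - 1)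
        have := hr (k - 1)
        omega) (Nat.one_le_iff_ne_zero.2 hk)
      refine h1 fun j => ?_
      have := hcon (j + 1) (hall _)
      rwa [add_sub_cancel_right] at this
    obtain ⟨a', rfl⟩ : ∃ a', a = Pi.single k 1 + a' := exists_eq_single_add hk
    obtain ⟨b', rfl⟩ : ∃ b' : Fin f → ℕ, b = Pi.single (k - 1) p + b' := exists_eq_single_add hk'
    have heq : mon p (Pi.single k 1 + a') (Pi.single (k - 1) p + b') =
        mon p (Pi.single (k - 1) p + a') (Pi.single k 1 + b') +
          thetaTw p f k ^ ((0 : Fin f → ℕ) k + 1) * mon p a' b' := by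
      rw [← mon_mul_mon, ← mon_mul_mon, thetaTw_eq_mon_sub_mon, Pi.zero_apply, zero_add, pow_one]
      ring
    rw [heq]
    refine add_mem (ih _ ?_ _ _ rfl ?_) (Submodule.mem_sup_right
      (mul_mem_thetaSpan (isWeightedHomogeneous_mon a' b') ?_))
    · rw [← hn]
      simp only [Pi.add_apply, Finset.sum_add_distrib, Finset.sum_pi_single', Finset.mem_univ,
        if_true]
      omega
    · rw [← hab]; abel
    · rw [← hab, thetaDeg, Pi.zero_apply, zero_add, one_smul]; abel
  exact mem_of_isWeightedHomogeneous hP _ fun a b hab => key _ a b rfl hab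

/-- The multidegree-`r` component is spanned by `(q+1)∏(m_j+1)` elements modulo the
`θ_j^{m_j+1}`. -/
theorem exists_spanning {r m : Fin f → ℕ} (hr : ∀ j, p + m j + p * m (j + 1) ≤ r j) :
    ∃ Z : Finset (MvPolynomial (Fin f × Fin 2) (GaloisField p f)),
      Z.card ≤ (p ^ f + 1) * ∏ j, (m j + 1) ∧
      weightedHomogeneousSubmodule (GaloisField p f) (wt f) r ≤
        Submodule.span (GaloisField p f) Z ⊔ thetaSpan p r m := by
  classical
  induction hN : ∑ j, m j using Nat.strong_induction_on generalizing r m with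
  | _ N ih =>
  by_cases h0 : m = 0
  · subst h0
    simpa using exists_spanning_of_zero (p := p) (r := r) fun j => by
      have := hr j
      omega
  obtain ⟨k, hk⟩ := Function.ne_iff.1 h0
  obtain ⟨m₂, hm⟩ : ∃ m₂ : Fin f → ℕ, m = m₂ + Pi.single k 1 := by
    obtain ⟨m₂, h⟩ := exists_eq_single_add (Nat.one_le_iff_ne_zero.2 hk)
    exact ⟨m₂, h.trans (add_comm _ _)⟩
  obtain ⟨m₁, hm₁⟩ : ∃ m₁, m₁ = Function.update m₂ k 0 := ⟨_, rfl⟩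
  have hm₁k : m₁ k = 0 := by simp [hm₁]
  have hm₁j {j : Fin f} (hj : j ≠ k) : m₁ j = m₂ j := by simp [hm₁, hj]
  have hmk : m k = m₂ k + 1 := by simp [hm]
  have hmj {j : Fin f} (hj : j ≠ k) : m j = m₂ j := by simp [hm, hj]
  have hms (j : Fin f) : m j = m₂ j + if j = k then 1 else 0 := by
    simp [hm, Pi.single_apply]
  have hle (j : Fin f) : m₁ j ≤ m₂ j := by
    by_cases hj : j = k
    · subst hj; simp [hm₁k]
    · exact (hm₁j hj).le
  have hN₂ : ∑ j, m₂ j < N := by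
    rw [← hN, hm]
    simp [Finset.sum_add_distrib]
  have hle' (j : Fin f) : m₂ j ≤ m j := by
    rw [hms]
    exact Nat.le_add_right _ _
  obtain ⟨s₀, hs₀⟩ : ∃ s₀, r = thetaDeg p k + s₀ := exists_add_of_le fun j => by
    have h1 := hr j
    change thetaDeg p k j ≤ r j
    rw [thetaDeg_apply]
    rw [hms j, hms (j + 1), mul_add, mul_ite, mul_one, mul_zero] at h1
    omega
  obtain ⟨Z₁, hZ₁, hs₁⟩ := @ih (∑ j, m₁ j)
    ((Finset.sum_le_sum fun j _ => hle j).trans_lt hN₂) r m₁ (fun j => (by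
      have := hr j
      have h1 := (hle j).trans (hle' j)
      have h2 := Nat.mul_le_mul_left p ((hle (j + 1)).trans (hle' (j + 1)))
      omega)) rfl
  obtain ⟨Z₂, hZ₂, hs₂⟩ := @ih _ hN₂ s₀ m₂ (fun j => (by
      have h1 := hr j
      have h2 : r j = thetaDeg p k j + s₀ j := congrFun hs₀ j
      rw [thetaDeg_apply] at h2
      rw [hms j, hms (j + 1), mul_add, mul_ite, mul_one, mul_zero] at h1
      omega)) rfl
  have hprod : ∏ j, (m j + 1) = ∏ j, (m₁ j + 1) + ∏ j, (m₂ j + 1) := by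
    rw [← Finset.mul_prod_erase Finset.univ _ (Finset.mem_univ k),
      ← Finset.mul_prod_erase Finset.univ (fun j => m₁ j + 1) (Finset.mem_univ k),
      ← Finset.mul_prod_erase Finset.univ (fun j => m₂ j + 1) (Finset.mem_univ k),
      Finset.prod_congr (g := fun j => m₂ j + 1) rfl fun j hj => by
        rw [hmj (Finset.ne_of_mem_erase hj)],
      Finset.prod_congr (f := fun j => m₁ j + 1) (g := fun j => m₂ j + 1) rfl fun j hj => by
        rw [hm₁j (Finset.ne_of_mem_erase hj)], hm₁k, hmk]
    ring
  refine ⟨Z₁ ∪ Z₂.image (thetaTw p f k * ·), ?_, hs₁.trans (sup_le ?_ (Submodule.span_le.2 ?_))⟩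
  · rw [hprod, mul_add]
    exact (Finset.card_union_le _ _).trans
      (add_le_add hZ₁ (Finset.card_image_le.trans hZ₂))
  · exact le_sup_of_le_left (Submodule.span_mono (by simp))
  rintro _ ⟨j, A, s, hA, hs, rfl⟩
  by_cases hj : j = k
  · subst hj
    rw [hm₁k, zero_add, one_smul, hs₀, add_comm, add_right_inj] at hs
    subst hs
    rw [hm₁k, zero_add, pow_one]
    suffices h : weightedHomogeneousSubmodule (GaloisField p f) (wt f) s ≤
        (Submodule.span (GaloisField p f) (↑(Z₁ ∪ Z₂.image (thetaTw p f j * ·)) : Set _) ⊔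
          thetaSpan p r m).comap
            (LinearMap.mulLeft (GaloisField p f) (thetaTw p f j)) from h hA
    refine hs₂.trans (sup_le (Submodule.span_le.2 fun z hz => ?_) (Submodule.span_le.2 ?_))
    · exact Submodule.mem_sup_left (Submodule.subset_span (Finset.mem_union_right _
        (Finset.mem_image_of_mem _ hz)))
    · rintro _ ⟨i, A', s', hA', hs', rfl⟩
      refine Submodule.mem_sup_right ?_
      rw [LinearMap.mulLeft_apply]
      by_cases hi : i = j
      · subst hi
        rw [← mul_assoc, ← pow_succ', ← hmk]
        refine mul_mem_thetaSpan hA' ?_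
        rw [hmk, hs₀, ← hs', add_smul _ 1, one_smul]
        abel
      · rw [mul_left_comm, ← hmj hi]
        refine mul_mem_thetaSpan ((isWeightedHomogeneous_thetaTw j).mul hA') ?_
        rw [hmj hi, hs₀, ← hs', add_assoc]
  · rw [hm₁j hj, ← hmj hj]
    refine Submodule.mem_sup_right (mul_mem_thetaSpan hA ?_)
    rw [← hs, hmj hj, hm₁j hj]

end UpperBound

/-! ### The kernel of the truncations -/

/-- The exponents of the monomials of multidegree `m`. -/
noncomputable def exponent (m : Fin f → ℕ) (i : ∀ j, Fin (m j + 1)) : Fin f × Fin 2 →₀ ℕ :=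
  Finsupp.equivFunOnFinite.symm fun v => if v.2 = 0 then (i v.1 : ℕ) else m v.1 - i v.1

theorem exponent_injective (m : Fin f → ℕ) : Function.Injective (exponent m) := by
  intro i i' h
  funext j
  have := DFunLike.congr_fun h (j, 0)
  exact Fin.ext (by simpa [exponent] using this)

theorem weight_exponent (m : Fin f → ℕ) (i : ∀ j, Fin (m j + 1)) :
    Finsupp.weight (wt f) (exponent m i) = m := by
  rw [weight_wt]
  funext j
  have := (i j).is_lt
  simp only [exponent, Finsupp.equivFunOnFinite_symm_apply_apply, if_true, one_ne_zero, if_false]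
  omega

/-- The coefficients of the truncations of the translates of a polynomial by the `rep o`. -/
noncomputable def truncCoeffs (p : ℕ) [Fact p.Prime] {f : ℕ} (m : Fin f → ℕ) :
    MvPolynomial (Fin f × Fin 2) (GaloisField p f) →ₗ[GaloisField p f]
      (Option (GaloisField p f) × (∀ j, Fin (m j + 1)) → GaloisField p f) :=
  LinearMap.pi fun x => lcoeff (GaloisField p f) (exponent m x.2) ∘ₗ
    trunc p m ∘ₗ (actHom p f (rep p f x.1).val).toLinearMap

theorem truncCoeffs_apply (m : Fin f → ℕ) (P : MvPolynomial (Fin f × Fin 2) (GaloisField p f))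
    (x : Option (GaloisField p f) × (∀ j, Fin (m j + 1))) :
    truncCoeffs p m P x =
      coeff (exponent m x.2) (trunc p m (actHom p f (rep p f x.1).val P)) := rfl

section Kernel

variable [NeZero f]

theorem thetaSpan_le_thetaIdeal (r m : Fin f → ℕ) :
    thetaSpan p r m ≤ (thetaIdeal p m).restrictScalars (GaloisField p f) := by
  refine Submodule.span_le.2 ?_
  rintro _ ⟨k, A, s, -, -, rfl⟩
  exact Ideal.mul_mem_right _ _ (Ideal.subset_span ⟨k, rfl⟩)

theorem add_add_mul_le {r m : Fin f → ℕ} (hm : ∀ j, m j ≤ p - 1)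
    (hr2 : ∀ j, (m j + 1) * (p ^ f + 1) ≤ r j) (j : Fin f) :
    p + m j + p * m (j + 1) ≤ r j := by
  have hp := (Fact.out : p.Prime).two_le
  refine le_trans ?_ (hr2 j)
  rcases (Nat.one_le_iff_ne_zero.2 (NeZero.ne f)).eq_or_lt with hf | hf
  · subst hf
    rw [Subsingleton.elim (j + 1) j, pow_one]
    nlinarith
  · have h1 : p * p ≤ p ^ f := by
      rw [← sq]
      exact Nat.pow_le_pow_right (by omega) hf
    have h2 : p * (m (j + 1) + 1) ≤ p * p := Nat.mul_le_mul_left p (by have := hm (j + 1); omega)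
    nlinarith

theorem exists_truncCoeffs_eq {r m : Fin f → ℕ} (hm : ∀ j, m j ≤ p - 1)
    (hr2 : ∀ j, (m j + 1) * (p ^ f + 1) ≤ r j)
    (hchoose : ∀ j, ¬ p ∣ Nat.choose (r j) (m j))
    (t : Option (GaloisField p f) × (∀ j, Fin (m j + 1)) → GaloisField p f) :
    ∃ P, IsWeightedHomogeneous (wt f) P r ∧ truncCoeffs p m P = t := by
  classical
  obtain ⟨P, hP, h⟩ := exists_trunc_actHom_rep_eq hm hr2 hchoose
    (fun o => ∑ i, monomial (exponent m i) (t (o, i)))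
    fun o => (weightedHomogeneousSubmodule (GaloisField p f) (wt f) m).sum_mem fun i _ =>
      isWeightedHomogeneous_monomial _ _ _ (weight_exponent m i)
  refine ⟨P, hP, funext fun ⟨o, i⟩ => ?_⟩
  simp [truncCoeffs_apply, h, coeff_sum, coeff_monomial, (exponent_injective m).eq_iff]

theorem finrank_truncCoeffs_codomain (m : Fin f → ℕ) :
    Module.finrank (GaloisField p f)
      (Option (GaloisField p f) × (∀ j, Fin (m j + 1)) → GaloisField p f) =
      (p ^ f + 1) * ∏ j, (m j + 1) := by
  have := Fintype.ofFinite (GaloisField p f)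
  rw [Module.finrank_fintype_fun_eq_card, Fintype.card_prod, Fintype.card_option,
    ← Nat.card_eq_fintype_card, GaloisField.card p f (NeZero.ne f)]
  simp

theorem truncCoeffs_eq_zero_of_mem {m : Fin f → ℕ} (hm : ∀ j, m j ≤ p - 1)
    {P : MvPolynomial (Fin f × Fin 2) (GaloisField p f)} (hP : P ∈ thetaIdeal p m) :
    truncCoeffs p m P = 0 := by
  funext x
  rw [truncCoeffs_apply, trunc_eq_zero_of_mem (actHom_mem_truncIdeal hm _ hP)]
  simp

theorem mem_thetaIdeal_of_truncCoeffs_eq_zero {r m : Fin f → ℕ} (hm : ∀ j, m j ≤ p - 1)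
    (hr2 : ∀ j, (m j + 1) * (p ^ f + 1) ≤ r j)
    (hchoose : ∀ j, ¬ p ∣ Nat.choose (r j) (m j))
    {P : MvPolynomial (Fin f × Fin 2) (GaloisField p f)}
    (hP : IsWeightedHomogeneous (wt f) P r) (h0 : truncCoeffs p m P = 0) :
    P ∈ thetaIdeal p m := by
  have := Fintype.ofFinite (GaloisField p f)
  obtain ⟨Z, hZ, hspan⟩ := exists_spanning (add_add_mul_le hm hr2)
  have hdecomp {Q : MvPolynomial (Fin f × Fin 2) (GaloisField p f)}
      (hQ : IsWeightedHomogeneous (wt f) Q r) :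
      ∃ u ∈ Submodule.span (GaloisField p f)
          (Z : Set (MvPolynomial (Fin f × Fin 2) (GaloisField p f))),
        ∃ i ∈ thetaIdeal p m, u + i = Q := by
    obtain ⟨u, hu, i, hi, h⟩ := Submodule.mem_sup.1 (hspan hQ)
    exact ⟨u, hu, i, thetaSpan_le_thetaIdeal r m hi, h⟩
  let φ := (truncCoeffs p m).domRestrict (Submodule.span (GaloisField p f)
    (Z : Set (MvPolynomial (Fin f × Fin 2) (GaloisField p f))))
  have hsurj : Function.Surjective φ := fun t => by
    obtain ⟨Q, hQ, rfl⟩ := exists_truncCoeffs_eq hm hr2 hchoose t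
    obtain ⟨u, hu, i, hi, rfl⟩ := hdecomp hQ
    refine ⟨⟨u, hu⟩, ?_⟩
    rw [map_add, truncCoeffs_eq_zero_of_mem hm hi, add_zero]
    rfl
  have hinj : Function.Injective φ := by
    refine (LinearMap.injective_iff_surjective_of_finrank_eq_finrank (le_antisymm ?_
      (LinearMap.finrank_le_finrank_of_surjective hsurj))).2 hsurj
    rw [finrank_truncCoeffs_codomain]
    exact (finrank_span_finset_le_card Z).trans hZ
  obtain ⟨u, hu, i, hi, rfl⟩ := hdecomp hP
  rw [map_add, truncCoeffs_eq_zero_of_mem hm hi, add_zero] at h0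
  have hu0 : u = 0 :=
    congrArg Subtype.val (@hinj ⟨u, hu⟩ 0 (Eq.trans h0 (map_zero φ).symm))
  rwa [hu0, zero_add]

end Kernel

end TwistedPrincipalSeries

/-- twisted principal series: if `0 ≤ m_j ≤ p−1`, `r_j ≥ p^{f−j}`,
`r_j ≥ (m_j+1)(q+1)` and `p ∤ C(r_j,m_j)` for all `j`, there is a `G`-equivariant isomorphism
`(⊗_j V_{r_j}^{Fr^j}) / ⟨θ_0^{m_0+1},…,θ_{f−1}^{m_{f−1}+1}⟩ ≅
 ind_{B(𝔽_q)}^{G} ⊗_j (V_{m_j}^{Fr^j} ⊗ d^{(r_j−m_j)p^j})`,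
expressed here by a linear map `ψ` inducing it. -/
theorem twisted_principal_series_iso (p f : ℕ) [Fact p.Prime] [NeZero f]
    (r m : Fin f → ℕ) (hm : ∀ j, m j ≤ p - 1)
    (hr1 : ∀ j : Fin f, p ^ (f - (j : ℕ)) ≤ r j)
    (hr2 : ∀ j, (m j + 1) * (p ^ f + 1) ≤ r j)
    (hchoose : ∀ j, ¬ p ∣ Nat.choose (r j) (m j)) :
    ∃ ψ : MvPolynomial (Fin f × Fin 2) (GaloisField p f) →ₗ[GaloisField p f]
        (Matrix.GeneralLinearGroup (Fin 2) (GaloisField p f) →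
          MvPolynomial (Fin f × Fin 2) (GaloisField p f)),
      -- the values of `ψ_P` lie in `⊗_j V_{m_j}^{Fr^j}`
      (∀ P, IsMultiHom p f r P → ∀ g, IsMultiHom p f m (ψ P g)) ∧
      -- `ψ_P` lies in `ind_{B(𝔽_q)}^G ⊗_j (V_{m_j}^{Fr^j} ⊗ d^{(r_j−m_j)p^j})`
      (∀ P, IsMultiHom p f r P →
        ∀ b g : Matrix.GeneralLinearGroup (Fin 2) (GaloisField p f), b.val 1 0 = 0 →
          ψ P (b * g) =
            (b.val 1 1) ^ (∑ j : Fin f, (r j - m j) * p ^ (j : ℕ)) •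
              actTw p f b.val (ψ P g)) ∧
      -- `G`-equivariance
      (∀ g : Matrix.GeneralLinearGroup (Fin 2) (GaloisField p f),
        ∀ P, IsMultiHom p f r P →
          ψ (actTw p f g.val P) = fun x => ψ P (x * g)) ∧
      -- the kernel on the multidegree-`r` component is `⟨θ_0^{m_0+1},…,θ_{f−1}^{m_{f−1}+1}⟩`
      (∀ P, IsMultiHom p f r P →
        (ψ P = 0 ↔
          P ∈ Ideal.span (Set.range fun j : Fin f => thetaTw p f j ^ (m j + 1)))) ∧
      -- surjectivity onto the induced representation
      (∀ h : Matrix.GeneralLinearGroup (Fin 2) (GaloisField p f) →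
          MvPolynomial (Fin f × Fin 2) (GaloisField p f),
        (∀ g, IsMultiHom p f m (h g)) →
        (∀ b g : Matrix.GeneralLinearGroup (Fin 2) (GaloisField p f), b.val 1 0 = 0 →
            h (b * g) =
              (b.val 1 1) ^ (∑ j : Fin f, (r j - m j) * p ^ (j : ℕ)) •
                actTw p f b.val (h g)) →
        ∃ P, IsMultiHom p f r P ∧ ψ P = h) := by
  open TwistedPrincipalSeries in
  have hmr : m ≤ r := fun j =>
    (Nat.le_succ _).trans ((Nat.le_mul_of_pos_right _ (Nat.succ_pos _)).trans (hr2 j))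
  have hcov {P : MvPolynomial (Fin f × Fin 2) (GaloisField p f)}
      (hP : IsWeightedHomogeneous (wt f) P r)
      (b g : Matrix.GeneralLinearGroup (Fin 2) (GaloisField p f)) (hb : b.val 1 0 = 0) :
      trunc p m (actHom p f (b * g).val P) =
        (b.val 1 1) ^ (∑ j : Fin f, (r j - m j) * p ^ (j : ℕ)) •
          actHom p f b.val (trunc p m (actHom p f g.val P)) := by
    rw [actHom_val_mul]
    refine trunc_actHom hmr (isWeightedHomogeneous_actHom _ hP) hb fun hd => ?_
    exact det_val_ne_zero b (by rw [Matrix.det_fin_two, hb, hd]; ring)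
  simp only [isMultiHom_iff, actTw_apply]
  refine ⟨LinearMap.pi fun g => trunc p m ∘ₗ (actHom p f g.val).toLinearMap,
    fun P _ g => isWeightedHomogeneous_trunc m _, fun P hP b g hb => hcov hP b g hb,
    fun g P _ => funext fun x => ?_, fun P hP => ⟨fun h => ?_, fun h => funext fun g => ?_⟩,
    fun h hh hB => ?_⟩
  · exact congrArg (trunc p m) (actHom_val_mul x g P).symm
  · refine mem_thetaIdeal_of_truncCoeffs_eq_zero hm hr2 hchoose hP (funext fun x => ?_)
    have := congrFun h (rep p f x.1)
    rw [truncCoeffs_apply, show trunc p m (actHom p f (rep p f x.1).val P) = 0 from this]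
    simp
  · exact trunc_eq_zero_of_mem (actHom_mem_truncIdeal hm _ h)
  · obtain ⟨P, hP, hPo⟩ := exists_trunc_actHom_rep_eq hm hr2 hchoose (fun o => h (rep p f o))
      fun o => hh _
    refine ⟨P, hP, funext fun g => ?_⟩
    obtain ⟨o, ho⟩ := exists_mul_rep_inv g
    have h1 := hcov hP _ (rep p f o) ho
    rw [hPo, ← hB _ _ ho, inv_mul_cancel_right] at h1
    exact h1
end

section
/- Let 0 ≤ m_j ≤ p−1 for 0 ≤ j ≤ f−1, and let r_j, s_j be integers with r_j, s_j ≥ p^{f−j} and r_j, s_j ≥ (m_j+1)(q+1), such that p ∤ C(r_j, m_j) and p ∤ C(s_j, m_j) for all j, and such that Σ_{j=0}^{f−1} r_j p^j ≡ Σ_{j=0}^{f−1} s_j p^j mod (q−1). Then there is a G-equivariant isomorphism (⊗_{j=0}^{f−1} V_{r_j}^{Fr^j}) / ⟨θ_0^{m_0+1}, …, θ_{f−1}^{m_{f−1}+1}⟩ ≅ (⊗_{j=0}^{f−1} V_{s_j}^{Fr^j}) / ⟨θ_0^{m_0+1}, …, θ_{f−1}^{m_{f−1}+1}⟩. -/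
open MvPolynomial

namespace TwistedPeriodicity

/-- The polynomial ring `𝔽_q[X_0,Y_0,…,X_{f−1},Y_{f−1}]`. -/
abbrev TwPoly (p f : ℕ) [Fact p.Prime] : Type := MvPolynomial (Fin f × Fin 2) (GaloisField p f)

/-- The weight recording the multidegree. -/
def multiWt (f : ℕ) (v : Fin f × Fin 2) : Fin f → ℕ := Pi.single v.1 1

theorem weight_multiWt {f : ℕ} (d : Fin f × Fin 2 →₀ ℕ) (j : Fin f) :
    Finsupp.weight (multiWt f) d j = d (j, 0) + d (j, 1) := by
  rw [Finsupp.weight_apply, Finsupp.sum_fintype _ _ (by simp), Fintype.sum_prod_type]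
  simp [multiWt, Finset.sum_apply, Pi.single_apply, Finset.sum_add_distrib]

section Basic

variable {p f : ℕ} [Fact p.Prime]

theorem isMultiHom_iff {r : Fin f → ℕ} {P : TwPoly p f} :
    IsMultiHom p f r P ↔ IsWeightedHomogeneous (multiWt f) P r := by
  simp only [IsMultiHom, IsWeightedHomogeneous, mem_support_iff, funext_iff, weight_multiWt]

theorem isWeightedHomogeneous_var (j : Fin f) (i : Fin 2) :
    IsWeightedHomogeneous (multiWt f) (X (j, i) : TwPoly p f) (Pi.single j 1) :=
  isWeightedHomogeneous_X _ _ (j, i)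

/-- The action of a matrix as an algebra endomorphism. -/
noncomputable def actHom (g : Matrix (Fin 2) (Fin 2) (GaloisField p f)) :
    TwPoly p f →ₐ[GaloisField p f] TwPoly p f :=
  aeval fun v : Fin f × Fin 2 =>
    C (g 0 v.2 ^ p ^ (v.1 : ℕ)) * X (v.1, 0) + C (g 1 v.2 ^ p ^ (v.1 : ℕ)) * X (v.1, 1)

theorem actTw_apply (g : Matrix (Fin 2) (Fin 2) (GaloisField p f)) (P : TwPoly p f) :
    actTw p f g P = actHom g P := rfl

theorem actHom_X (g : Matrix (Fin 2) (Fin 2) (GaloisField p f)) (j : Fin f) (i : Fin 2) :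
    actHom g (X (j, i)) =
      C (g 0 i ^ p ^ (j : ℕ)) * X (j, 0) + C (g 1 i ^ p ^ (j : ℕ)) * X (j, 1) := by
  simp [actHom]

theorem actHom_mul (g h : Matrix (Fin 2) (Fin 2) (GaloisField p f)) (P : TwPoly p f) :
    actHom (g * h) P = actHom g (actHom h P) := by
  suffices actHom (g * h) = (actHom g).comp (actHom h) from DFunLike.congr_fun this P
  refine algHom_ext fun ⟨j, i⟩ => ?_
  have e (l : Fin 2) : (g * h) l i ^ p ^ (j : ℕ) =
      g l 0 ^ p ^ (j : ℕ) * h 0 i ^ p ^ (j : ℕ) + g l 1 ^ p ^ (j : ℕ) * h 1 i ^ p ^ (j : ℕ) := by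
    rw [Matrix.mul_apply, Fin.sum_univ_two, add_pow_char_pow, mul_pow, mul_pow]
  simp only [AlgHom.comp_apply, actHom_X, map_add, map_mul, algHom_C, algebraMap_eq, e]
  ring

theorem actHom_isWeightedHomogeneous (g : Matrix (Fin 2) (Fin 2) (GaloisField p f))
    {r : Fin f → ℕ} {P : TwPoly p f} (hP : IsWeightedHomogeneous (multiWt f) P r) :
    IsWeightedHomogeneous (multiWt f) (actHom g P) r := by
  rw [P.as_sum, map_sum]
  refine IsWeightedHomogeneous.sum _ _ _ fun d hd => ?_
  rw [actHom, aeval_monomial, algebraMap_eq]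
  refine .C_mul ?_ _
  rw [← hP (mem_support_iff.mp hd), Finsupp.weight_apply]
  refine .prod _ _ _ fun v _ => .pow (.add (.C_mul ?_ _) (.C_mul ?_ _)) _ <;>
    exact isWeightedHomogeneous_var _ _

/-- Restriction to the chart `X_j = 1`. -/
noncomputable def dehom : TwPoly p f →ₐ[GaloisField p f] MvPolynomial (Fin f) (GaloisField p f) :=
  aeval fun v => if v.2 = 0 then 1 else X v.1

theorem dehom_X_zero (j : Fin f) : dehom (X (j, 0) : TwPoly p f) = 1 := by simp [dehom]

theorem dehom_X_one (j : Fin f) : dehom (X (j, 1) : TwPoly p f) = X j := by simp [dehom]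

end Basic

section Theta

variable {p f : ℕ} [Fact p.Prime] [NeZero f]

theorem pow_card (a : GaloisField p f) : a ^ p ^ f = a := by
  rw [← GaloisField.card p f (NeZero.ne f)]
  have := Fintype.ofFinite (GaloisField p f)
  rw [Nat.card_eq_fintype_card, FiniteField.pow_card]

theorem pow_pred_pow_char (a : GaloisField p f) (j : Fin f) :
    (a ^ p ^ ((j - 1 : Fin f) : ℕ)) ^ p = a ^ p ^ (j : ℕ) := by
  rw [← pow_mul, ← pow_succ]
  obtain ⟨f, rfl⟩ := Nat.exists_eq_succ_of_ne_zero (NeZero.ne f)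
  induction j using Fin.cases with
  | zero =>
    have : ((0 - 1 : Fin (f + 1)) : ℕ) = f := by simp
    rw [this, pow_card]
    simp
  | succ j =>
    congr 2
    rw [Fin.val_sub_one_of_ne_zero (Fin.succ_ne_zero j), Fin.val_succ, Nat.add_sub_cancel]

theorem actHom_theta (g : Matrix (Fin 2) (Fin 2) (GaloisField p f)) (j : Fin f) :
    actHom g (thetaTw p f j) = C (g.det ^ p ^ (j : ℕ)) * thetaTw p f j := by
  have e (i : Fin 2) : actHom g (X (j - 1, i) ^ p) =
      C (g 0 i ^ p ^ (j : ℕ)) * X (j - 1, 0) ^ p + C (g 1 i ^ p ^ (j : ℕ)) * X (j - 1, 1) ^ p := by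
    rw [map_pow, actHom_X, add_pow_char, mul_pow, mul_pow, ← C_pow, ← C_pow, pow_pred_pow_char,
      pow_pred_pow_char]
  rw [thetaTw, map_sub, map_mul, map_mul, e, e, actHom_X, actHom_X, Matrix.det_fin_two,
    sub_pow_char_pow]
  simp only [map_sub, map_mul, mul_pow]
  ring

theorem theta_isWeightedHomogeneous (j : Fin f) :
    IsWeightedHomogeneous (multiWt f) (thetaTw p f j) (Pi.single j 1 + Pi.single (j - 1) p) := by
  have e : (Pi.single (j - 1) p : Fin f → ℕ) = p • Pi.single (j - 1) 1 := by
    rw [← Pi.single_smul]; simp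
  rw [e]
  exact .sub (.mul (isWeightedHomogeneous_var _ _) (.pow (isWeightedHomogeneous_var _ _) _))
    (.mul (isWeightedHomogeneous_var _ _) (.pow (isWeightedHomogeneous_var _ _) _))

/-- The product of powers `∏ θ_j^{k_j}`. -/
noncomputable def thetaPow (p : ℕ) [Fact p.Prime] (k : Fin f → ℕ) : TwPoly p f :=
  ∏ j, thetaTw p f j ^ k j

/-- The multidegree of `∏ θ_j^{k_j}`. -/
def thetaDeg (p : ℕ) (k : Fin f → ℕ) (j : Fin f) : ℕ := k j + p * k (j + 1)

theorem thetaPow_isWeightedHomogeneous (k : Fin f → ℕ) :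
    IsWeightedHomogeneous (multiWt f) (thetaPow p k) (thetaDeg p k) := by
  have e : thetaDeg p k = ∑ j, k j • (Pi.single j 1 + Pi.single (j - 1) p : Fin f → ℕ) := by
    funext i
    have h (j : Fin f) : i = j - 1 ↔ j = i + 1 := by rw [eq_sub_iff_add_eq, eq_comm]
    simp [thetaDeg, Finset.sum_apply, Pi.single_apply, Finset.sum_add_distrib, h,
      mul_comm]
  rw [e]
  exact .prod _ _ _ fun j _ => .pow (theta_isWeightedHomogeneous j) _

theorem thetaPow_single (j : Fin f) (n : ℕ) : thetaPow p (Pi.single j n) = thetaTw p f j ^ n := by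
  rw [thetaPow, Finset.prod_eq_single j] <;> simp +contextual

theorem thetaPow_add (k l : Fin f → ℕ) : thetaPow p (k + l) = thetaPow p k * thetaPow p l := by
  simp [thetaPow, pow_add, Finset.prod_mul_distrib]

/-- The scalar by which `g` acts on `∏ θ_j^{k_j}`. -/
noncomputable def detPow (g : Matrix (Fin 2) (Fin 2) (GaloisField p f)) (k : Fin f → ℕ) :
    GaloisField p f :=
  ∏ j : Fin f, (g.det ^ p ^ (j : ℕ)) ^ k j

omit [NeZero f] in
theorem detPow_ne_zero {g : Matrix (Fin 2) (Fin 2) (GaloisField p f)} (hg : g.det ≠ 0)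
    (k : Fin f → ℕ) : detPow g k ≠ 0 :=
  Finset.prod_ne_zero_iff.mpr fun _ _ => pow_ne_zero _ (pow_ne_zero _ hg)

theorem actHom_thetaPow (g : Matrix (Fin 2) (Fin 2) (GaloisField p f)) (k : Fin f → ℕ) :
    actHom g (thetaPow p k) = C (detPow g k) * thetaPow p k := by
  simp only [thetaPow, detPow, map_prod, map_pow, actHom_theta, mul_pow, Finset.prod_mul_distrib]

/-- On exponents below `p`, the dehomogenised `θ_j` acts like `-y_j`. -/
theorem coeff_dehom_thetaPow_mul (k : Fin f → ℕ) (A : TwPoly p f) (l : Fin f →₀ ℕ)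
    (hl : ∀ j, l j < p) :
    coeff l (dehom (thetaPow p k * A)) =
      if Finsupp.equivFunOnFinite.symm k ≤ l then
        (-1) ^ (∑ j, k j) * coeff (l - Finsupp.equivFunOnFinite.symm k) (dehom A) else 0 := by
  let I : Ideal (MvPolynomial (Fin f) (GaloisField p f)) :=
    Ideal.span ((fun s => monomial s 1) '' Set.range fun j : Fin f => Finsupp.single j p)
  have hI (u : MvPolynomial (Fin f) (GaloisField p f)) (hu : u ∈ I) : coeff l u = 0 := by
    by_contra h
    obtain ⟨_, ⟨j, rfl⟩, hj⟩ := mem_ideal_span_monomial_image.mp hu l (mem_support_iff.mpr h)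
    have := hj j
    rw [Finsupp.single_eq_same] at this
    exact (hl j).not_ge this
  have hX (j : Fin f) : (X j ^ p : MvPolynomial (Fin f) (GaloisField p f)) ∈ I := by
    rw [X_pow_eq_monomial]
    exact Ideal.subset_span ⟨_, ⟨j, rfl⟩, rfl⟩
  have hθ (j : Fin f) : Ideal.Quotient.mk I (dehom (thetaTw p f j)) =
      Ideal.Quotient.mk I (-X j) := by
    rw [Ideal.Quotient.mk_eq_mk_iff_sub_mem]
    simpa [thetaTw, dehom_X_zero, dehom_X_one] using hX (j - 1)
  have hm : Ideal.Quotient.mk I (dehom (thetaPow p k * A)) =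
      Ideal.Quotient.mk I
        (monomial (Finsupp.equivFunOnFinite.symm k) ((-1) ^ (∑ j, k j)) * dehom A) := by
    rw [map_mul, map_mul, map_mul]
    congr 1
    have : (monomial (Finsupp.equivFunOnFinite.symm k) ((-1) ^ (∑ j, k j)) :
        MvPolynomial (Fin f) (GaloisField p f)) = ∏ j, (-X j) ^ k j := by
      rw [monomial_eq, Finsupp.prod_fintype _ _ (by simp)]
      simp only [Finsupp.equivFunOnFinite_symm_apply_apply,
        neg_pow (X _ : MvPolynomial (Fin f) (GaloisField p f)), Finset.prod_mul_distrib,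
        Finset.prod_pow_eq_pow_sum, map_pow, map_neg, map_one]
    rw [this]
    simp only [thetaPow, map_prod, map_pow, hθ]
  have := hI _ ((Ideal.Quotient.mk_eq_mk_iff_sub_mem _ _).mp hm)
  rw [coeff_sub, sub_eq_zero] at this
  rw [this, coeff_monomial_mul']

end Theta

section NormalForm

variable {p f : ℕ} [Fact p.Prime] [NeZero f]

/-- The exponent of `∏ X_j^{n_j−i_j} Y_j^{i_j}`. -/
noncomputable def monoExp (n i : Fin f → ℕ) : Fin f × Fin 2 →₀ ℕ :=
  Finsupp.equivFunOnFinite.symm fun v => if v.2 = 0 then n v.1 - i v.1 else i v.1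

omit [NeZero f] in
theorem monoExp_zero (n i : Fin f → ℕ) (j : Fin f) : monoExp n i (j, 0) = n j - i j := by
  simp [monoExp]

omit [NeZero f] in
theorem monoExp_one (n i : Fin f → ℕ) (j : Fin f) : monoExp n i (j, 1) = i j := by
  simp [monoExp]

omit [NeZero f] in
theorem weight_monoExp {n i : Fin f → ℕ} (h : i ≤ n) :
    Finsupp.weight (multiWt f) (monoExp n i) = n := by
  funext j
  rw [weight_multiWt, monoExp_zero, monoExp_one, Nat.sub_add_cancel (h j)]

omit [NeZero f] in
theorem eq_monoExp {n i : Fin f → ℕ} {d : Fin f × Fin 2 →₀ ℕ}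
    (hd : Finsupp.weight (multiWt f) d = n) (hi : ∀ j, d (j, 1) = i j) : d = monoExp n i := by
  subst hd
  ext ⟨j, l⟩
  fin_cases l
  · simp [monoExp_zero, weight_multiWt, hi]
  · simp [monoExp_one, hi]

/-- The `Y`-exponents of the normal form monomials of multidegree `n` modulo the `θ_j`. -/
def yExp (n : Fin f → ℕ) : Option (Fin f → Fin p) → Fin f → ℕ
  | none => n
  | some i => fun j => i j

omit [Fact p.Prime] [NeZero f] in
theorem yExp_le {n : Fin f → ℕ} (hn : ∀ j, p ≤ n j) (o : Option (Fin f → Fin p)) :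
    yExp n o ≤ n := by
  cases o with
  | none => exact le_rfl
  | some i => exact fun j => (i j).is_lt.le.trans (hn j)

/-- Indices of the jet coordinates up to order `m_j` in the variable `y_j`. -/
abbrev JetIdx (m : Fin f → ℕ) : Type := ∀ j, Fin (m j + 1)

/-- The underlying exponents of a jet index. -/
def JetIdx.toNat {m : Fin f → ℕ} (k : JetIdx m) (j : Fin f) : ℕ := k j

omit [NeZero f] in
theorem JetIdx.toNat_le {m : Fin f → ℕ} (k : JetIdx m) (j : Fin f) : k.toNat j ≤ m j :=
  Nat.le_of_lt_succ (k j).is_lt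

/-- The exponent vector of a jet index. -/
noncomputable def JetIdx.toFinsupp {m : Fin f → ℕ} (k : JetIdx m) : Fin f →₀ ℕ :=
  Finsupp.equivFunOnFinite.symm k.toNat

/-- Combinations of the products `∏ θ_j^{k_j} · (normal form monomial)` of multidegree `r`. -/
noncomputable def normalForm (p : ℕ) [Fact p.Prime] (r m : Fin f → ℕ) :
    (JetIdx m × Option (Fin f → Fin p) → GaloisField p f) →ₗ[GaloisField p f] TwPoly p f :=
  Fintype.linearCombination (GaloisField p f) fun x =>
    thetaPow p x.1.toNat * monomial (monoExp (r - thetaDeg p x.1.toNat)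
      (yExp (r - thetaDeg p x.1.toNat) x.2)) 1

/-- The ideal generated by the `θ_j^{m_j+1}`. -/
noncomputable abbrev thetaIdeal (p : ℕ) [Fact p.Prime] (m : Fin f → ℕ) : Ideal (TwPoly p f) :=
  Ideal.span (Set.range fun j : Fin f => thetaTw p f j ^ (m j + 1))

omit [Fact p.Prime] in
theorem thetaDeg_add_le {r m k : Fin f → ℕ} (hr : ∀ j, thetaDeg p m j + p ≤ r j)
    (hk : ∀ j, k j ≤ m j) (j : Fin f) : thetaDeg p k j + p ≤ r j := by
  refine le_trans ?_ (hr j)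
  unfold thetaDeg
  gcongr <;> exact hk _

theorem normalForm_isWeightedHomogeneous {r m : Fin f → ℕ}
    (hr : ∀ j, thetaDeg p m j + p ≤ r j)
    (e : JetIdx m × Option (Fin f → Fin p) → GaloisField p f) :
    IsWeightedHomogeneous (multiWt f) (normalForm p r m e) r := by
  rw [normalForm, Fintype.linearCombination_apply]
  refine .sum _ _ _ fun x _ => ?_
  have h (j : Fin f) := thetaDeg_add_le hr x.1.toNat_le j
  rw [smul_eq_C_mul]
  refine .C_mul ?_ _
  have e : r = thetaDeg p x.1.toNat + (r - thetaDeg p x.1.toNat) := by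
    funext j
    have := h j
    simp only [Pi.add_apply, Pi.sub_apply]
    omega
  nth_rw 3 [e]
  refine .mul (thetaPow_isWeightedHomogeneous _) (isWeightedHomogeneous_monomial _ _ _ ?_)
  refine weight_monoExp (yExp_le (fun j => ?_) x.2)
  have := h j
  simp only [Pi.sub_apply]
  omega

theorem forall_of_forall_add_one {S : Fin f → Prop} (h : ∀ j, S j → S (j + 1)) {j : Fin f}
    (hj : S j) (i : Fin f) : S i := by
  obtain ⟨f, rfl⟩ := Nat.exists_eq_succ_of_ne_zero (NeZero.ne f)
  have hn (n : ℕ) : S (j + Fin.ofNat (f + 1) n) := by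
    induction n with
    | zero => simpa using hj
    | succ n ih =>
      have e : Fin.ofNat (f + 1) (n + 1) = Fin.ofNat (f + 1) n + 1 := by
        ext; simp [Fin.val_add]
      rw [e, ← add_assoc]
      exact h _ ih
  have := hn (i - j : Fin (f + 1)).val
  rwa [Fin.ofNat_val_eq_self, add_sub_cancel] at this

omit [Fact p.Prime] in
/-- A monomial divisible by no leading term `X_j Y_{j−1}^p` is in normal form. -/
theorem exists_yExp_of_reduced {n : Fin f → ℕ} (hn : ∀ j, p ≤ n j) {d : Fin f × Fin 2 →₀ ℕ}
    (hd : Finsupp.weight (multiWt f) d = n)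
    (hred : ∀ j : Fin f, 1 ≤ d (j, 0) → d (j - 1, 1) < p) :
    ∃ o : Option (Fin f → Fin p), d = monoExp n (yExp n o) := by
  have hw (j : Fin f) : d (j, 0) + d (j, 1) = n j := by rw [← hd, weight_multiWt]
  by_cases h : ∀ j, d (j, 1) < p
  · exact ⟨some fun j => ⟨d (j, 1), h j⟩, eq_monoExp hd fun j => rfl⟩
  · push Not at h
    obtain ⟨j, hj⟩ := h
    have step (i : Fin f) (hi : p ≤ d (i, 1)) : d (i + 1, 0) = 0 := by
      by_contra h0
      have := hred (i + 1) (Nat.one_le_iff_ne_zero.mpr h0)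
      rw [add_sub_cancel_right] at this
      omega
    have all := forall_of_forall_add_one (S := fun i => p ≤ d (i, 1)) (fun i hi => by
      have := step i hi
      have := hw (i + 1)
      have := hn (i + 1)
      omega) hj
    refine ⟨none, eq_monoExp hd fun i => ?_⟩
    have := step (i - 1) (all _)
    rw [sub_add_cancel] at this
    have := hw i
    simp only [yExp]
    omega

theorem thetaPow_mem_thetaIdeal {m k : Fin f → ℕ} {j : Fin f} (h : m j < k j) :
    thetaPow p k ∈ thetaIdeal p m := by
  refine Ideal.mem_of_dvd _ ?_ (Ideal.subset_span ⟨j, rfl⟩)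
  exact (pow_dvd_pow _ h).trans (Finset.dvd_prod_of_mem _ (Finset.mem_univ j))

theorem thetaPow_mul_monomial_mem {r m : Fin f → ℕ} (hr : ∀ j, thetaDeg p m j + p ≤ r j)
    (k : Fin f → ℕ) (d : Fin f × Fin 2 →₀ ℕ)
    (hd : thetaDeg p k + Finsupp.weight (multiWt f) d = r) :
    thetaPow p k * monomial d 1 ∈
      LinearMap.range (normalForm p r m) ⊔
        (thetaIdeal p m).restrictScalars (GaloisField p f) := by
  induction hN : Finsupp.weight (fun v : Fin f × Fin 2 => 1 + (v.2 : ℕ)) d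
    using Nat.strong_induction_on generalizing k d with
  | _ N ih =>
  by_cases hk : ∀ j, k j ≤ m j
  swap
  · push Not at hk
    obtain ⟨j, hj⟩ := hk
    exact Submodule.mem_sup_right (Ideal.mul_mem_right _ _ (thetaPow_mem_thetaIdeal hj))
  have hd' : Finsupp.weight (multiWt f) d = r - thetaDeg p k := by rw [← hd, add_tsub_cancel_left]
  by_cases hred : ∀ j : Fin f, 1 ≤ d (j, 0) → d (j - 1, 1) < p
  · obtain ⟨o, ho⟩ := exists_yExp_of_reduced (fun j => by
      have := thetaDeg_add_le hr hk j
      simp only [Pi.sub_apply]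
      omega) hd' hred
    refine Submodule.mem_sup_left ⟨Pi.single (fun j => ⟨k j, Nat.lt_succ_of_le (hk j)⟩, o) 1, ?_⟩
    rw [normalForm, Fintype.linearCombination_apply_single, one_smul, ho]
    rfl
  · push Not at hred
    obtain ⟨j, hj0, hj1⟩ := hred
    obtain ⟨d, rfl⟩ : ∃ d', d = d' + Finsupp.single (j, 0) 1 + Finsupp.single (j - 1, 1) p := by
      refine ⟨d - Finsupp.single (j, 0) 1 - Finsupp.single (j - 1, 1) p, ?_⟩
      ext v
      simp only [Finsupp.add_apply, Finsupp.tsub_apply, Finsupp.single_apply]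
      by_cases h0 : (j, (0 : Fin 2)) = v
      · subst h0
        simp
        omega
      · by_cases h1 : (j - 1, (1 : Fin 2)) = v
        · subst h1
          simp [h0]
          omega
        · simp [h0, h1]
    have hp := (Fact.out : p.Prime).two_le
    have key : thetaPow p k *
          monomial (d + Finsupp.single (j, 0) 1 + Finsupp.single (j - 1, 1) p) 1 =
        thetaPow p (k + Pi.single j 1) * monomial d 1 +
          thetaPow p k *
            monomial (d + Finsupp.single (j, 1) 1 + Finsupp.single (j - 1, 0) p) 1 := by
      have e (u v : Fin f × Fin 2) :
          (monomial (d + Finsupp.single u 1 + Finsupp.single v p) 1 : TwPoly p f) =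
            monomial d 1 * X u * X v ^ p := by
        rw [X_pow_eq_monomial, X, monomial_mul, monomial_mul]
        simp
      rw [e, e, thetaPow_add, thetaPow_single, pow_one, thetaTw]
      ring
    rw [key]
    simp only [map_add, Finsupp.weight_single] at hN
    refine Submodule.add_mem _ (ih _ ?_ _ _ ?_ rfl) (ih _ ?_ _ _ ?_ rfl)
    · simp at hN
      omega
    · have e : thetaDeg p (k + Pi.single j 1) =
          thetaDeg p k + (Pi.single j 1 + Pi.single (j - 1) p) := by
        funext i
        simp only [thetaDeg, Pi.add_apply, Pi.single_apply, eq_sub_iff_add_eq]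
        split_ifs <;> ring
      rw [e, ← hd]
      funext i
      simp [Finsupp.weight_single, multiWt, Pi.single_apply]
      ring
    · simp [Finsupp.weight_single] at hN ⊢
      omega
    · rw [← hd]
      simp [Finsupp.weight_single, multiWt]

/-- The normal forms span the multidegree-`r` component modulo the ideal. -/
theorem exists_normalForm {r m : Fin f → ℕ} (hr : ∀ j, thetaDeg p m j + p ≤ r j)
    {P : TwPoly p f} (hP : IsWeightedHomogeneous (multiWt f) P r) :
    ∃ e, P - normalForm p r m e ∈ thetaIdeal p m := by
  have : P ∈ LinearMap.range (normalForm p r m) ⊔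
      (thetaIdeal p m).restrictScalars (GaloisField p f) := by
    rw [P.as_sum]
    refine Submodule.sum_mem _ fun d hd => ?_
    have h := thetaPow_mul_monomial_mem hr 0 d (by
      rw [hP (mem_support_iff.mp hd)]
      funext j
      simp [thetaDeg])
    have e : monomial d (coeff d P) = coeff d P • (thetaPow p 0 * monomial d 1 : TwPoly p f) := by
      simp [thetaPow, smul_monomial]
    rw [e]
    exact Submodule.smul_mem _ _ h
  obtain ⟨_, ⟨e, rfl⟩, Q, hQ, rfl⟩ := Submodule.mem_sup.mp this
  exact ⟨e, by simpa using hQ⟩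

end NormalForm

section Jets

variable {p f : ℕ} [Fact p.Prime] [NeZero f]

/-- Representatives of the cosets of the stabiliser of a point, indexed by `ℙ¹(𝔽_q)`. -/
def pointRep {K : Type*} [Field K] : Option K → Matrix (Fin 2) (Fin 2) K
  | some t => !![1, t; 0, 1]
  | none => !![0, 1; 1, 0]

theorem det_pointRep_ne_zero {K : Type*} [Field K] (t : Option K) : (pointRep t).det ≠ 0 := by
  cases t <;> simp [pointRep, Matrix.det_fin_two]

/-- The jets of `P` at all points of `ℙ¹(𝔽_q)`. -/
noncomputable def jets (p : ℕ) [Fact p.Prime] (m : Fin f → ℕ) :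
    TwPoly p f →ₗ[GaloisField p f] (JetIdx m × Option (GaloisField p f) → GaloisField p f) :=
  LinearMap.pi fun x =>
    (lcoeff (GaloisField p f) x.1.toFinsupp).comp
      (dehom.toLinearMap.comp (actHom (pointRep x.2)).toLinearMap)

omit [NeZero f] in
theorem jets_apply (m : Fin f → ℕ) (P : TwPoly p f)
    (x : JetIdx m × Option (GaloisField p f)) :
    jets p m P x = coeff x.1.toFinsupp (dehom (actHom (pointRep x.2) P)) := rfl

theorem coeff_jet_thetaPow_mul {m : Fin f → ℕ} (hm : ∀ j, m j < p) (k : Fin f → ℕ)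
    (g : Matrix (Fin 2) (Fin 2) (GaloisField p f)) (A : TwPoly p f) (l : JetIdx m) :
    coeff l.toFinsupp (dehom (actHom g (thetaPow p k * A))) =
      if Finsupp.equivFunOnFinite.symm k ≤ l.toFinsupp then detPow g k * (-1) ^ (∑ j, k j) *
        coeff (l.toFinsupp - Finsupp.equivFunOnFinite.symm k) (dehom (actHom g A)) else 0 := by
  rw [map_mul, actHom_thetaPow, mul_assoc, map_mul, ← algebraMap_eq, AlgHom.commutes,
    algebraMap_eq, coeff_C_mul, coeff_dehom_thetaPow_mul _ _ _ fun j =>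
      (l.toNat_le j).trans_lt (hm j)]
  rw [mul_ite, mul_zero, mul_assoc]

theorem jets_eq_zero_of_mem {m : Fin f → ℕ} (hm : ∀ j, m j < p) {P : TwPoly p f}
    (hP : P ∈ thetaIdeal p m) : jets p m P = 0 := by
  obtain ⟨c, rfl⟩ := Ideal.mem_span_range_iff_exists_fun.mp hP
  rw [map_sum]
  refine Finset.sum_eq_zero fun j _ => ?_
  funext x
  rw [jets_apply, mul_comm, ← thetaPow_single, coeff_jet_thetaPow_mul hm, if_neg]
  · rfl
  · intro h
    have := (h j).trans (x.1.toNat_le j)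
    rw [Finsupp.equivFunOnFinite_symm_apply_apply, Pi.single_eq_same] at this
    omega

omit [NeZero f] in
theorem coeff_zero_dehom_actHom_monomial (g : Matrix (Fin 2) (Fin 2) (GaloisField p f))
    (d : Fin f × Fin 2 →₀ ℕ) :
    coeff 0 (dehom (actHom g (monomial d 1))) =
      ∏ j : Fin f, (g 0 0 ^ p ^ (j : ℕ)) ^ d (j, 0) * (g 0 1 ^ p ^ (j : ℕ)) ^ d (j, 1) := by
  rw [monomial_eq, C_1, one_mul, Finsupp.prod_fintype _ _ (by simp), Fintype.prod_prod_type,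
    ← constantCoeff_eq]
  simp only [map_prod, Fin.prod_univ_two, map_mul, map_pow, actHom_X, map_add, dehom_X_zero,
    dehom_X_one, mul_one, constantCoeff_X, mul_zero, add_zero]
  simp [← algebraMap_eq]

/-- A combination of normal form monomials vanishing at all points of `ℙ¹(𝔽_q)` is trivial. -/
theorem eq_zero_of_forall_point {n : Fin f → ℕ} (hn : ∀ j, p ≤ n j)
    {e : Option (Fin f → Fin p) → GaloisField p f}
    (he : ∀ t : Option (GaloisField p f),
      ∑ o, e o * coeff 0 (dehom (actHom (pointRep t)
        (monomial (monoExp n (yExp n o)) 1 : TwPoly p f))) = 0) :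
    e = 0 := by
  have hp : p ≠ 0 := (Fact.out : p.Prime).ne_zero
  simp only [coeff_zero_dehom_actHom_monomial, monoExp_zero, monoExp_one] at he
  have h0 : e none = 0 := by
    have := he none
    rw [Fintype.sum_option, Finset.sum_eq_zero] at this
    · simpa [pointRep, yExp] using this
    · intro i _
      rw [Finset.prod_eq_zero (Finset.mem_univ (0 : Fin f)), mul_zero]
      have := (i 0).is_lt.trans_le (hn 0)
      simp [pointRep, yExp, Nat.sub_ne_zero_of_lt this]
  let E : Fin (p ^ f) ≃ GaloisField p f :=
    (Finite.equivFinOfCardEq (GaloisField.card p f (NeZero.ne f))).symm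
  have hv : (fun i => e (some (finFunctionFinEquiv.symm i))) = 0 := by
    refine Matrix.eq_zero_of_forall_index_sum_mul_pow_eq_zero E.injective fun j => ?_
    rw [← he (some (E j)), Fintype.sum_option, h0, zero_mul, zero_add,
      ← finFunctionFinEquiv.sum_comp]
    refine Finset.sum_congr rfl fun i _ => ?_
    rw [Equiv.symm_apply_apply, finFunctionFinEquiv_apply]
    simp only [pointRep, yExp, Matrix.of_apply, Matrix.cons_val', Matrix.cons_val_zero,
      Matrix.cons_val_one, one_pow, one_mul]
    simp only [← pow_mul, Finset.prod_pow_eq_pow_sum, mul_comm]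
  funext o
  cases o with
  | none => exact h0
  | some i =>
    have := congrFun hv (finFunctionFinEquiv i)
    simpa using this

theorem jets_normalForm_injective {r m : Fin f → ℕ} (hm : ∀ j, m j < p)
    (hr : ∀ j, thetaDeg p m j + p ≤ r j) :
    Function.Injective ((jets p m).comp (normalForm p r m)) := by
  refine (injective_iff_map_eq_zero _).mpr fun e he => ?_
  suffices ∀ k : JetIdx m, (fun o => e (k, o)) = 0 from funext fun x => congrFun (this x.1) x.2
  intro k
  induction k using WellFoundedLT.induction with
  | _ k ih =>
  refine eq_zero_of_forall_point (n := r - thetaDeg p k.toNat) (fun j => ?_) fun t => ?_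
  · have := thetaDeg_add_le hr k.toNat_le j
    simp only [Pi.sub_apply]
    omega
  have h := congrFun he (k, t)
  rw [LinearMap.comp_apply, normalForm, Fintype.linearCombination_apply, map_sum,
    Finset.sum_apply, Fintype.sum_prod_type, Finset.sum_eq_single k] at h
  · simp only [map_smul, jets_apply, coeff_smul, coeff_jet_thetaPow_mul hm,
      show Finsupp.equivFunOnFinite.symm k.toNat = k.toFinsupp from rfl, le_refl, if_true,
      smul_eq_mul, tsub_self, mul_left_comm (e _), ← Finset.mul_sum, Pi.zero_apply] at h
    exact (mul_eq_zero.mp h).resolve_left (mul_ne_zero (detPow_ne_zero (det_pointRep_ne_zero t) _)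
      (pow_ne_zero _ (neg_ne_zero.mpr one_ne_zero)))
  · intro l _ hl
    refine Finset.sum_eq_zero fun o _ => ?_
    rw [map_smul, Pi.smul_apply, jets_apply, coeff_jet_thetaPow_mul hm]
    split_ifs with hlk
    · rw [show e (l, o) = 0 from congrFun (ih l (lt_of_le_of_ne hlk hl)) o, zero_smul]
    · exact smul_zero _
  · simp

/-- The normal forms are determined by their jets, and all jets occur. -/
noncomputable def jetsEquiv {r m : Fin f → ℕ} (hm : ∀ j, m j < p)
    (hr : ∀ j, thetaDeg p m j + p ≤ r j) :
    (JetIdx m × Option (Fin f → Fin p) → GaloisField p f) ≃ₗ[GaloisField p f]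
      (JetIdx m × Option (GaloisField p f) → GaloisField p f) :=
  have := Fintype.ofFinite (GaloisField p f)
  LinearEquiv.ofBijective ((jets p m).comp (normalForm p r m))
    ⟨jets_normalForm_injective hm hr,
      (LinearMap.injective_iff_surjective_of_finrank_eq_finrank (by
        have hc : Fintype.card (GaloisField p f) = p ^ f := by
          rw [← Nat.card_eq_fintype_card, GaloisField.card p f (NeZero.ne f)]
        rw [Module.finrank_fintype_fun_eq_card, Module.finrank_fintype_fun_eq_card]
        simp [hc])).mp (jets_normalForm_injective hm hr)⟩

theorem jetsEquiv_apply {r m : Fin f → ℕ} (hm : ∀ j, m j < p)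
    (hr : ∀ j, thetaDeg p m j + p ≤ r j)
    (e : JetIdx m × Option (Fin f → Fin p) → GaloisField p f) :
    jetsEquiv hm hr e = jets p m (normalForm p r m e) := rfl

/-- In large multidegree, the ideal consists of the polynomials with vanishing jets. -/
theorem mem_thetaIdeal_iff {r m : Fin f → ℕ} (hm : ∀ j, m j < p)
    (hr : ∀ j, thetaDeg p m j + p ≤ r j) {P : TwPoly p f}
    (hP : IsWeightedHomogeneous (multiWt f) P r) : P ∈ thetaIdeal p m ↔ jets p m P = 0 := by
  refine ⟨jets_eq_zero_of_mem hm, fun h => ?_⟩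
  obtain ⟨e, he⟩ := exists_normalForm hr hP
  have h0 := jets_eq_zero_of_mem hm he
  rw [map_sub, h, zero_sub, neg_eq_zero, ← jetsEquiv_apply hm hr,
    LinearEquiv.map_eq_zero_iff] at h0
  simpa [h0] using he

end Jets

section Stabiliser

variable {p f : ℕ} [Fact p.Prime]

theorem coeff_prod_aeval_X {K ι : Type*} [Field K] [Fintype ι] (F : ι → Polynomial K)
    (l : ι →₀ ℕ) :
    coeff l (∏ j, Polynomial.aeval (X j : MvPolynomial ι K) (F j)) =
      ∏ j, (F j).coeff (l j) := by
  classical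
  simp only [fun j => Polynomial.aeval_eq_sum_range' (Nat.lt_succ_self _) (p := F j)
    (X j : MvPolynomial ι K), Finset.prod_univ_sum, coeff_sum]
  have e (k : ι → ℕ) : coeff l (∏ j, (F j).coeff (k j) • (X j : MvPolynomial ι K) ^ k j) =
      if k = l then ∏ j, (F j).coeff (k j) else 0 := by
    have : (∏ j, (F j).coeff (k j) • (X j : MvPolynomial ι K) ^ k j) =
        monomial (Finsupp.equivFunOnFinite.symm k) (∏ j, (F j).coeff (k j)) := by
      rw [monomial_eq, Finsupp.prod_fintype _ _ (by simp), map_prod, ← Finset.prod_mul_distrib]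
      simp [smul_eq_C_mul]
    rw [this, coeff_monomial]
    congr 1
    rw [Equiv.symm_apply_eq]
    rfl
  simp only [e]
  rw [Finset.sum_ite_eq']
  split_ifs with h
  · rfl
  · simp only [Fintype.mem_piFinset, Finset.mem_range, not_forall, not_lt] at h
    obtain ⟨j, hj⟩ := h
    exact (Finset.prod_eq_zero (Finset.mem_univ j)
      (Polynomial.coeff_eq_zero_of_natDegree_lt hj)).symm

theorem coeff_linear_pow_mul {K : Type*} [Field K] (a c d : K) (n i l : ℕ) :
    ((Polynomial.C a + Polynomial.C c * Polynomial.X) ^ n *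
      (Polynomial.C d * Polynomial.X) ^ i).coeff l =
      if i ≤ l then (n.choose (l - i) : K) * a ^ (n - (l - i)) * (c ^ (l - i) * d ^ i) else 0 := by
  have e : (Polynomial.C a + Polynomial.C c * Polynomial.X) ^ n =
      ((Polynomial.X + Polynomial.C a) ^ n).comp (Polynomial.C c * Polynomial.X) := by
    simp [add_comm]
  rw [mul_pow, ← Polynomial.C_pow, mul_left_comm, Polynomial.coeff_C_mul,
    Polynomial.coeff_mul_X_pow', e, Polynomial.comp_C_mul_X_coeff, Polynomial.coeff_X_add_C_pow]
  split_ifs <;> ring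

theorem dehom_monomial (d : Fin f × Fin 2 →₀ ℕ) (c : GaloisField p f) :
    dehom (monomial d c) = monomial (Finsupp.equivFunOnFinite.symm fun j => d (j, 1)) c := by
  rw [monomial_eq, monomial_eq, Finsupp.prod_fintype _ _ (by simp),
    Finsupp.prod_fintype _ _ (by simp), Fintype.prod_prod_type]
  simp [dehom_X_zero, dehom_X_one, map_prod, ← algebraMap_eq]

/-- Matrix coefficients of the stabiliser of `y = 0` acting on jets in multidegree `r`. -/
theorem coeff_dehom_actHom {b : Matrix (Fin 2) (Fin 2) (GaloisField p f)} (hb : b 0 1 = 0)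
    {r : Fin f → ℕ} {P : TwPoly p f} (hP : IsWeightedHomogeneous (multiWt f) P r)
    (l : Fin f →₀ ℕ) :
    coeff l (dehom (actHom b P)) = ∑ i ∈ Finset.Iic l, coeff i (dehom P) *
      ∏ j : Fin f, ((r j - i j).choose (l j - i j) : GaloisField p f) *
        (b 0 0 ^ p ^ (j : ℕ)) ^ (r j - l j) *
        ((b 1 0 ^ p ^ (j : ℕ)) ^ (l j - i j) * (b 1 1 ^ p ^ (j : ℕ)) ^ i j) := by
  classical
  induction hP using IsWeightedHomogeneous.induction_on with
  | zero => simp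
  | add P Q _ _ hP hQ => simp [hP, hQ, add_mul, Finset.sum_add_distrib]
  | monomial d c hd =>
    have hp : p ≠ 0 := (Fact.out : p.Prime).ne_zero
    have e : dehom (actHom b (monomial d c)) = C c * ∏ j : Fin f,
        Polynomial.aeval (X j : MvPolynomial (Fin f) (GaloisField p f))
          ((Polynomial.C (b 0 0 ^ p ^ (j : ℕ)) +
            Polynomial.C (b 1 0 ^ p ^ (j : ℕ)) * Polynomial.X) ^ (r j - d (j, 1)) *
          (Polynomial.C (b 1 1 ^ p ^ (j : ℕ)) * Polynomial.X) ^ d (j, 1)) := by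
      rw [monomial_eq, Finsupp.prod_fintype _ _ (by simp), Fintype.prod_prod_type, map_mul,
        map_mul, ← algebraMap_eq, AlgHom.commutes, AlgHom.commutes, algebraMap_eq, map_prod,
        map_prod]
      congr 1
      refine Finset.prod_congr rfl fun j _ => ?_
      have : r j - d (j, 1) = d (j, 0) := by rw [← hd, weight_multiWt, Nat.add_sub_cancel]
      rw [this, Fin.prod_univ_two]
      simp only [map_mul, map_pow, map_add, actHom_X, hb, dehom_X_zero, dehom_X_one,
        Polynomial.aeval_C, Polynomial.aeval_X]
      simp [hp, algebraMap_eq]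
    rw [e, coeff_C_mul, coeff_prod_aeval_X, dehom_monomial]
    simp only [coeff_monomial, coeff_linear_pow_mul, ite_mul, zero_mul]
    rw [Finset.sum_ite_eq]
    split_ifs with h
    · rw [Finset.mem_Iic] at h
      congr 1
      refine Finset.prod_congr rfl fun j _ => ?_
      have hj : d (j, 1) ≤ l j := h j
      rw [if_pos hj, Finsupp.equivFunOnFinite_symm_apply_apply]
      congr 3
      omega
    · rw [Finset.mem_Iic, Finsupp.le_def] at h
      push Not at h
      obtain ⟨j, hj⟩ := h
      rw [Finset.prod_eq_zero (Finset.mem_univ j), mul_zero]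
      exact if_neg hj.not_ge

/-- The product of binomial coefficients `∏ C(n_j, i_j)` in `𝔽_q`. -/
noncomputable def binom (p : ℕ) [Fact p.Prime] (n i : Fin f → ℕ) : GaloisField p f :=
  ∏ j, ((n j).choose (i j) : GaloisField p f)

theorem binom_ne_zero {n m i : Fin f → ℕ} (hm : ∀ j, m j < p) (hn : ∀ j, ¬ p ∣ (n j).choose (m j))
    (hi : ∀ j, i j ≤ m j) : binom p n i ≠ 0 := by
  have hp : p.Prime := Fact.out
  refine Finset.prod_ne_zero_iff.mpr fun j _ => ?_
  rw [Ne, CharP.cast_eq_zero_iff (GaloisField p f) p]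
  intro h
  have h2 : p ∣ (n j).choose (m j) * (m j).choose (i j) := by
    rw [Nat.choose_mul (hi j)]
    exact h.mul_right _
  refine (hp.dvd_mul.mp h2).elim (hn j) fun h3 => ?_
  refine (hm j).not_ge (hp.dvd_factorial.mp ?_)
  rw [← Nat.choose_mul_factorial_mul_factorial (hi j), mul_assoc]
  exact h3.mul_right _

theorem binom_mul {n l i : Fin f → ℕ} (hi : i ≤ l) :
    binom p n l * binom p l i = binom p n i * binom p (n - i) (l - i) := by
  simp only [binom, ← Finset.prod_mul_distrib, Pi.sub_apply, ← Nat.cast_mul,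
    fun j => Nat.choose_mul (n := n j) (hi j)]

theorem prod_pow_eq_of_modEq [NeZero f] {r s l : Fin f → ℕ} (hr : l ≤ r) (hs : l ≤ s)
    (h : (∑ j : Fin f, r j * p ^ (j : ℕ)) ≡ (∑ j : Fin f, s j * p ^ (j : ℕ)) [MOD p ^ f - 1])
    {a : GaloisField p f} (ha : a ≠ 0) :
    ∏ j : Fin f, (a ^ p ^ (j : ℕ)) ^ (r j - l j) =
      ∏ j : Fin f, (a ^ p ^ (j : ℕ)) ^ (s j - l j) := by
  have e {n : Fin f → ℕ} (hn : l ≤ n) : (∑ j : Fin f, p ^ (j : ℕ) * (n j - l j)) +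
      ∑ j : Fin f, l j * p ^ (j : ℕ) = ∑ j : Fin f, n j * p ^ (j : ℕ) := by
    rw [← Finset.sum_add_distrib]
    refine Finset.sum_congr rfl fun j _ => ?_
    rw [mul_comm, ← add_mul, Nat.sub_add_cancel (hn j)]
  rw [← e hr, ← e hs] at h
  have h1 : a ^ (p ^ f - 1) = 1 := by
    refine mul_right_cancel₀ ha ?_
    rw [one_mul, pow_sub_one_mul (pow_ne_zero _ (Fact.out : p.Prime).ne_zero), pow_card]
  simp only [← pow_mul, Finset.prod_pow_eq_pow_sum]
  rw [pow_eq_pow_mod _ h1, Nat.ModEq.add_right_cancel' _ h, ← pow_eq_pow_mod _ h1]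

/-- Jets of order at most `m` in multidegrees `r` and `s` correspond to each other under the
rescaling `y^l ↦ C(s,l)/C(r,l) · y^l`. -/
def JetRel (r s m : Fin f → ℕ) (P Q : TwPoly p f) : Prop :=
  ∀ l : Fin f →₀ ℕ, (∀ j, l j ≤ m j) →
    binom p r l * coeff l (dehom Q) = binom p s l * coeff l (dehom P)

/-- The rescaling of jets is equivariant for the stabiliser of `y = 0`. -/
theorem JetRel.actHom [NeZero f] {r s m : Fin f → ℕ} (hm : ∀ j, m j < p) (hr : m ≤ r) (hs : m ≤ s)
    (hcr : ∀ j, ¬ p ∣ (r j).choose (m j))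
    (hcong : (∑ j : Fin f, r j * p ^ (j : ℕ)) ≡
      (∑ j : Fin f, s j * p ^ (j : ℕ)) [MOD p ^ f - 1])
    {b : Matrix (Fin 2) (Fin 2) (GaloisField p f)} (hb : b 0 1 = 0) (hb0 : b 0 0 ≠ 0)
    {P Q : TwPoly p f} (hP : IsWeightedHomogeneous (multiWt f) P r)
    (hQ : IsWeightedHomogeneous (multiWt f) Q s) (h : JetRel r s m P Q) :
    JetRel r s m (TwistedPeriodicity.actHom b P) (TwistedPeriodicity.actHom b Q) := by
  intro l hl
  rw [coeff_dehom_actHom hb hP, coeff_dehom_actHom hb hQ, Finset.mul_sum, Finset.mul_sum]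
  refine Finset.sum_congr rfl fun i hi => ?_
  have hil : (i : Fin f → ℕ) ≤ l := fun j => (Finset.mem_Iic.mp hi : i ≤ l) j
  have him (j : Fin f) : i j ≤ m j := (hil j).trans (hl j)
  have h1 := h i him
  have h2 := binom_mul (p := p) (n := r) hil
  have h3 := binom_mul (p := p) (n := s) hil
  have h4 := prod_pow_eq_of_modEq (fun j => (hl j).trans (hr j)) (fun j => (hl j).trans (hs j))
    hcong hb0
  simp only [binom, Pi.sub_apply] at h1 h2 h3 ⊢
  have split (x y z : Fin f → GaloisField p f) :
      ∏ j, x j * y j * z j = (∏ j, x j) * (∏ j, y j) * ∏ j, z j := by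
    simp only [Finset.prod_mul_distrib]
  rw [split, split, h4]
  refine mul_left_cancel₀ (binom_ne_zero hm hcr him) ?_
  simp only [binom]
  generalize (∏ j : Fin f, (b 0 0 ^ p ^ (j : ℕ)) ^ (s j - l j)) = A
  generalize (∏ j : Fin f, ((b 1 0 ^ p ^ (j : ℕ)) ^ (l j - i j) *
    (b 1 1 ^ p ^ (j : ℕ)) ^ i j)) = E
  linear_combination (A * E) * ((∏ j, ((r j).choose (l j) : GaloisField p f)) *
    (∏ j, ((s j - i j).choose (l j - i j) : GaloisField p f)) * h1 -
    (∏ j, ((r j).choose (l j) : GaloisField p f)) * coeff i (dehom P) * h3 +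
    (∏ j, ((s j).choose (l j) : GaloisField p f)) * coeff i (dehom P) * h2)

theorem exists_eq_mul_pointRep {K : Type*} [Field K] {g : Matrix (Fin 2) (Fin 2) K}
    (hg : g.det ≠ 0) :
    ∃ (b : Matrix (Fin 2) (Fin 2) K) (t : Option K),
      b 0 1 = 0 ∧ b 0 0 ≠ 0 ∧ g = b * pointRep t := by
  rw [Matrix.det_fin_two] at hg
  by_cases h : g 0 0 = 0
  · refine ⟨!![g 0 1, g 0 0; g 1 1, g 1 0], none, h, fun h1 => hg ?_, ?_⟩
    · have : g 0 1 = 0 := h1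
      simp [h, this]
    · ext i j
      fin_cases i <;> fin_cases j <;> simp [pointRep, Matrix.mul_apply, Fin.sum_univ_two]
  · refine ⟨!![g 0 0, 0; g 1 0, g 1 1 - g 1 0 * (g 0 1 / g 0 0)], some (g 0 1 / g 0 0), rfl, h, ?_⟩
    ext i j
    fin_cases i <;> fin_cases j <;>
      simp [pointRep, Matrix.mul_apply, Fin.sum_univ_two, mul_div_cancel₀, h]

end Stabiliser

section Transfer

variable {p f : ℕ} [Fact p.Prime]

/-- The rescaling of all jets from multidegree `r` to multidegree `s`. -/
noncomputable def rescale (p : ℕ) [Fact p.Prime] (r s m : Fin f → ℕ) :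
    (JetIdx m × Option (GaloisField p f) → GaloisField p f) →ₗ[GaloisField p f]
      (JetIdx m × Option (GaloisField p f) → GaloisField p f) :=
  LinearMap.pi fun x => (binom p s x.1.toNat / binom p r x.1.toNat) • LinearMap.proj x

theorem rescale_apply (r s m : Fin f → ℕ)
    (φ : JetIdx m × Option (GaloisField p f) → GaloisField p f)
    (x : JetIdx m × Option (GaloisField p f)) :
    rescale p r s m φ x = binom p s x.1.toNat / binom p r x.1.toNat * φ x := rfl

theorem rescale_rescale {r s m : Fin f → ℕ} (hm : ∀ j, m j < p)
    (hcr : ∀ j, ¬ p ∣ (r j).choose (m j)) (hcs : ∀ j, ¬ p ∣ (s j).choose (m j))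
    (φ : JetIdx m × Option (GaloisField p f) → GaloisField p f) :
    rescale p s r m (rescale p r s m φ) = φ := by
  funext x
  have h1 := binom_ne_zero (f := f) hm hcr x.1.toNat_le
  have h2 := binom_ne_zero (f := f) hm hcs x.1.toNat_le
  rw [rescale_apply, rescale_apply]
  field_simp

variable [NeZero f]

/-- The map replacing `P` of multidegree `r` by the normal form of multidegree `s` with the
rescaled jets. -/
noncomputable def transfer {s m : Fin f → ℕ} (r : Fin f → ℕ) (hm : ∀ j, m j < p)
    (hs : ∀ j, thetaDeg p m j + p ≤ s j) : TwPoly p f →ₗ[GaloisField p f] TwPoly p f :=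
  normalForm p s m ∘ₗ (jetsEquiv hm hs).symm.toLinearMap ∘ₗ rescale p r s m ∘ₗ jets p m

theorem jets_transfer {s m : Fin f → ℕ} (r : Fin f → ℕ) (hm : ∀ j, m j < p)
    (hs : ∀ j, thetaDeg p m j + p ≤ s j) (P : TwPoly p f) :
    jets p m (transfer r hm hs P) = rescale p r s m (jets p m P) :=
  (jetsEquiv hm hs).apply_symm_apply _

theorem transfer_isWeightedHomogeneous {s m : Fin f → ℕ} (r : Fin f → ℕ) (hm : ∀ j, m j < p)
    (hs : ∀ j, thetaDeg p m j + p ≤ s j) (P : TwPoly p f) :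
    IsWeightedHomogeneous (multiWt f) (transfer r hm hs P) s :=
  normalForm_isWeightedHomogeneous hs _

/-- Polynomials with corresponding jets at all points have corresponding translates. -/
theorem jetRel_actHom_of_jets_eq {r s m : Fin f → ℕ} (hm : ∀ j, m j < p) (hr : m ≤ r) (hs : m ≤ s)
    (hcr : ∀ j, ¬ p ∣ (r j).choose (m j))
    (hcong : (∑ j : Fin f, r j * p ^ (j : ℕ)) ≡
      (∑ j : Fin f, s j * p ^ (j : ℕ)) [MOD p ^ f - 1])
    {P Q : TwPoly p f} (hP : IsWeightedHomogeneous (multiWt f) P r)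
    (hQ : IsWeightedHomogeneous (multiWt f) Q s)
    (h : jets p m Q = rescale p r s m (jets p m P))
    {g : Matrix (Fin 2) (Fin 2) (GaloisField p f)} (hg : g.det ≠ 0) :
    JetRel r s m (actHom g P) (actHom g Q) := by
  obtain ⟨b, t, hb, hb0, rfl⟩ := exists_eq_mul_pointRep hg
  rw [actHom_mul, actHom_mul]
  refine JetRel.actHom hm hr hs hcr hcong hb hb0 (actHom_isWeightedHomogeneous _ hP)
    (actHom_isWeightedHomogeneous _ hQ) fun l hl => ?_
  let k : JetIdx m := fun j => ⟨l j, Nat.lt_succ_of_le (hl j)⟩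
  have hk : k.toFinsupp = l := Finsupp.ext fun _ => rfl
  have h1 := congrFun h (k, t)
  rw [rescale_apply, jets_apply, jets_apply, hk] at h1
  have h2 : binom p r l ≠ 0 := binom_ne_zero hm hcr hl
  rw [h1]
  change binom p r l * (binom p s l / binom p r l * _) = _
  field_simp

/-- The transfer is equivariant up to polynomials with vanishing jets. -/
theorem jets_transfer_actHom {r s m : Fin f → ℕ} (hm : ∀ j, m j < p)
    (hs : ∀ j, thetaDeg p m j + p ≤ s j) (hmr : m ≤ r) (hms : m ≤ s)
    (hcr : ∀ j, ¬ p ∣ (r j).choose (m j))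
    (hcong : (∑ j : Fin f, r j * p ^ (j : ℕ)) ≡
      (∑ j : Fin f, s j * p ^ (j : ℕ)) [MOD p ^ f - 1])
    {P : TwPoly p f} (hP : IsWeightedHomogeneous (multiWt f) P r)
    {g : Matrix (Fin 2) (Fin 2) (GaloisField p f)} (hg : g.det ≠ 0) :
    jets p m (transfer r hm hs (actHom g P)) = jets p m (actHom g (transfer r hm hs P)) := by
  rw [jets_transfer]
  funext ⟨k, t⟩
  have hkt := jetRel_actHom_of_jets_eq hm hmr hms hcr hcong hP
    (transfer_isWeightedHomogeneous r hm hs P) (jets_transfer r hm hs P)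
    (g := pointRep t * g) (by rw [Matrix.det_mul]; exact mul_ne_zero (det_pointRep_ne_zero t) hg)
    k.toFinsupp k.toNat_le
  rw [rescale_apply, jets_apply, jets_apply, ← actHom_mul, ← actHom_mul, div_mul_eq_mul_div,
    div_eq_iff (binom_ne_zero hm hcr k.toNat_le), mul_comm _ (binom _ _ _)]
  exact hkt.symm

theorem thetaDeg_add_le_of_le {r m : Fin f → ℕ} (hm : ∀ j, m j < p)
    (hr : ∀ j, (m j + 1) * (p ^ f + 1) ≤ r j) (j : Fin f) : thetaDeg p m j + p ≤ r j := by
  refine le_trans ?_ (hr j)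
  have hp := (Fact.out : p.Prime).two_le
  unfold thetaDeg
  rcases (Nat.one_le_iff_ne_zero.mpr (NeZero.ne f)).eq_or_lt with rfl | hf
  · rw [Subsingleton.elim (j + 1) j]
    nlinarith
  · have h1 : p ^ 2 ≤ p ^ f := Nat.pow_le_pow_right (by omega) hf
    have h2 : p * (m (j + 1) + 1) ≤ p * p := Nat.mul_le_mul_left p (hm (j + 1))
    nlinarith [Nat.zero_le (m j * p ^ f)]

end Transfer

end TwistedPeriodicity

open TwistedPeriodicity

/-- twisted periodicity: under the stated hypotheses, with
`Σ r_j p^j ≡ Σ s_j p^j mod (q−1)`, there is a `G`-equivariant isomorphism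
`(⊗_j V_{r_j}^{Fr^j}) / ⟨θ_0^{m_0+1},…⟩ ≅ (⊗_j V_{s_j}^{Fr^j}) / ⟨θ_0^{m_0+1},…⟩`,
expressed here by a linear map `Φ` lifting it. -/
theorem twisted_periodicity (p f : ℕ) [Fact p.Prime] [NeZero f]
    (r s m : Fin f → ℕ) (hm : ∀ j, m j ≤ p - 1)
    (hr1 : ∀ j : Fin f, p ^ (f - (j : ℕ)) ≤ r j)
    (hs1 : ∀ j : Fin f, p ^ (f - (j : ℕ)) ≤ s j)
    (hr2 : ∀ j, (m j + 1) * (p ^ f + 1) ≤ r j)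
    (hs2 : ∀ j, (m j + 1) * (p ^ f + 1) ≤ s j)
    (hcr : ∀ j, ¬ p ∣ Nat.choose (r j) (m j))
    (hcs : ∀ j, ¬ p ∣ Nat.choose (s j) (m j))
    (hcong : (∑ j : Fin f, r j * p ^ (j : ℕ)) ≡
      (∑ j : Fin f, s j * p ^ (j : ℕ)) [MOD p ^ f - 1]) :
    ∃ Φ : MvPolynomial (Fin f × Fin 2) (GaloisField p f) →ₗ[GaloisField p f]
        MvPolynomial (Fin f × Fin 2) (GaloisField p f),
      -- `Φ` maps the multidegree-`r` component to the multidegree-`s` component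
      (∀ P, IsMultiHom p f r P → IsMultiHom p f s (Φ P)) ∧
      -- the induced map on the quotients is well defined and injective
      (∀ P, IsMultiHom p f r P →
        (Φ P ∈ Ideal.span (Set.range fun j : Fin f => thetaTw p f j ^ (m j + 1)) ↔
          P ∈ Ideal.span (Set.range fun j : Fin f => thetaTw p f j ^ (m j + 1)))) ∧
      -- the induced map is surjective
      (∀ Q, IsMultiHom p f s Q →
        ∃ P, IsMultiHom p f r P ∧
          Φ P - Q ∈ Ideal.span (Set.range fun j : Fin f => thetaTw p f j ^ (m j + 1))) ∧
      -- the induced map is `G`-equivariant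
      (∀ g : Matrix.GeneralLinearGroup (Fin 2) (GaloisField p f),
        ∀ P, IsMultiHom p f r P →
          Φ (actTw p f g.val P) - actTw p f g.val (Φ P) ∈
            Ideal.span (Set.range fun j : Fin f => thetaTw p f j ^ (m j + 1))) := by
  have hm' (j : Fin f) : m j < p := by
    have := hm j
    have := (Fact.out : p.Prime).pos
    omega
  have hr := thetaDeg_add_le_of_le hm' hr2
  have hs := thetaDeg_add_le_of_le hm' hs2
  have hmr : m ≤ r := fun j =>
    (Nat.le_succ _).trans ((Nat.le_mul_of_pos_right _ (Nat.succ_pos _)).trans (hr2 j))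
  have hms : m ≤ s := fun j =>
    (Nat.le_succ _).trans ((Nat.le_mul_of_pos_right _ (Nat.succ_pos _)).trans (hs2 j))
  refine ⟨transfer r hm' hs, fun P _ => ?_, fun P hP => ?_, fun Q hQ => ?_, fun g P hP => ?_⟩
  · exact isMultiHom_iff.mpr (transfer_isWeightedHomogeneous r hm' hs P)
  · refine (mem_thetaIdeal_iff hm' hs (transfer_isWeightedHomogeneous r hm' hs P)).trans
      (Iff.trans ?_ (mem_thetaIdeal_iff hm' hr (isMultiHom_iff.mp hP)).symm)
    rw [jets_transfer]
    refine ⟨fun h => ?_, fun h => by rw [h, map_zero]⟩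
    rw [← rescale_rescale hm' hcr hcs (jets p m P), h, map_zero]
  · have hP := transfer_isWeightedHomogeneous s hm' hr Q
    refine ⟨transfer s hm' hr Q, isMultiHom_iff.mpr hP, (mem_thetaIdeal_iff hm' hs
      ((transfer_isWeightedHomogeneous r hm' hs _).sub (isMultiHom_iff.mp hQ))).mpr ?_⟩
    rw [map_sub, jets_transfer, jets_transfer, rescale_rescale hm' hcs hcr, sub_self]
  · rw [actTw_apply, actTw_apply]
    refine (mem_thetaIdeal_iff hm' hs ((transfer_isWeightedHomogeneous r hm' hs _).sub
      (actHom_isWeightedHomogeneous _ (transfer_isWeightedHomogeneous r hm' hs _)))).mpr ?_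
    rw [map_sub, jets_transfer_actHom hm' hs hmr hms hcr hcong (isMultiHom_iff.mp hP)
      ((Matrix.isUnit_iff_isUnit_det _).mp g.isUnit).ne_zero, sub_self]
end

section
/- Let p be a prime, let a, b, c, d, z ∈ 𝔽_p, and let P ∈ 𝔽_p[X,Y] be homogeneous of degree r. Write ∇ = a∂/∂X + b∂/∂Y and ∇' = c∂/∂X + d∂/∂Y. Then for all integers 0 ≤ k ≤ t ≤ r, the identity (∇^{t−k}∇'^{k}(P))(zc, zd) = z^{r−t}·[r−t+k]_k·(∇^{t−k}(P))(c, d) holds in 𝔽_p. -/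
open MvPolynomial

/-- The differential operator `∇ = a ∂/∂X + b ∂/∂Y` on `𝔽_p[X,Y]`. -/
noncomputable def nabla {p : ℕ} (a b : ZMod p) :
    Module.End (ZMod p) (MvPolynomial (Fin 2) (ZMod p)) :=
  a • (pderiv (0 : Fin 2)).toLinearMap + b • (pderiv (1 : Fin 2)).toLinearMap

/-- The falling factorial `[n]_k = n(n-1)⋯(n-k+1)` as an element of `ZMod p`,
for an integer `n`. -/
def fallingFacZMod (p : ℕ) (n : ℤ) (k : ℕ) : ZMod p :=
  ∏ i ∈ Finset.range k, ((n : ZMod p) - (i : ZMod p))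

theorem fallingFacZMod_succ (p : ℕ) (n : ℤ) (k : ℕ) :
    fallingFacZMod p (n + 1) (k + 1) = ((n + 1 : ℤ) : ZMod p) * fallingFacZMod p n k := by
  simp only [fallingFacZMod, Finset.prod_range_succ', Nat.cast_zero, sub_zero]
  rw [mul_comm]
  congr 1
  refine Finset.prod_congr rfl fun i _ => ?_
  push_cast
  ring

theorem nabla_apply {p : ℕ} (a b : ZMod p) (P : MvPolynomial (Fin 2) (ZMod p)) :
    nabla a b P = a • pderiv 0 P + b • pderiv 1 P :=
  rfl

theorem commute_nabla {p : ℕ} (a b c d : ZMod p) : Commute (nabla a b) (nabla c d) := by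
  have pderiv_comm (P : MvPolynomial (Fin 2) (ZMod p)) :
      pderiv 0 (pderiv 1 P) = pderiv 1 (pderiv 0 P) := by
    have h : ⁅pderiv (R := ZMod p) (0 : Fin 2), pderiv (R := ZMod p) (1 : Fin 2)⁆ = 0 := by
      refine MvPolynomial.derivation_ext fun i => ?_
      fin_cases i <;> simp [Derivation.commutator_apply, pderiv_X]
    have h' := DFunLike.congr_fun h P
    rwa [Derivation.commutator_apply, Derivation.zero_apply, sub_eq_zero] at h'
  refine LinearMap.ext fun P => ?_
  simp only [Module.End.mul_apply, nabla_apply, map_add, map_smul, pderiv_comm]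
  module

theorem MvPolynomial.IsHomogeneous.nabla {p n : ℕ} {P : MvPolynomial (Fin 2) (ZMod p)}
    (hP : P.IsHomogeneous n) (a b : ZMod p) : (nabla a b P).IsHomogeneous (n - 1) := by
  rw [nabla_apply, smul_eq_C_mul, smul_eq_C_mul]
  exact (hP.pderiv.C_mul a).add (hP.pderiv.C_mul b)

theorem MvPolynomial.IsHomogeneous.nabla_pow {p n : ℕ} {P : MvPolynomial (Fin 2) (ZMod p)}
    (hP : P.IsHomogeneous n) (a b : ZMod p) (j : ℕ) :
    ((_root_.nabla a b ^ j) P).IsHomogeneous (n - j) := by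
  induction j with
  | zero => simpa using hP
  | succ j ih =>
    rw [pow_succ', Module.End.mul_apply, ← Nat.sub_sub]
    exact ih.nabla a b

theorem MvPolynomial.IsHomogeneous.eval_mul_left {σ R : Type*} [CommSemiring R] {n : ℕ}
    {P : MvPolynomial σ R} (hP : P.IsHomogeneous n) (z : R) (v : σ → R) :
    eval (fun i => z * v i) P = z ^ n * eval v P := by
  rw [eval_eq, eval_eq, Finset.mul_sum]
  refine Finset.sum_congr rfl fun s hs => ?_
  have hdeg : ∑ i ∈ s.support, s i = n := by
    rw [← hP (mem_support_iff.mp hs), Finsupp.weight_apply, Finsupp.sum]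
    simp
  simp only [mul_pow, Finset.prod_mul_distrib, Finset.prod_pow_eq_pow_sum, hdeg]
  ring

theorem MvPolynomial.IsHomogeneous.eval_nabla_self {p n : ℕ}
    {P : MvPolynomial (Fin 2) (ZMod p)} (hP : P.IsHomogeneous n) (c d : ZMod p) :
    eval ![c, d] (_root_.nabla c d P) = n * eval ![c, d] P := by
  have h := congrArg (eval ![c, d]) hP.sum_X_mul_pderiv
  simpa [nabla_apply, Fin.sum_univ_two, smul_eval] using h

theorem MvPolynomial.IsHomogeneous.eval_nabla_pow_self {p m k : ℕ}
    {P : MvPolynomial (Fin 2) (ZMod p)} (hP : P.IsHomogeneous (m + k)) (c d : ZMod p) :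
    eval ![c, d] ((_root_.nabla c d ^ k) P) =
      fallingFacZMod p (m + k) k * eval ![c, d] P := by
  induction k generalizing P with
  | zero => simp [fallingFacZMod]
  | succ k ih =>
    rw [pow_succ, Module.End.mul_apply, ih (hP.nabla c d), hP.eval_nabla_self, Nat.cast_succ,
      ← add_assoc (m : ℤ), fallingFacZMod_succ]
    push_cast
    ring

/-- for a homogeneous `P` of degree `r` and `0 ≤ k ≤ t ≤ r`,
`(∇^{t−k}∇'^{k}(P))(zc, zd) = z^{r−t}·[r−t+k]_k·(∇^{t−k}(P))(c, d)` in `𝔽_p`. -/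
theorem nabla_eval_smul (p : ℕ) [Fact p.Prime] (a b c d z : ZMod p) (r : ℕ)
    (P : MvPolynomial (Fin 2) (ZMod p))
    (hP : P ∈ homogeneousSubmodule (Fin 2) (ZMod p) r)
    (k t : ℕ) (hk : k ≤ t) (ht : t ≤ r) :
    eval ![z * c, z * d] ((nabla a b ^ (t - k) * nabla c d ^ k) P) =
      z ^ (r - t) * fallingFacZMod p ((r : ℤ) - (t : ℤ) + (k : ℤ)) k *
        eval ![c, d] ((nabla a b ^ (t - k)) P) := by
  rw [mem_homogeneousSubmodule] at hP
  have hQ : ((nabla a b ^ (t - k)) P).IsHomogeneous (r - t + k) := by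
    convert hP.nabla_pow a b (t - k) using 1
    omega
  have hv : ![z * c, z * d] = fun i => z * ![c, d] i := by
    ext i
    fin_cases i <;> rfl
  have hdeg := hQ.nabla_pow c d k
  rw [Nat.add_sub_cancel] at hdeg
  rw [((commute_nabla a b c d).pow_pow (t - k) k).eq, Module.End.mul_apply, hv,
    hdeg.eval_mul_left, hQ.eval_nabla_pow_self, Nat.cast_sub ht, mul_assoc]
end

section
/- Let q be a prime power and let P ∈ 𝔽_q[X,Y] be a homogeneous polynomial of degree r. If P(c,d) = 0 for every pair (c,d) ∈ 𝔽_q × 𝔽_q with (c,d) ≠ (0,0), then P lies in the ideal of 𝔽_q[X,Y] generated by θ' = X^q·Y − X·Y^q. -/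
open MvPolynomial

theorem Polynomial.X_pow_card_sub_X_dvd_of_eval_eq_zero {K : Type*} [Field K] [Fintype K]
    {p : Polynomial K} (h : ∀ c, p.eval c = 0) :
    (Polynomial.X ^ Fintype.card K - Polynomial.X : Polynomial K) ∣ p := by
  obtain rfl | hp := eq_or_ne p 0
  · exact dvd_zero _
  have hsplits : (Polynomial.X ^ Fintype.card K - Polynomial.X : Polynomial K).Splits := by
    rw [Polynomial.splits_iff_card_roots, FiniteField.roots_X_pow_card_sub_X,
      FiniteField.X_pow_card_sub_X_natDegree_eq K Fintype.one_lt_card]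
    rfl
  refine hsplits.dvd_of_roots_le_roots
    (FiniteField.X_pow_card_sub_X_ne_zero K Fintype.one_lt_card) ?_
  rw [FiniteField.roots_X_pow_card_sub_X, Multiset.le_iff_subset Finset.univ.nodup]
  exact fun c _ ↦ (Polynomial.mem_roots hp).2 (h c)

theorem Polynomial.eval_homogenize_one_zero {R : Type*} [CommSemiring R] (p : Polynomial R)
    (n : ℕ) : MvPolynomial.eval ![1, 0] (p.homogenize n) = p.coeff n := by
  rw [Polynomial.homogenize, MvPolynomial.eval_sum, Finset.sum_eq_single (n, 0)]
  · simp [MvPolynomial.eval_monomial, Finsupp.prod_fintype]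
  · rintro ⟨a, b⟩ hab hne
    have hb : b ≠ 0 := by
      rintro rfl
      simp_all
    simp [MvPolynomial.eval_monomial, Finsupp.prod_fintype, hb]
  · simp

/-- if a homogeneous polynomial `P ∈ 𝔽_q[X,Y]` of degree `r` vanishes at every
`(c,d) ≠ (0,0)`, then `P` lies in the ideal generated by `θ' = X^q·Y − X·Y^q`.
Here `𝔽_q` is a finite field with `q = Fintype.card F` elements (a prime power). -/
theorem homogeneous_vanishing_mem_span_theta' (F : Type*) [Field F] [Fintype F] (r : ℕ)
    (P : MvPolynomial (Fin 2) F) (hP : P ∈ homogeneousSubmodule (Fin 2) F r)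
    (hvanish : ∀ c d : F, (c, d) ≠ (0, 0) → eval ![c, d] P = 0) :
    P ∈ Ideal.span
      {(X 0 : MvPolynomial (Fin 2) F) ^ Fintype.card F * X 1 -
        X 0 * X 1 ^ Fintype.card F} := by
  rw [mem_homogeneousSubmodule] at hP
  rw [Ideal.mem_span_singleton]
  have hq : 1 < Fintype.card F := Fintype.one_lt_card
  set p : Polynomial F := aeval ![Polynomial.X, 1] P
  have hPp : p.homogenize r = P := Polynomial.homogenize_eq_of_isHomogeneous hP rfl
  have hdeg : p.natDegree ≤ r := by
    simpa using aeval_natDegree_le P hP.totalDegree_le ![Polynomial.X, 1] (n := 1)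
      (by simp [Fin.forall_fin_two])
  have hroot (c : F) : p.eval c = 0 := by
    simpa [← hPp, Polynomial.eval_homogenize hdeg] using hvanish c 1 (by simp)
  have hcoeff : p.coeff r = 0 := by
    rw [← Polynomial.eval_homogenize_one_zero, hPp]
    exact hvanish 1 0 (by simp)
  obtain ⟨g, hg⟩ := Polynomial.X_pow_card_sub_X_dvd_of_eval_eq_zero hroot
  obtain hp0 | hp0 := eq_or_ne p 0
  · simp [← hPp, hp0]
  have hlt : p.natDegree < r := hdeg.lt_of_ne fun h ↦ hp0 <| by
    rwa [← h, Polynomial.coeff_natDegree, Polynomial.leadingCoeff_eq_zero] at hcoeff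
  have hXdeg : (Polynomial.X ^ Fintype.card F - Polynomial.X : Polynomial F).natDegree = Fintype.card F :=
    FiniteField.X_pow_card_sub_X_natDegree_eq F hq
  have hgdeg : p.natDegree = Fintype.card F + g.natDegree := by
    rw [hg, Polynomial.natDegree_mul (FiniteField.X_pow_card_sub_X_ne_zero F hq)
      (right_ne_zero_of_mul (hg ▸ hp0)), hXdeg]
  obtain ⟨m, rfl⟩ : ∃ m, r = (Fintype.card F + 1) + m := Nat.exists_eq_add_of_le (by omega)
  refine ⟨g.homogenize m, ?_⟩
  rw [← hPp, hg, Polynomial.homogenize_mul _ _ (by omega) (by omega), Polynomial.homogenize_sub,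
    Polynomial.homogenize_X_pow (by omega), Polynomial.homogenize_X (by omega)]
  simp
end
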